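/- Let R > 0 and 0 < α < 1, and let B_R ⊆ ℝ² be the open ball of radius R centered at the origin with outward unit normal ν(x) = x/R on ∂B_R. There is a constant C = C(R, α) such that: for every f₁ that is α-Hölder continuous on the closure of B_R and every f₂ that is C^{1,α} on ∂B_R, both even in x₁ (invariant under (x₁,x₂) ↦ (−x₁,x₂)), there exist a function φ ∈ C^{2,α} on the closure of B_R, even in x₁, and a real number g, both depending linearly on (f₁, f₂), such that Δφ = f₁ in B_R, and ∂φ/∂ν − φ/R = f₂ + g·(x₂ + R) on ∂B_R, with ‖φ‖_{C^{2,α}} + |g| ≤ C (‖f₁‖_{C^{α}} + ‖f₂‖_{C^{1,α}}). -/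

import Mathlib

open Complex Metric Set

/-- Second partial derivatives Laplacian for functions on `ℂ ≃ ℝ²`. -/
noncomputable def lap (f : ℂ → ℝ) (z : ℂ) : ℝ :=
  fderiv ℝ (fun w => fderiv ℝ f w 1) z 1 +
    fderiv ℝ (fun w => fderiv ℝ f w Complex.I) z Complex.I

section RobinProblem

open MeasureTheory
open scoped ComplexConjugate

/-- The radial weight dominating all the regularised kernels, at scale `t`. -/
noncomputable def radialWeight (α t : ℝ) (z : ℂ) : ℝ := ‖z‖ ^ (α - 2) * (t / (‖z‖ + t))

theorem radialWeight_nonneg {α t : ℝ} (ht : 0 ≤ t) (z : ℂ) : 0 ≤ radialWeight α t z := by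
  unfold radialWeight; positivity

theorem integrable_radialWeight_one {α : ℝ} (h0 : 0 < α) (h1 : α < 1) :
    Integrable (radialWeight α 1) := by
  have key : Integrable (fun z : ℂ => (fun r : ℝ => r ^ (α - 2) * (1 / (r + 1))) ‖z‖) := by
    refine (integrable_fun_norm_addHaar volume
      (f := fun r : ℝ => r ^ (α - 2) * (1 / (r + 1)))).2 ?_
    rw [Complex.finrank_real_complex, ← Ioc_union_Ioi_eq_Ioi zero_le_one]
    have hcont : ContinuousOn
        (fun y : ℝ => y ^ (2 - 1) • (y ^ (α - 2) * (1 / (y + 1)))) (Ioi 0) := by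
      intro y hy
      have hy' : 0 < y := hy
      apply ContinuousAt.continuousWithinAt
      have : y + 1 ≠ 0 := by positivity
      have h2 : ContinuousAt (fun y : ℝ => y ^ (α - 2)) y :=
        Real.continuousAt_rpow_const _ _ (Or.inl hy'.ne')
      fun_prop (disch := assumption)
    refine IntegrableOn.union ?_ ?_
    · have h : IntegrableOn (fun y : ℝ => y ^ (α - 1)) (Ioc 0 1) := by
        rw [← intervalIntegrable_iff_integrableOn_Ioc_of_le zero_le_one]
        exact intervalIntegral.intervalIntegrable_rpow' (by linarith)
      refine Integrable.mono' h
        ((hcont.mono Ioc_subset_Ioi_self).aestronglyMeasurable measurableSet_Ioc) ?_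
      filter_upwards [self_mem_ae_restrict measurableSet_Ioc] with y hy
      have hy0 : 0 < y := hy.1
      have e : y ^ (2 - 1) • (y ^ (α - 2) * (1 / (y + 1))) = y ^ (α - 1) * (1 / (y + 1)) := by
        rw [show α - 1 = (α - 2) + 1 by ring, Real.rpow_add hy0, Real.rpow_one]
        simp; ring
      rw [e, Real.norm_of_nonneg (by positivity)]
      refine mul_le_of_le_one_right (by positivity) ?_
      rw [div_le_one (by positivity)]; linarith
    · have h : IntegrableOn (fun y : ℝ => y ^ (α - 2)) (Ioi 1) :=
        integrableOn_Ioi_rpow_of_lt (by linarith) one_pos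
      refine Integrable.mono' h
        ((hcont.mono (Ioi_subset_Ioi zero_le_one)).aestronglyMeasurable measurableSet_Ioi) ?_
      filter_upwards [self_mem_ae_restrict measurableSet_Ioi] with y hy
      have hy1 : 1 < y := hy
      have hy0 : 0 < y := by linarith
      rw [Real.norm_of_nonneg (by positivity)]
      simp only [smul_eq_mul, Nat.add_one_sub_one, pow_one]
      have : y * (1 / (y + 1)) ≤ 1 := by
        rw [mul_one_div, div_le_one (by positivity)]; linarith
      have h3 : 0 ≤ y ^ (α - 2) := by positivity
      calc y * (y ^ (α - 2) * (1 / (y + 1))) = y ^ (α - 2) * (y * (1 / (y + 1))) := by ring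
        _ ≤ _ := mul_le_of_le_one_right h3 this
  exact key

theorem radialWeight_scale {α t : ℝ} (ht : 0 < t) (z : ℂ) :
    radialWeight α t z = t ^ (α - 2) * radialWeight α 1 (t⁻¹ • z) := by
  unfold radialWeight
  rw [norm_smul, Real.norm_of_nonneg (by positivity : (0:ℝ) ≤ t⁻¹),
    Real.mul_rpow (by positivity) (norm_nonneg z), Real.inv_rpow ht.le]
  have : t ^ (α - 2) ≠ 0 := by positivity
  have h2 : t ≠ 0 := ht.ne'
  have h3 : ‖z‖ + t ≠ 0 := by positivity
  field_simp

theorem integrable_radialWeight {α t : ℝ} (h0 : 0 < α) (h1 : α < 1) (ht : 0 < t) :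
    Integrable (radialWeight α t) := by
  rw [show radialWeight α t = fun z => t ^ (α - 2) * radialWeight α 1 (t⁻¹ • z) from
    funext (radialWeight_scale ht)]
  exact ((integrable_radialWeight_one h0 h1).comp_smul (by positivity)).const_mul _

theorem integral_radialWeight {α t : ℝ} (ht : 0 < t) :
    ∫ z, radialWeight α t z = t ^ α * ∫ z, radialWeight α 1 z := by
  rw [funext (radialWeight_scale ht), integral_const_mul,
    Measure.integral_comp_smul, Complex.finrank_real_complex]
  have : t ^ α = t ^ (α - 2) * t ^ 2 := by
    rw [← Real.rpow_natCast t 2, ← Real.rpow_add ht]; norm_num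
  rw [this, abs_of_pos (by positivity), inv_pow, inv_inv, smul_eq_mul]; ring

theorem integrableOn_norm_rpow_ball {α : ℝ} (h0 : 0 < α) (h1 : α < 1) (ρ : ℝ) :
    IntegrableOn (fun z : ℂ => ‖z‖ ^ (α - 2)) (ball 0 ρ) := by
  refine Integrable.mono' (g := fun z => (1 + ρ) * radialWeight α 1 z)
    ((integrable_radialWeight_one h0 h1).integrableOn.const_mul _) ?_ ?_
  · exact (by fun_prop : Measurable fun z : ℂ => ‖z‖ ^ (α - 2)).aestronglyMeasurable
  · filter_upwards [self_mem_ae_restrict measurableSet_ball] with z hz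
    rw [mem_ball_zero_iff] at hz
    rw [Real.norm_of_nonneg (by positivity), radialWeight]
    have h3 : 0 ≤ ‖z‖ ^ (α - 2) := by positivity
    have h4 : 1 ≤ (1 + ρ) * (1 / (‖z‖ + 1)) := by
      rw [mul_one_div, le_div_iff₀ (by positivity)]; linarith
    calc _ ≤ ‖z‖ ^ (α - 2) * ((1 + ρ) * (1 / (‖z‖ + 1))) := le_mul_of_one_le_right h3 h4
      _ = _ := by ring

theorem integral_regularised_delta {t : ℝ} (ht : 0 < t) :
    ∫ z : ℂ, t ^ 2 / (normSq z + t ^ 2) ^ 2 = Real.pi := by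
  have e : ∀ z : ℂ, t ^ 2 / (normSq z + t ^ 2) ^ 2 =
      (fun r : ℝ => t ^ 2 / (r ^ 2 + t ^ 2) ^ 2) ‖z‖ := fun z => by
    simp only [normSq_eq_norm_sq]
  simp_rw [e]
  rw [integral_fun_norm_addHaar volume (fun r : ℝ => t ^ 2 / (r ^ 2 + t ^ 2) ^ 2),
    Complex.finrank_real_complex]
  have hv : (volume : Measure ℂ).real (ball 0 1) = Real.pi := by
    simp [Measure.real, Complex.volume_ball]
  rw [hv]
  have h1 : ∫ y in Ioi (0:ℝ), y ^ (2 - 1) • (t ^ 2 / (y ^ 2 + t ^ 2) ^ 2) =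
      0 - (-(t ^ 2 / 2) / (0 ^ 2 + t ^ 2)) := by
    refine integral_Ioi_of_hasDerivAt_of_nonneg' (g := fun y => -(t ^ 2 / 2) / (y ^ 2 + t ^ 2))
      ?_ ?_ ?_
    · intro y _
      have hne : y ^ 2 + t ^ 2 ≠ 0 := by positivity
      have := ((hasDerivAt_const y (-(t ^ 2 / 2))).div
        (((hasDerivAt_id y).pow 2).add_const (t ^ 2)) hne)
      refine this.congr_deriv ?_
      simp; field_simp
    · intro y hy
      have : (0:ℝ) < y := hy
      simp; positivity
    · refine Filter.Tendsto.div_atTop tendsto_const_nhds ?_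
      exact Filter.tendsto_atTop_add_const_right _ _ (Filter.tendsto_pow_atTop two_ne_zero)
  rw [h1]
  simp; field_simp

theorem integrable_regularised_delta {t : ℝ} (ht : 0 < t) :
    Integrable fun z : ℂ => t ^ 2 / (normSq z + t ^ 2) ^ 2 := by
  by_contra h
  have := integral_undef h
  rw [integral_regularised_delta ht] at this
  exact Real.pi_ne_zero this

/-- The real-linear map `v ↦ a v + b conj v`. -/
noncomputable def wirtCLM (a b : ℂ) : ℂ →L[ℝ] ℂ :=
  a • (1 : ℂ →L[ℝ] ℂ) + b • (conjCLE : ℂ →L[ℝ] ℂ)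

/-- The real-linear functional `v ↦ Re (p v)`. -/
noncomputable def reMulCLM (p : ℂ) : ℂ →L[ℝ] ℝ := reCLM ∘L (p • (1 : ℂ →L[ℝ] ℂ))

@[simp] theorem wirtCLM_apply (a b v : ℂ) : wirtCLM a b v = a * v + b * conj v := by
  simp [wirtCLM]

@[simp] theorem reMulCLM_apply (p v : ℂ) : reMulCLM p v = (p * v).re := by
  simp [reMulCLM]

theorem norm_wirtCLM_le (a b : ℂ) : ‖wirtCLM a b‖ ≤ ‖a‖ + ‖b‖ := by
  refine ContinuousLinearMap.opNorm_le_bound _ (by positivity) fun v => ?_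
  rw [wirtCLM_apply]
  refine (norm_add_le _ _).trans (le_of_eq ?_)
  simp; ring

theorem norm_reMulCLM_le (p : ℂ) : ‖reMulCLM p‖ ≤ ‖p‖ := by
  refine ContinuousLinearMap.opNorm_le_bound _ (by positivity) fun v => ?_
  rw [reMulCLM_apply, ← norm_mul]
  exact abs_re_le_norm _

theorem wirtCLM_sub (a b a' b' : ℂ) : wirtCLM a b - wirtCLM a' b' = wirtCLM (a - a') (b - b') := by
  ext; simp; ring

theorem reMulCLM_sub (p q : ℂ) : reMulCLM p - reMulCLM q = reMulCLM (p - q) := by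
  ext; simp; ring

theorem hasFDerivAt_conj (z : ℂ) : HasFDerivAt (fun w : ℂ => conj w) (wirtCLM 0 1) z := by
  have h : HasFDerivAt (fun w : ℂ => conj w) (conjCLE : ℂ →L[ℝ] ℂ) z := conjCLE.hasFDerivAt
  refine h.congr_fderiv ?_
  ext; simp

theorem hasFDerivAt_normSq_add (s : ℝ) (z : ℂ) :
    HasFDerivAt (fun w : ℂ => ((normSq w + s : ℝ) : ℂ)) (wirtCLM (conj z) z) z := by
  have h := ((hasFDerivAt_id (𝕜 := ℝ) z).mul (hasFDerivAt_conj z)).add_const (s : ℂ)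
  have e : (fun w : ℂ => ((normSq w + s : ℝ) : ℂ)) = fun w => id w * conj w + (s : ℂ) := by
    ext w; simp [mul_conj]
  rw [e]
  refine h.congr_fderiv ?_
  ext; simp; ring

/-- Regularised logarithmic kernel, `log |z|` for `t = 0`. -/
noncomputable def kerL (t : ℝ) (z : ℂ) : ℝ := 1 / 2 * Real.log (normSq z + t ^ 2)

/-- Twice the `∂_z`-derivative of `kerL`. -/
noncomputable def kerP (t : ℝ) (z : ℂ) : ℂ := conj z / ((normSq z + t ^ 2 : ℝ) : ℂ)

/-- The `∂_z`-derivative of `kerP`. -/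
noncomputable def kerA (t : ℝ) (z : ℂ) : ℂ := -(conj z) ^ 2 / ((normSq z + t ^ 2 : ℝ) : ℂ) ^ 2

/-- The `∂_{z̄}`-derivative of `kerP`. -/
noncomputable def kerB (t : ℝ) (z : ℂ) : ℝ := t ^ 2 / (normSq z + t ^ 2) ^ 2

/-- The Fréchet derivative of `kerA`. -/
noncomputable def kerDA (t : ℝ) (z : ℂ) : ℂ →L[ℝ] ℂ :=
  wirtCLM (2 * conj z ^ 3 / ((normSq z + t ^ 2 : ℝ) : ℂ) ^ 3)
    (-2 * conj z / ((normSq z + t ^ 2 : ℝ) : ℂ) ^ 2 +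
      2 * conj z ^ 2 * z / ((normSq z + t ^ 2 : ℝ) : ℂ) ^ 3)

section

variable {t : ℝ}

theorem normSq_add_sq_pos (ht : 0 < t) (z : ℂ) : 0 < normSq z + t ^ 2 := by
  have := normSq_nonneg z
  positivity

theorem normSq_add_sq_ne (ht : 0 < t) (z : ℂ) : ((normSq z + t ^ 2 : ℝ) : ℂ) ≠ 0 :=
  ofReal_ne_zero.2 (normSq_add_sq_pos ht z).ne'

theorem hasFDerivAt_kerL (ht : 0 < t) (z : ℂ) : HasFDerivAt (kerL t) (reMulCLM (kerP t z)) z := by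
  have h := (reCLM.hasFDerivAt (x := ((normSq z + t ^ 2 : ℝ) : ℂ))).comp z
    (hasFDerivAt_normSq_add (t ^ 2) z)
  have h1 : HasFDerivAt (fun w : ℂ => normSq w + t ^ 2) (reCLM ∘L wirtCLM (conj z) z) z := h
  have h2 := ((Real.hasDerivAt_log (normSq_add_sq_pos ht z).ne').comp_hasFDerivAt z h1).const_mul
    (1 / 2 : ℝ)
  refine h2.congr_fderiv ?_
  ext v
  simp [kerP, -ofReal_pow, -ofReal_add, div_ofReal_re]; ring

theorem hasFDerivAt_kerP (ht : 0 < t) (z : ℂ) : HasFDerivAt (kerP t) (wirtCLM (kerA t z) (kerB t z)) z := by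
  have hne := normSq_add_sq_ne ht z
  have h := (hasFDerivAt_conj z).mul ((hasDerivAt_inv hne).comp_hasFDerivAt z
    (hasFDerivAt_normSq_add (t ^ 2) z))
  have hB : (kerB t z : ℂ) = t ^ 2 / ((normSq z + t ^ 2 : ℝ) : ℂ) ^ 2 := by
    simp [kerB]
  refine h.congr_fderiv ?_
  have e2 : ∀ v, kerA t z * v + kerB t z * conj v =
      conj z * (-(((normSq z + t ^ 2 : ℝ) : ℂ) ^ 2)⁻¹ * (conj z * v + z * conj v)) +
        (((normSq z + t ^ 2 : ℝ) : ℂ))⁻¹ * conj v := by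
    intro v
    rw [hB, kerA]
    have e : (t : ℂ) ^ 2 = ((normSq z + t ^ 2 : ℝ) : ℂ) - z * conj z := by simp [mul_conj]
    generalize ((normSq z + t ^ 2 : ℝ) : ℂ) = N at *
    rw [e]
    field_simp; ring
  ext; simp only [wirtCLM_apply, e2]; simp

theorem hasFDerivAt_kerA (ht : 0 < t) (z : ℂ) : HasFDerivAt (kerA t) (kerDA t z) z := by
  have hne := normSq_add_sq_ne ht z
  have hN := hasFDerivAt_normSq_add (t ^ 2) z
  have h := (((hasFDerivAt_conj z).pow 2).neg).mul
    ((hasDerivAt_inv (pow_ne_zero 2 hne)).comp_hasFDerivAt z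
    (hN.pow 2))
  refine h.congr_fderiv ?_
  generalize hNN : ((normSq z + t ^ 2 : ℝ) : ℂ) = N at *
  ext
  simp [kerDA, wirtCLM_apply]
  simp only [← ofReal_pow, ← ofReal_add, hNN]
  field_simp; ring

end

theorem hasFDerivAt_integral_smul_sub {E : Type*} [NormedAddCommGroup E] [NormedSpace ℝ E]
    [CompleteSpace E] {F : ℂ → ℝ} (hF : Continuous F) (hc : HasCompactSupport F)
    {k : ℂ → E} {k' : ℂ → ℂ →L[ℝ] E} (hk : ∀ z, HasFDerivAt k (k' z) z) (hk' : Continuous k')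
    (x : ℂ) :
    HasFDerivAt (fun x => ∫ y, F y • k (x - y)) (∫ y, F y • k' (x - y)) x := by
  have hkc : Continuous k := continuous_iff_continuousAt.2 fun z => (hk z).continuousAt
  have hK : IsCompact ((fun p : ℂ × ℂ => p.1 - p.2) '' (closedBall x 1 ×ˢ tsupport F)) :=
    ((isCompact_closedBall x 1).prod hc).image (by fun_prop)
  obtain ⟨C, hC⟩ := hK.exists_bound_of_continuousOn (f := k') hk'.continuousOn
  refine hasFDerivAt_integral_of_dominated_of_fderiv_le (bound := fun y => C * ‖F y‖)
    (F := fun x y => F y • k (x - y)) (F' := fun x y => F y • k' (x - y))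
    (ball_mem_nhds x one_pos) ?_ ?_ ?_ ?_ ?_ ?_
  · exact Filter.Eventually.of_forall fun x => by
      apply Continuous.aestronglyMeasurable; fun_prop
  · exact (by fun_prop : Continuous fun y => F y • k (x - y)).integrable_of_hasCompactSupport
      (hc.smul_right)
  · exact ((by fun_prop : Continuous fun y => F y • k' (x - y)).integrable_of_hasCompactSupport
      hc.smul_right).aestronglyMeasurable
  · refine Filter.Eventually.of_forall fun y w hw => ?_
    rw [norm_smul, mul_comm]
    by_cases hy : y ∈ tsupport F
    · refine mul_le_mul_of_nonneg_right (hC _ ⟨(w, y), ⟨ball_subset_closedBall hw, hy⟩, rfl⟩)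
        (norm_nonneg _)
    · simp [image_eq_zero_of_notMem_tsupport hy]
  · exact ((hF.integrable_of_hasCompactSupport hc).norm).const_mul C
  · refine Filter.Eventually.of_forall fun y w _ => ?_
    have := (hk (w - y)).comp w ((hasFDerivAt_id w).sub_const y)
    exact this.const_smul (F y)

section
variable {α : ℝ} {z : ℂ}

theorem norm_rpow_eq_mul_sq (hz : z ≠ 0) (α : ℝ) : ‖z‖ ^ α = ‖z‖ ^ (α - 2) * ‖z‖ ^ 2 := by
  rw [← Real.rpow_natCast ‖z‖ 2, ← Real.rpow_add (norm_pos_iff.2 hz)]; norm_num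

theorem inv_norm_le_rpow (h1 : α < 1) (hz : z ≠ 0) {ρ : ℝ} (hρ : ‖z‖ ≤ ρ) :
    ‖z‖⁻¹ ≤ ρ ^ (1 - α) * ‖z‖ ^ (α - 2) := by
  have h : ‖z‖⁻¹ = ‖z‖ ^ (1 - α) * ‖z‖ ^ (α - 2) := by
    rw [← Real.rpow_add (norm_pos_iff.2 hz), ← Real.rpow_neg_one]; norm_num
  rw [h]
  gcongr

theorem norm_ofReal_normSq_add (t : ℝ) (z : ℂ) :
    ‖((normSq z + t ^ 2 : ℝ) : ℂ)‖ = ‖z‖ ^ 2 + t ^ 2 := by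
  rw [norm_real, normSq_eq_norm_sq, Real.norm_of_nonneg (by positivity)]

theorem norm_kerA_zero (hz : z ≠ 0) : ‖kerA 0 z‖ * ‖z‖ ^ α = ‖z‖ ^ (α - 2) := by
  have hr : ‖z‖ ≠ 0 := norm_ne_zero_iff.2 hz
  rw [kerA, norm_div, norm_neg, norm_pow, norm_pow, norm_ofReal_normSq_add, RCLike.norm_conj,
    norm_rpow_eq_mul_sq hz]
  generalize ‖z‖ ^ (α - 2) = s
  field_simp
  simp only [ne_eq, OfNat.ofNat_ne_zero, not_false_eq_true, zero_pow, add_zero]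
  ring

theorem norm_kerA_sub_le {t : ℝ} (ht : 0 < t) (hz : z ≠ 0) :
    ‖kerA t z - kerA 0 z‖ * ‖z‖ ^ α ≤ 4 * radialWeight α t z := by
  have hr : 0 < ‖z‖ := norm_pos_iff.2 hz
  have hN : normSq z ≠ 0 := by simpa using hz
  have hNt := (normSq_add_sq_pos ht z).ne'
  have e : kerA t z - kerA 0 z = conj z ^ 2 *
      ((t ^ 2 * (2 * normSq z + t ^ 2) / (normSq z ^ 2 * (normSq z + t ^ 2) ^ 2) : ℝ) : ℂ) := by
    have h1 : (normSq z : ℂ) ≠ 0 := ofReal_ne_zero.2 hN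
    have h2 : (normSq z : ℂ) + t ^ 2 ≠ 0 := by exact_mod_cast hNt
    simp only [kerA]
    push_cast
    rw [zero_pow two_ne_zero, add_zero]
    field_simp
    ring
  rw [e, norm_mul, norm_pow, RCLike.norm_conj, norm_real, normSq_eq_norm_sq,
    Real.norm_of_nonneg (by positivity), norm_rpow_eq_mul_sq hz, radialWeight]
  have hs : 0 ≤ ‖z‖ ^ (α - 2) := by positivity
  generalize ‖z‖ ^ (α - 2) = s at *
  generalize ‖z‖ = r at *
  have : r ^ 2 * (t ^ 2 * (2 * r ^ 2 + t ^ 2) / ((r ^ 2) ^ 2 * (r ^ 2 + t ^ 2) ^ 2)) * r ^ 2 ≤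
      4 * (t / (r + t)) := by
    have : r ^ 2 * (t ^ 2 * (2 * r ^ 2 + t ^ 2) / ((r ^ 2) ^ 2 * (r ^ 2 + t ^ 2) ^ 2)) * r ^ 2 =
      t ^ 2 * (2 * r ^ 2 + t ^ 2) / (r ^ 2 + t ^ 2) ^ 2 := by field_simp
    rw [this, ← mul_div_assoc, div_le_div_iff₀ (by positivity) (by positivity)]
    have h1 : (2 * r ^ 2 + t ^ 2) ≤ 2 * (r ^ 2 + t ^ 2) := by nlinarith
    have h2 : t * (r + t) ≤ 2 * (r ^ 2 + t ^ 2) := by nlinarith [sq_nonneg (r - t)]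
    calc t ^ 2 * (2 * r ^ 2 + t ^ 2) * (r + t) = t * ((2 * r ^ 2 + t ^ 2) * (t * (r + t))) := by
          ring
      _ ≤ t * ((2 * (r ^ 2 + t ^ 2)) * (2 * (r ^ 2 + t ^ 2))) := by gcongr
      _ = _ := by ring
  calc _ = s * (r ^ 2 * (t ^ 2 * (2 * r ^ 2 + t ^ 2) / ((r ^ 2) ^ 2 * (r ^ 2 + t ^ 2) ^ 2)) *
        r ^ 2) := by ring
    _ ≤ s * (4 * (t / (r + t))) := by gcongr
    _ = _ := by ring

theorem norm_kerB_le {t : ℝ} (ht : 0 < t) (hz : z ≠ 0) :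
    |kerB t z| * ‖z‖ ^ α ≤ 2 * radialWeight α t z := by
  have hr : 0 < ‖z‖ := norm_pos_iff.2 hz
  rw [kerB, normSq_eq_norm_sq, abs_of_nonneg (by positivity), norm_rpow_eq_mul_sq hz, radialWeight]
  have hs : 0 ≤ ‖z‖ ^ (α - 2) := by positivity
  generalize ‖z‖ ^ (α - 2) = s at *
  generalize ‖z‖ = r at *
  have : t ^ 2 / (r ^ 2 + t ^ 2) ^ 2 * r ^ 2 ≤ 2 * (t / (r + t)) := by
    rw [div_mul_eq_mul_div, ← mul_div_assoc, div_le_div_iff₀ (by positivity) (by positivity)]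
    have h1 : r ^ 2 ≤ r ^ 2 + t ^ 2 := by nlinarith
    have h2 : t * (r + t) ≤ 2 * (r ^ 2 + t ^ 2) := by nlinarith [sq_nonneg (r - t)]
    calc t ^ 2 * r ^ 2 * (r + t) = t * (r ^ 2 * (t * (r + t))) := by ring
      _ ≤ t * ((r ^ 2 + t ^ 2) * (2 * (r ^ 2 + t ^ 2))) := by gcongr
      _ = _ := by ring
  calc _ = s * (t ^ 2 / (r ^ 2 + t ^ 2) ^ 2 * r ^ 2) := by ring
    _ ≤ s * (2 * (t / (r + t))) := by gcongr
    _ = _ := by ring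

theorem norm_kerDA_le {t : ℝ} (ht : 0 < t) (hz : z ≠ 0) :
    ‖kerDA t z‖ * ‖z‖ ^ α ≤ 12 * t⁻¹ * radialWeight α t z := by
  have hr : 0 < ‖z‖ := norm_pos_iff.2 hz
  have h0 : ‖kerDA t z‖ ≤ 6 * ‖z‖ / (‖z‖ ^ 2 + t ^ 2) ^ 2 := by
    refine (norm_wirtCLM_le _ _).trans ?_
    refine (add_le_add le_rfl (norm_add_le _ _)).trans ?_
    simp only [norm_div, norm_mul, norm_pow, norm_ofReal_normSq_add, RCLike.norm_conj, norm_neg,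
      RCLike.norm_ofNat]
    generalize ‖z‖ = r at *
    have h1 : r ^ 3 / (r ^ 2 + t ^ 2) ^ 3 ≤ r / (r ^ 2 + t ^ 2) ^ 2 := by
      rw [div_le_div_iff₀ (by positivity) (by positivity)]
      have h2 : r ^ 2 ≤ r ^ 2 + t ^ 2 := by nlinarith
      calc r ^ 3 * (r ^ 2 + t ^ 2) ^ 2 = r * (r ^ 2 + t ^ 2) ^ 2 * r ^ 2 := by ring
        _ ≤ r * (r ^ 2 + t ^ 2) ^ 2 * (r ^ 2 + t ^ 2) := by gcongr
        _ = _ := by ring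
    calc _ = 4 * (r ^ 3 / (r ^ 2 + t ^ 2) ^ 3) + 2 * (r / (r ^ 2 + t ^ 2) ^ 2) := by ring
      _ ≤ 4 * (r / (r ^ 2 + t ^ 2) ^ 2) + 2 * (r / (r ^ 2 + t ^ 2) ^ 2) := by gcongr
      _ = _ := by ring
  refine (mul_le_mul_of_nonneg_right h0 (by positivity)).trans ?_
  rw [norm_rpow_eq_mul_sq hz, radialWeight]
  have hs : 0 ≤ ‖z‖ ^ (α - 2) := by positivity
  generalize ‖z‖ ^ (α - 2) = s at *
  generalize ‖z‖ = r at *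
  have : 6 * r / (r ^ 2 + t ^ 2) ^ 2 * r ^ 2 ≤ 12 * t⁻¹ * (t / (r + t)) := by
    have : 12 * t⁻¹ * (t / (r + t)) = 12 / (r + t) := by field_simp
    rw [this, div_mul_eq_mul_div, div_le_div_iff₀ (by positivity) (by positivity)]
    have h2 : r * (r + t) ≤ 2 * (r ^ 2 + t ^ 2) := by nlinarith [sq_nonneg (r - t)]
    have h1 : r ^ 2 ≤ r ^ 2 + t ^ 2 := by nlinarith
    calc 6 * r * r ^ 2 * (r + t) = 6 * (r ^ 2 * (r * (r + t))) := by ring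
      _ ≤ 6 * ((r ^ 2 + t ^ 2) * (2 * (r ^ 2 + t ^ 2))) := by gcongr
      _ = _ := by ring
  calc _ = s * (6 * r / (r ^ 2 + t ^ 2) ^ 2 * r ^ 2) := by ring
    _ ≤ s * (12 * t⁻¹ * (t / (r + t))) := by gcongr
    _ = _ := by ring

theorem norm_kerP_zero (z : ℂ) : ‖kerP 0 z‖ = ‖z‖⁻¹ := by
  rw [kerP, norm_div, norm_ofReal_normSq_add, RCLike.norm_conj]
  by_cases h : ‖z‖ = 0
  · simp [h]
  · field_simp; simp

theorem norm_kerP_zero_le (h1 : α < 1) (hz : z ≠ 0) {ρ : ℝ} (hρ : ‖z‖ ≤ ρ) :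
    ‖kerP 0 z‖ ≤ ρ ^ (1 - α) * ‖z‖ ^ (α - 2) := by
  rw [norm_kerP_zero]
  exact inv_norm_le_rpow h1 hz hρ

theorem norm_kerP_sub_le (h1 : α < 1) {t : ℝ} (ht : 0 < t) (hz : z ≠ 0) {ρ : ℝ} (hρ : ‖z‖ ≤ ρ) :
    ‖kerP t z - kerP 0 z‖ ≤ 2 * ρ ^ (1 - α) * radialWeight α t z := by
  have hr : 0 < ‖z‖ := norm_pos_iff.2 hz
  have hN : normSq z ≠ 0 := by simpa using hz
  have hNt := (normSq_add_sq_pos ht z).ne'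
  have e : kerP t z - kerP 0 z = conj z *
      ((-t ^ 2 / (normSq z * (normSq z + t ^ 2)) : ℝ) : ℂ) := by
    have h1 : (normSq z : ℂ) ≠ 0 := ofReal_ne_zero.2 hN
    have h2 : (normSq z : ℂ) + t ^ 2 ≠ 0 := by exact_mod_cast hNt
    simp only [kerP]
    push_cast
    rw [zero_pow two_ne_zero, add_zero]
    field_simp
    ring
  have h3 : ‖kerP t z - kerP 0 z‖ ≤ 2 * (t / (‖z‖ + t)) * ‖z‖⁻¹ := by
    rw [e, norm_mul, RCLike.norm_conj, norm_real, normSq_eq_norm_sq, neg_div, norm_neg,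
      Real.norm_of_nonneg (by positivity)]
    generalize ‖z‖ = r at *
    have : r * (t ^ 2 / (r ^ 2 * (r ^ 2 + t ^ 2))) = t ^ 2 / (r ^ 2 + t ^ 2) * r⁻¹ := by
      field_simp
    rw [this]
    gcongr
    rw [← mul_div_assoc, div_le_div_iff₀ (by positivity) (by positivity)]
    have h2 : t * (r + t) ≤ 2 * (r ^ 2 + t ^ 2) := by nlinarith [sq_nonneg (r - t)]
    calc t ^ 2 * (r + t) = t * (t * (r + t)) := by ring
      _ ≤ t * (2 * (r ^ 2 + t ^ 2)) := by gcongr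
      _ = _ := by ring
  calc _ ≤ _ := h3
    _ ≤ 2 * (t / (‖z‖ + t)) * (ρ ^ (1 - α) * ‖z‖ ^ (α - 2)) := by
        gcongr; exact inv_norm_le_rpow h1 hz hρ
    _ = _ := by rw [radialWeight]; ring

theorem kerL_zero (z : ℂ) : kerL 0 z = Real.log ‖z‖ := by
  rw [kerL, normSq_eq_norm_sq]
  simp

theorem abs_kerL_zero_le (h1 : α < 1) (hz : z ≠ 0) {ρ : ℝ} (hρ : ‖z‖ ≤ ρ) :
    |kerL 0 z| ≤ ρ ^ (1 - α) * ‖z‖ ^ (α - 2) + ρ := by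
  have hr : 0 < ‖z‖ := norm_pos_iff.2 hz
  rw [kerL_zero]
  have h2 := inv_norm_le_rpow h1 hz hρ
  have h3 := Real.log_le_self hr.le
  have h4 := Real.log_le_self (inv_pos.2 hr).le
  rw [Real.log_inv] at h4
  have h5 := inv_pos.2 hr
  rw [abs_le]
  constructor <;> linarith

theorem abs_kerL_sub_le (h1 : α < 1) {t : ℝ} (ht : 0 < t) (hz : z ≠ 0) {ρ : ℝ} (hρ : ‖z‖ ≤ ρ) :
    |kerL t z - kerL 0 z| ≤ t * ρ ^ (1 - α) * ‖z‖ ^ (α - 2) := by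
  have hr : 0 < ‖z‖ := norm_pos_iff.2 hz
  have h2 := inv_norm_le_rpow h1 hz hρ
  have e : kerL t z - kerL 0 z = 1 / 2 * Real.log ((‖z‖ ^ 2 + t ^ 2) / ‖z‖ ^ 2) := by
    rw [Real.log_div (by positivity) (by positivity), kerL, kerL, normSq_eq_norm_sq]
    simp; ring
  have h3 : 1 ≤ (‖z‖ ^ 2 + t ^ 2) / ‖z‖ ^ 2 := by
    rw [le_div_iff₀ (by positivity)]; nlinarith
  have h4 : (‖z‖ ^ 2 + t ^ 2) / ‖z‖ ^ 2 ≤ (1 + t * ‖z‖⁻¹) ^ 2 := by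
    rw [div_le_iff₀ (by positivity), ← mul_pow, add_mul, mul_assoc, inv_mul_cancel₀ hr.ne']
    nlinarith
  have h5 := Real.log_le_log (by positivity) h4
  rw [Real.log_pow] at h5
  have h6 := Real.log_le_sub_one_of_pos (by positivity : 0 < 1 + t * ‖z‖⁻¹)
  rw [e, abs_of_nonneg (by have := Real.log_nonneg h3; positivity)]
  have h7 := mul_le_mul_of_nonneg_left h2 ht.le
  push_cast at h5
  nlinarith

end

/-- Bounded `α`-Hölder functions with constant `M`, supported in the disk of radius `2R`. -/
structure IsCutHolder (α R M : ℝ) (F : ℂ → ℝ) : Prop where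
  bound : ∀ x, |F x| ≤ M
  holder : ∀ x y, |F x - F y| ≤ M * ‖x - y‖ ^ α
  supp : ∀ x, 2 * R ≤ ‖x‖ → F x = 0

/-- Regularised logarithmic potential. -/
noncomputable def potL (R t : ℝ) (F : ℂ → ℝ) (x : ℂ) : ℝ :=
  ∫ z in ball (0 : ℂ) (4 * R), F (x - z) • kerL t z

/-- Twice the `∂_z`-derivative of `potL`. -/
noncomputable def potP (R t : ℝ) (F : ℂ → ℝ) (x : ℂ) : ℂ :=
  ∫ z in ball (0 : ℂ) (4 * R), F (x - z) • kerP t z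

/-- The `∂_z`-derivative of `potP`. -/
noncomputable def potA (R t : ℝ) (F : ℂ → ℝ) (x : ℂ) : ℂ :=
  ∫ z in ball (0 : ℂ) (4 * R), (F (x - z) - F x) • kerA t z

/-- The `∂_{z̄}`-derivative of `potP`. -/
noncomputable def potB (R t : ℝ) (F : ℂ → ℝ) (x : ℂ) : ℝ :=
  ∫ z in ball (0 : ℂ) (4 * R), F (x - z) • kerB t z

theorem ae_ne_zero_restrict (s : Set ℂ) : ∀ᵐ z ∂(volume.restrict s), z ≠ 0 :=
  ae_restrict_of_ae (Measure.ae_ne volume 0)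

theorem integral_kerA_ball (t ρ : ℝ) : ∫ z in ball (0 : ℂ) ρ, kerA t z = 0 := by
  let e : ℂ ≃ₗᵢ[ℝ] ℂ := rotation (Circle.exp (Real.pi / 2))
  have he : ∀ z, e z = I * z := fun z => by
    simp only [e, rotation_apply, Circle.coe_exp]
    congr 1
    push_cast
    exact Complex.exp_pi_div_two_mul_I
  have h := e.measurePreserving.setIntegral_preimage_emb
    e.toHomeomorph.measurableEmbedding (kerA t) (ball (0 : ℂ) ρ)
  have hp : e ⁻¹' ball (0 : ℂ) ρ = ball 0 ρ := by
    rw [e.preimage_ball]; simp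
  have hk : ∀ z, kerA t (e z) = - kerA t z := fun z => by
    rw [he, kerA, kerA, normSq_mul, map_mul, mul_pow]
    simp [neg_div]
  rw [hp] at h
  simp_rw [hk] at h
  rw [integral_neg] at h
  exact self_eq_neg.1 h.symm

theorem kerDA_neg (t : ℝ) (z : ℂ) : kerDA t (-z) = -kerDA t z := by
  ext v
  simp [kerDA]
  ring

theorem integral_kerDA (t : ℝ) : ∫ z, kerDA t z = 0 := by
  have h := integral_neg_eq_self (kerDA t) volume
  simp_rw [kerDA_neg] at h
  rw [integral_neg] at h
  have h2 : (2 : ℝ) • ∫ z, kerDA t z = 0 := by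
    rw [two_smul ℝ (∫ z, kerDA t z)]
    nth_rewrite 1 [← h]
    exact neg_add_cancel _
  exact (smul_eq_zero.1 h2).resolve_left two_ne_zero

theorem continuous_kerL {t : ℝ} (ht : 0 < t) : Continuous (kerL t) :=
  continuous_iff_continuousAt.2 fun z => (hasFDerivAt_kerL ht z).continuousAt

theorem continuous_kerP {t : ℝ} (ht : 0 < t) : Continuous (kerP t) :=
  continuous_iff_continuousAt.2 fun z => (hasFDerivAt_kerP ht z).continuousAt

theorem continuous_kerA {t : ℝ} (ht : 0 < t) : Continuous (kerA t) :=
  continuous_iff_continuousAt.2 fun z => (hasFDerivAt_kerA ht z).continuousAt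

theorem continuous_kerB {t : ℝ} (ht : 0 < t) : Continuous (kerB t) := by
  have h : ∀ z : ℂ, (normSq z + t ^ 2) ^ 2 ≠ 0 := fun z =>
    pow_ne_zero 2 (normSq_add_sq_pos ht z).ne'
  unfold kerB
  have := continuous_normSq
  fun_prop (disch := exact h _)

theorem continuous_wirtCLM : Continuous fun p : ℂ × ℂ => wirtCLM p.1 p.2 := by
  unfold wirtCLM; fun_prop

theorem continuous_reMulCLM : Continuous reMulCLM := by
  unfold reMulCLM
  exact (ContinuousLinearMap.compL ℝ ℂ ℂ ℝ reCLM).continuous.comp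
    (continuous_id.smul continuous_const)

theorem continuous_kerDA {t : ℝ} (ht : 0 < t) : Continuous (kerDA t) := by
  have h : ∀ z : ℂ, ((normSq z + t ^ 2 : ℝ) : ℂ) ≠ 0 := normSq_add_sq_ne ht
  have hc : Continuous fun z : ℂ => ((normSq z + t ^ 2 : ℝ) : ℂ) :=
    continuous_ofReal.comp (continuous_normSq.add continuous_const)
  have hj : Continuous fun z : ℂ => conj z := continuous_conj
  refine continuous_wirtCLM.comp (Continuous.prodMk ?_ (Continuous.add ?_ ?_))
  · exact (continuous_const.mul (hj.pow 3)).div (hc.pow 3) fun z => pow_ne_zero _ (h z)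
  · exact (continuous_const.mul hj).div (hc.pow 2) fun z => pow_ne_zero _ (h z)
  · exact ((continuous_const.mul (hj.pow 2)).mul continuous_id).div (hc.pow 3)
      fun z => pow_ne_zero _ (h z)

theorem measurable_kerL (t : ℝ) : Measurable (kerL t) := by
  unfold kerL
  exact ((Real.measurable_log.comp
    (continuous_normSq.measurable.add_const _))).const_mul _

theorem measurable_kerP (t : ℝ) : Measurable (kerP t) := by
  unfold kerP
  exact continuous_conj.measurable.div
    (measurable_ofReal.comp (continuous_normSq.measurable.add_const _))

theorem measurable_kerA (t : ℝ) : Measurable (kerA t) := by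
  unfold kerA
  exact (continuous_conj.measurable.pow_const _).neg.div
    ((measurable_ofReal.comp (continuous_normSq.measurable.add_const _)).pow_const _)

namespace IsCutHolder

variable {α R M : ℝ} {F : ℂ → ℝ}

theorem nonneg (h : IsCutHolder α R M F) : 0 ≤ M := (abs_nonneg _).trans (h.bound 0)

theorem continuous (h : IsCutHolder α R M F) (h0 : 0 < α) : Continuous F := by
  have hM := h.nonneg
  rw [continuous_iff_continuousAt]
  intro x
  rw [ContinuousAt, tendsto_iff_norm_sub_tendsto_zero]
  refine squeeze_zero (fun y => norm_nonneg _) (fun y => h.holder y x) ?_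
  have : ContinuousAt (fun y : ℂ => M * ‖y - x‖ ^ α) x := by
    refine continuousAt_const.mul (ContinuousAt.rpow_const (by fun_prop) (Or.inr h0.le))
  have h2 := this.tendsto
  simpa [Real.zero_rpow h0.ne'] using h2

theorem hasCompactSupport (h : IsCutHolder α R M F) : HasCompactSupport F :=
  HasCompactSupport.of_support_subset_isCompact (isCompact_closedBall (0 : ℂ) (2 * R)) fun x hx => by
    rw [mem_closedBall_zero_iff]
    by_contra hcon
    exact hx (h.supp x (not_le.1 hcon).le)

theorem eq_zero_of_mem {x z : ℂ} (h : IsCutHolder α R M F) (hx : x ∈ ball (0 : ℂ) (2 * R))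
    (hz : z ∉ ball (0 : ℂ) (4 * R)) : F (x - z) = 0 := by
  apply h.supp
  rw [mem_ball_zero_iff] at *
  have := norm_sub_norm_le z x
  rw [norm_sub_rev] at this
  linarith

theorem setIntegral_eq {E : Type*} [NormedAddCommGroup E] [NormedSpace ℝ E] {x : ℂ}
    (h : IsCutHolder α R M F) (hx : x ∈ ball (0 : ℂ) (2 * R)) (k : ℂ → E) :
    ∫ z in ball (0 : ℂ) (4 * R), F (x - z) • k z = ∫ y, F y • k (x - y) := by
  rw [setIntegral_eq_integral_of_forall_compl_eq_zero
    (fun z hz => by rw [h.eq_zero_of_mem hx hz, zero_smul])]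
  rw [← integral_sub_left_eq_self (fun y => F y • k (x - y)) volume x]
  simp

theorem integrable_smul {E : Type*} [NormedAddCommGroup E] [NormedSpace ℝ E]
    (h : IsCutHolder α R M F) (h0 : 0 < α) {k : ℂ → E} (hk : Continuous k) (x : ℂ) :
    Integrable fun y => F y • k (x - y) :=
  (by have := h.continuous h0; fun_prop : Continuous fun y => F y • k (x - y)).integrable_of_hasCompactSupport
    h.hasCompactSupport.smul_right

theorem integrable_smul_left {E : Type*} [NormedAddCommGroup E] [NormedSpace ℝ E]
    (h : IsCutHolder α R M F) (h0 : 0 < α) {k : ℂ → E} (hk : Continuous k) (x : ℂ) :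
    Integrable fun z => F (x - z) • k z := by
  have := (h.integrable_smul h0 hk x).comp_sub_left x
  simpa using this

theorem hasFDerivAt_potL {t : ℝ} {x : ℂ} (h : IsCutHolder α R M F) (h0 : 0 < α) (ht : 0 < t)
    (hx : x ∈ ball (0 : ℂ) (2 * R)) :
    HasFDerivAt (potL R t F) (reMulCLM (potP R t F x)) x := by
  have hcR : Continuous fun z => reMulCLM (kerP t z) :=
    continuous_reMulCLM.comp (continuous_kerP ht)
  have h1 := hasFDerivAt_integral_smul_sub (h.continuous h0) h.hasCompactSupport
    (hasFDerivAt_kerL ht) hcR x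
  have h2 : HasFDerivAt (potL R t F) _ x := h1.congr_of_eventuallyEq (by
    filter_upwards [isOpen_ball.mem_nhds hx] with w hw using h.setIntegral_eq hw _)
  refine h2.congr_fderiv ?_
  rw [potP, h.setIntegral_eq hx]
  ext v
  rw [ContinuousLinearMap.integral_apply
    (h.integrable_smul h0 hcR x), reMulCLM_apply,
    ← integral_mul_const]
  have := reCLM.integral_comp_comm ((h.integrable_smul h0 (continuous_kerP ht) x).mul_const v)
  simp only [reCLM_apply] at this
  rw [← this]
  congr 1
  ext y
  simp
  ring

theorem potA_eq {t : ℝ} {x : ℂ} (h : IsCutHolder α R M F) (h0 : 0 < α) (ht : 0 < t)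
    (hx : x ∈ ball (0 : ℂ) (2 * R)) : potA R t F x = ∫ y, F y • kerA t (x - y) := by
  have hi : IntegrableOn (fun z => F x • kerA t z) (ball 0 (4 * R)) :=
    (((continuous_const (y := F x)).smul (continuous_kerA ht)).continuousOn.integrableOn_compact
      (isCompact_closedBall 0 (4 * R))).mono_set ball_subset_closedBall
  rw [← h.setIntegral_eq hx, potA]
  simp_rw [sub_smul]
  rw [integral_sub (h.integrable_smul_left h0 (continuous_kerA ht) x).integrableOn
    hi, integral_smul, integral_kerA_ball, smul_zero, sub_zero]

theorem hasFDerivAt_potP {t : ℝ} {x : ℂ} (h : IsCutHolder α R M F) (h0 : 0 < α) (ht : 0 < t)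
    (hx : x ∈ ball (0 : ℂ) (2 * R)) :
    HasFDerivAt (potP R t F) (wirtCLM (potA R t F x) (potB R t F x)) x := by
  have hcB : Continuous fun z => (kerB t z : ℂ) := continuous_ofReal.comp (continuous_kerB ht)
  have hc : Continuous fun z => wirtCLM (kerA t z) (kerB t z) :=
    continuous_wirtCLM.comp ((continuous_kerA ht).prodMk hcB)
  have h1 := hasFDerivAt_integral_smul_sub (h.continuous h0) h.hasCompactSupport
    (hasFDerivAt_kerP ht) hc x
  have h2 : HasFDerivAt (potP R t F) _ x := h1.congr_of_eventuallyEq (by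
    filter_upwards [isOpen_ball.mem_nhds hx] with w hw using h.setIntegral_eq hw _)
  refine h2.congr_fderiv ?_
  have hB : (potB R t F x : ℂ) = ∫ y, F y • (kerB t (x - y) : ℂ) := by
    rw [potB, h.setIntegral_eq hx]
    simp only [smul_eq_mul, real_smul, ← ofReal_mul]
    exact integral_ofReal.symm
  rw [h.potA_eq h0 ht hx, hB]
  ext v
  rw [ContinuousLinearMap.integral_apply (h.integrable_smul h0 hc x), wirtCLM_apply,
    ← integral_mul_const, ← integral_mul_const, ← integral_add
    ((h.integrable_smul h0 (continuous_kerA ht) x).mul_const v)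
    ((h.integrable_smul h0 hcB x).mul_const _)]
  congr 1
  ext y
  simp
  ring

theorem hasFDerivAt_potA {t : ℝ} {x : ℂ} (h : IsCutHolder α R M F) (h0 : 0 < α) (ht : 0 < t)
    (hx : x ∈ ball (0 : ℂ) (2 * R)) :
    HasFDerivAt (potA R t F) (∫ z, F (x - z) • kerDA t z) x := by
  have h1 := hasFDerivAt_integral_smul_sub (h.continuous h0) h.hasCompactSupport
    (hasFDerivAt_kerA ht) (continuous_kerDA ht) x
  have h2 : HasFDerivAt (potA R t F) _ x := h1.congr_of_eventuallyEq (by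
    filter_upwards [isOpen_ball.mem_nhds hx] with w hw using h.potA_eq h0 ht hw)
  refine h2.congr_fderiv ?_
  rw [← integral_sub_left_eq_self (fun y => F y • kerDA t (x - y)) volume x]
  simp

end IsCutHolder

/-- The mass of the unit radial weight. -/
noncomputable def weightMass (α : ℝ) : ℝ := ∫ z, radialWeight α 1 z

/-- The mass of the singular kernel `‖z‖ ^ (α - 2)` on a disk. -/
noncomputable def diskMass (α ρ : ℝ) : ℝ := ∫ z in ball (0 : ℂ) ρ, ‖z‖ ^ (α - 2)

theorem weightMass_nonneg (α : ℝ) : 0 ≤ weightMass α :=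
  integral_nonneg fun z => radialWeight_nonneg zero_le_one z

theorem diskMass_nonneg (α ρ : ℝ) : 0 ≤ diskMass α ρ :=
  integral_nonneg fun z => by positivity

section Estimates

variable {E : Type*} [NormedAddCommGroup E] [NormedSpace ℝ E]

theorem norm_setIntegral_le_weightMass {α t c : ℝ} (h0 : 0 < α) (h1 : α < 1) (ht : 0 < t)
    (hc : 0 ≤ c) {s : Set ℂ} {f : ℂ → E}
    (hf : ∀ᵐ z ∂(volume.restrict s), ‖f z‖ ≤ c * radialWeight α t z) :
    ‖∫ z in s, f z‖ ≤ c * (t ^ α * weightMass α) := by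
  have hi := (integrable_radialWeight h0 h1 ht).const_mul c
  refine (norm_integral_le_of_norm_le hi.integrableOn hf).trans ?_
  refine (setIntegral_le_integral hi (ae_of_all _ fun z =>
    mul_nonneg hc (radialWeight_nonneg ht.le z))).trans ?_
  rw [integral_const_mul, integral_radialWeight ht, weightMass]

theorem norm_setIntegral_le_diskMass {α ρ c d : ℝ} (h0 : 0 < α) (h1 : α < 1) {f : ℂ → E}
    (hρ : 0 ≤ ρ)
    (hf : ∀ᵐ z ∂(volume.restrict (ball (0 : ℂ) ρ)), ‖f z‖ ≤ c * ‖z‖ ^ (α - 2) + d) :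
    ‖∫ z in ball (0 : ℂ) ρ, f z‖ ≤ c * diskMass α ρ + d * (Real.pi * ρ ^ 2) := by
  have hi := (integrableOn_norm_rpow_ball h0 h1 ρ).const_mul c
  have hd : IntegrableOn (fun _ : ℂ => d) (ball (0 : ℂ) ρ) := integrableOn_const (by
    simp [Complex.volume_ball]; finiteness)
  refine (norm_integral_le_of_norm_le (hi.add hd) hf).trans (le_of_eq ?_)
  simp only [Pi.add_apply]
  rw [integral_add hi hd, integral_const_mul, diskMass, setIntegral_const, smul_eq_mul,
    measureReal_def, Complex.volume_ball]
  simp [ENNReal.toReal_ofReal hρ]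
  ring

end Estimates

theorem integrable_kerDA {α t : ℝ} (h0 : 0 < α) (h1 : α < 1) (ht : 0 < t) :
    Integrable (kerDA t) := by
  rw [← integrableOn_univ, ← union_compl_self (closedBall (0 : ℂ) 1)]
  refine IntegrableOn.union ((continuous_kerDA ht).continuousOn.integrableOn_compact
    (isCompact_closedBall 0 1)) ?_
  refine Integrable.mono' ((integrable_radialWeight h0 h1 ht).const_mul (12 * t⁻¹)).integrableOn
    (continuous_kerDA ht).aestronglyMeasurable ?_
  filter_upwards [ae_restrict_mem measurableSet_closedBall.compl] with z hz
  have hz1 : 1 < ‖z‖ := by simpa using hz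
  refine le_trans ?_ (norm_kerDA_le ht (norm_pos_iff.1 (zero_lt_one.trans hz1)))
  exact le_mul_of_one_le_right (norm_nonneg _) (Real.one_le_rpow hz1.le h0.le)

namespace IsCutHolder

variable {α R M t : ℝ} {F : ℂ → ℝ} {x y : ℂ}

theorem holder_sub_left (h : IsCutHolder α R M F) (x z : ℂ) : |F (x - z) - F x| ≤ M * ‖z‖ ^ α := by
  simpa using h.holder (x - z) x

theorem norm_sub_smul_le {E : Type*} [NormedAddCommGroup E] [NormedSpace ℝ E]
    (h : IsCutHolder α R M F) (x z : ℂ) (k : E) {b : ℝ} (hk : ‖k‖ * ‖z‖ ^ α ≤ b) :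
    ‖(F (x - z) - F x) • k‖ ≤ M * b := by
  rw [norm_smul]
  calc _ ≤ (M * ‖z‖ ^ α) * ‖k‖ := by gcongr; exact h.holder_sub_left x z
    _ = M * (‖k‖ * ‖z‖ ^ α) := by ring
    _ ≤ _ := mul_le_mul_of_nonneg_left hk h.nonneg

theorem norm_smul_le {E : Type*} [NormedAddCommGroup E] [NormedSpace ℝ E]
    (h : IsCutHolder α R M F) (x : ℂ) (k : E) {b : ℝ} (hk : ‖k‖ ≤ b) :
    ‖F x • k‖ ≤ M * b := by
  rw [norm_smul]
  exact mul_le_mul (h.bound x) hk (norm_nonneg _) h.nonneg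

theorem integrableOn_smul_of_le (h0 : 0 < α) (h1 : α < 1) {E : Type*}
    [NormedAddCommGroup E] {f : ℂ → E} {ρ c d : ℝ} 
    (hm : AEStronglyMeasurable f (volume.restrict (ball (0 : ℂ) ρ)))
    (hf : ∀ᵐ z ∂(volume.restrict (ball (0 : ℂ) ρ)), ‖f z‖ ≤ c * ‖z‖ ^ (α - 2) + d) :
    IntegrableOn f (ball (0 : ℂ) ρ) := by
  have hi := (integrableOn_norm_rpow_ball h0 h1 ρ).const_mul c
  have hd : IntegrableOn (fun _ : ℂ => d) (ball (0 : ℂ) ρ) := integrableOn_const (by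
    simp [Complex.volume_ball]; finiteness)
  exact Integrable.mono' (hi.add hd) hm hf

theorem ae_mem_ball_ne_zero (ρ : ℝ) :
    ∀ᵐ z ∂(volume.restrict (ball (0 : ℂ) ρ)), z ≠ 0 ∧ ‖z‖ ≤ ρ := by
  filter_upwards [ae_ne_zero_restrict (ball (0 : ℂ) ρ), ae_restrict_mem measurableSet_ball]
    with z hz hzb using ⟨hz, (mem_ball_zero_iff.1 hzb).le⟩

theorem ae_norm_potL_le (h : IsCutHolder α R M F) (h1 : α < 1) (x : ℂ) :
    ∀ᵐ z ∂(volume.restrict (ball (0 : ℂ) (4 * R))), ‖F (x - z) • kerL 0 z‖ ≤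
      M * (4 * R) ^ (1 - α) * ‖z‖ ^ (α - 2) + M * (4 * R) := by
  filter_upwards [ae_mem_ball_ne_zero (4 * R)] with z hz
  refine (h.norm_smul_le (x - z) (kerL 0 z) (abs_kerL_zero_le h1 hz.1 hz.2)).trans (le_of_eq ?_)
  ring

theorem ae_norm_potP_le (h : IsCutHolder α R M F) (h1 : α < 1) (x : ℂ) :
    ∀ᵐ z ∂(volume.restrict (ball (0 : ℂ) (4 * R))), ‖F (x - z) • kerP 0 z‖ ≤
      M * (4 * R) ^ (1 - α) * ‖z‖ ^ (α - 2) + 0 := by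
  filter_upwards [ae_mem_ball_ne_zero (4 * R)] with z hz
  refine (h.norm_smul_le (x - z) (kerP 0 z) (norm_kerP_zero_le h1 hz.1 hz.2)).trans (le_of_eq ?_)
  ring

theorem ae_norm_potA_le (h : IsCutHolder α R M F) (x : ℂ) :
    ∀ᵐ z ∂(volume.restrict (ball (0 : ℂ) (4 * R))), ‖(F (x - z) - F x) • kerA 0 z‖ ≤
      M * ‖z‖ ^ (α - 2) + 0 := by
  filter_upwards [ae_mem_ball_ne_zero (4 * R)] with z hz
  rw [add_zero]
  exact h.norm_sub_smul_le x z (kerA 0 z) (norm_kerA_zero hz.1).le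

theorem measurable_sub_left (h : IsCutHolder α R M F) (h0 : 0 < α) (x : ℂ) :
    Measurable fun z => F (x - z) :=
  ((h.continuous h0).comp (continuous_const.sub continuous_id)).measurable

theorem integrableOn_potL (h : IsCutHolder α R M F) (h0 : 0 < α) (h1 : α < 1) (x : ℂ) :
    IntegrableOn (fun z => F (x - z) • kerL 0 z) (ball 0 (4 * R)) :=
  integrableOn_smul_of_le h0 h1
    ((h.measurable_sub_left h0 x).smul (measurable_kerL 0)).aestronglyMeasurable
    (h.ae_norm_potL_le h1 x)

theorem integrableOn_potP (h : IsCutHolder α R M F) (h0 : 0 < α) (h1 : α < 1) (x : ℂ) :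
    IntegrableOn (fun z => F (x - z) • kerP 0 z) (ball 0 (4 * R)) :=
  integrableOn_smul_of_le h0 h1
    ((h.measurable_sub_left h0 x).smul (measurable_kerP 0)).aestronglyMeasurable
    (h.ae_norm_potP_le h1 x)

theorem integrableOn_potA (h : IsCutHolder α R M F) (h0 : 0 < α) (h1 : α < 1) (x : ℂ) :
    IntegrableOn (fun z => (F (x - z) - F x) • kerA 0 z) (ball 0 (4 * R)) :=
  integrableOn_smul_of_le h0 h1
    (((h.measurable_sub_left h0 x).sub_const _).smul (measurable_kerA 0)).aestronglyMeasurable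
    (h.ae_norm_potA_le x)

theorem abs_potL_sub_le (h : IsCutHolder α R M F) (h0 : 0 < α) (h1 : α < 1) (hR : 0 < R)
    (ht : 0 < t) (x : ℂ) :
    |potL R t F x - potL R 0 F x| ≤ M * (t * (4 * R) ^ (1 - α)) * diskMass α (4 * R) := by
  rw [potL, potL, ← integral_sub
    (h.integrable_smul_left h0 (continuous_kerL ht) x).integrableOn (h.integrableOn_potL h0 h1 x)]
  have key := norm_setIntegral_le_diskMass (c := M * (t * (4 * R) ^ (1 - α))) (d := 0) h0 h1
    (ρ := 4 * R) (f := fun z => F (x - z) • kerL t z - F (x - z) • kerL 0 z) (by positivity) ?_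
  · simpa using key
  filter_upwards [ae_mem_ball_ne_zero (4 * R)] with z hz
  rw [← smul_sub]
  refine (h.norm_smul_le (x - z) _ (abs_kerL_sub_le h1 ht hz.1 hz.2)).trans (le_of_eq ?_)
  ring

theorem norm_potP_sub_le (h : IsCutHolder α R M F) (h0 : 0 < α) (h1 : α < 1) (hR : 0 < R)
    (ht : 0 < t) (x : ℂ) :
    ‖potP R t F x - potP R 0 F x‖ ≤
      M * (2 * (4 * R) ^ (1 - α)) * (t ^ α * weightMass α) := by
  rw [potP, potP, ← integral_sub
    (h.integrable_smul_left h0 (continuous_kerP ht) x).integrableOn (h.integrableOn_potP h0 h1 x)]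
  have := h.nonneg
  refine norm_setIntegral_le_weightMass h0 h1 ht (by positivity) ?_
  filter_upwards [ae_mem_ball_ne_zero (4 * R)] with z hz
  rw [← smul_sub]
  refine (h.norm_smul_le (x - z) _ (norm_kerP_sub_le h1 ht hz.1 hz.2)).trans (le_of_eq ?_)
  ring

theorem norm_potA_sub_le (h : IsCutHolder α R M F) (h0 : 0 < α) (h1 : α < 1)
    (ht : 0 < t) (x : ℂ) :
    ‖potA R t F x - potA R 0 F x‖ ≤ M * 4 * (t ^ α * weightMass α) := by
  have hi : IntegrableOn (fun z => (F (x - z) - F x) • kerA t z) (ball 0 (4 * R)) := by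
    have hc := h.continuous h0
    have := continuous_kerA ht
    exact ((by fun_prop : Continuous fun z => (F (x - z) - F x) • kerA t z).continuousOn.integrableOn_compact
      (isCompact_closedBall 0 (4 * R))).mono_set ball_subset_closedBall
  rw [potA, potA, ← integral_sub hi (h.integrableOn_potA h0 h1 x)]
  have := h.nonneg
  refine norm_setIntegral_le_weightMass h0 h1 ht (by positivity) ?_
  filter_upwards [ae_mem_ball_ne_zero (4 * R)] with z hz
  rw [← smul_sub]
  refine (h.norm_sub_smul_le x z _ (norm_kerA_sub_le ht hz.1)).trans (le_of_eq ?_)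
  ring

theorem abs_potB_sub_le (h : IsCutHolder α R M F) (h0 : 0 < α) (h1 : α < 1)
    (ht : 0 < t) (hx : x ∈ ball (0 : ℂ) (2 * R)) :
    |potB R t F x - Real.pi * F x| ≤ M * 2 * (t ^ α * weightMass α) := by
  have e : potB R t F x = ∫ z, F (x - z) • kerB t z :=
    setIntegral_eq_integral_of_forall_compl_eq_zero
      (fun z hz => by rw [h.eq_zero_of_mem hx hz, zero_smul])
  have e2 : Real.pi * F x = ∫ z, F x • kerB t z := by
    rw [integral_smul, smul_eq_mul, mul_comm]
    congr 1
    exact (integral_regularised_delta ht).symm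
  have hi : Integrable fun z => F x • kerB t z := (integrable_regularised_delta ht).smul (F x)
  rw [e, e2, ← integral_sub (h.integrable_smul_left h0 (continuous_kerB ht) x) hi, ← setIntegral_univ]
  rw [← Real.norm_eq_abs]
  have := h.nonneg
  refine norm_setIntegral_le_weightMass h0 h1 ht (by positivity) ?_
  filter_upwards [ae_ne_zero_restrict univ] with z hz
  rw [← sub_smul (F (x - z)) (F x) (kerB t z)]
  refine (h.norm_sub_smul_le x z (kerB t z) (norm_kerB_le ht hz)).trans (le_of_eq ?_)
  ring

theorem norm_deriv_potA_le (h : IsCutHolder α R M F) (h0 : 0 < α) (h1 : α < 1)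
    (ht : 0 < t) (x : ℂ) :
    ‖∫ z, F (x - z) • kerDA t z‖ ≤ M * (12 * t⁻¹) * (t ^ α * weightMass α) := by
  have := h.nonneg
  have hi : Integrable fun z => F x • kerDA t z := (integrable_kerDA h0 h1 ht).smul (F x)
  have e : ∫ z, F (x - z) • kerDA t z = ∫ z, (F (x - z) - F x) • kerDA t z := by
    have e1 : ∫ z, F x • kerDA t z = 0 := by
      rw [integral_smul, integral_kerDA, smul_zero]
    rw [← sub_zero (∫ z, F (x - z) • kerDA t z), ← e1,
      ← integral_sub (h.integrable_smul_left h0 (continuous_kerDA ht) x) hi]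
    congr 1
    ext1 z
    exact (sub_smul (F (x - z)) (F x) (kerDA t z)).symm
  rw [e, ← setIntegral_univ]
  refine norm_setIntegral_le_weightMass h0 h1 ht (by positivity) ?_
  filter_upwards [ae_ne_zero_restrict univ] with z hz
  refine (h.norm_sub_smul_le x z (kerDA t z) (norm_kerDA_le ht hz)).trans (le_of_eq ?_)
  ring

end IsCutHolder

theorem reMulCLM_norm_sub_le (p q : ℂ) : ‖reMulCLM p - reMulCLM q‖ ≤ ‖p - q‖ := by
  rw [reMulCLM_sub]; exact norm_reMulCLM_le _

namespace IsCutHolder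
open Filter Topology

variable {α R M t : ℝ} {F : ℂ → ℝ} {x y : ℂ}

theorem hasFDerivAt_potL_zero (h : IsCutHolder α R M F) (h0 : 0 < α) (h1 : α < 1) (hR : 0 < R)
    (hx : x ∈ ball (0 : ℂ) (2 * R)) :
    HasFDerivAt (potL R 0 F) (reMulCLM (potP R 0 F x)) x := by
  have ht : ∀ n : ℕ, (0 : ℝ) < 1 / (n + 1) := fun n => Nat.one_div_pos_of_nat
  have hlim : Tendsto (fun n : ℕ => (1 : ℝ) / (n + 1)) atTop (𝓝 0) :=
    tendsto_one_div_add_atTop_nhds_zero_nat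
  have hlim' : Tendsto (fun n : ℕ => ((1 : ℝ) / (n + 1)) ^ α) atTop (𝓝 0) := by
    simpa [Real.zero_rpow h0.ne'] using hlim.rpow_const (Or.inr h0.le)
  refine hasFDerivAt_of_tendstoUniformlyOn (l := (atTop : Filter ℕ))
    (f := fun n : ℕ => potL R (1 / (n + 1)) F)
    (f' := fun n x => reMulCLM (potP R (1 / (n + 1)) F x))
    (g' := fun x => reMulCLM (potP R 0 F x)) isOpen_ball ?_
    (fun n y hy => h.hasFDerivAt_potL h0 (ht n) hy) ?_ hx
  · rw [Metric.tendstoUniformlyOn_iff]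
    intro ε hε
    have := (hlim'.mul_const (weightMass α)).const_mul (M * (2 * (4 * R) ^ (1 - α)))
    simp only [zero_mul, mul_zero] at this
    filter_upwards [this.eventually_lt_const hε] with n hn y _
    rw [dist_comm, dist_eq_norm]
    exact ((reMulCLM_norm_sub_le _ _).trans (h.norm_potP_sub_le h0 h1 hR (ht n) y)).trans_lt hn
  · intro y _
    rw [tendsto_iff_norm_sub_tendsto_zero]
    refine squeeze_zero (fun _ => norm_nonneg _)
      (fun n => h.abs_potL_sub_le h0 h1 hR (ht n) y) ?_
    simpa using ((hlim.mul_const ((4 * R) ^ (1 - α))).const_mul M).mul_const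
      (diskMass α (4 * R))

theorem norm_wirtCLM_sub_le (a b c d : ℂ) :
    ‖wirtCLM a b - wirtCLM c d‖ ≤ ‖a - c‖ + ‖b - d‖ := by
  rw [wirtCLM_sub]; exact norm_wirtCLM_le _ _

theorem hasFDerivAt_potP_zero (h : IsCutHolder α R M F) (h0 : 0 < α) (h1 : α < 1) (hR : 0 < R)
    (hx : x ∈ ball (0 : ℂ) (2 * R)) :
    HasFDerivAt (potP R 0 F) (wirtCLM (potA R 0 F x) ((Real.pi * F x : ℝ))) x := by
  have ht : ∀ n : ℕ, (0 : ℝ) < 1 / (n + 1) := fun n => Nat.one_div_pos_of_nat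
  have hlim : Tendsto (fun n : ℕ => (1 : ℝ) / (n + 1)) atTop (𝓝 0) :=
    tendsto_one_div_add_atTop_nhds_zero_nat
  have hlim' : Tendsto (fun n : ℕ => ((1 : ℝ) / (n + 1)) ^ α) atTop (𝓝 0) := by
    simpa [Real.zero_rpow h0.ne'] using hlim.rpow_const (Or.inr h0.le)
  refine hasFDerivAt_of_tendstoUniformlyOn (l := (atTop : Filter ℕ))
    (f := fun n : ℕ => potP R (1 / (n + 1)) F)
    (f' := fun n x => wirtCLM (potA R (1 / (n + 1)) F x) (potB R (1 / (n + 1)) F x))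
    (g' := fun x => wirtCLM (potA R 0 F x) ((Real.pi * F x : ℝ))) isOpen_ball ?_
    (fun n y hy => h.hasFDerivAt_potP h0 (ht n) hy) ?_ hx
  · rw [Metric.tendstoUniformlyOn_iff]
    intro ε hε
    have := (hlim'.mul_const (weightMass α)).const_mul (M * 6)
    simp only [zero_mul, mul_zero] at this
    filter_upwards [this.eventually_lt_const hε] with n hn y hy
    rw [dist_comm, dist_eq_norm]
    refine ((norm_wirtCLM_sub_le _ _ _ _).trans ?_).trans_lt hn
    have e1 := h.norm_potA_sub_le h0 h1 (ht n) y
    have e2 := h.abs_potB_sub_le h0 h1 (ht n) hy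
    rw [← ofReal_sub, norm_real, Real.norm_eq_abs]
    linarith
  · intro y _
    rw [tendsto_iff_norm_sub_tendsto_zero]
    refine squeeze_zero (fun _ => norm_nonneg _)
      (fun n => h.norm_potP_sub_le h0 h1 hR (ht n) y) ?_
    simpa using (hlim'.mul_const (weightMass α)).const_mul (M * (2 * (4 * R) ^ (1 - α)))

theorem abs_potL_zero_le (h : IsCutHolder α R M F) (h0 : 0 < α) (h1 : α < 1) (hR : 0 < R) (x : ℂ) :
    |potL R 0 F x| ≤ M * ((4 * R) ^ (1 - α) * diskMass α (4 * R) +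
      4 * R * (Real.pi * (4 * R) ^ 2)) := by
  refine (norm_setIntegral_le_diskMass h0 h1 (by positivity) (h.ae_norm_potL_le h1 x)).trans
    (le_of_eq ?_)
  ring

theorem norm_potP_zero_le (h : IsCutHolder α R M F) (h0 : 0 < α) (h1 : α < 1) (hR : 0 < R) (x : ℂ) :
    ‖potP R 0 F x‖ ≤ M * ((4 * R) ^ (1 - α) * diskMass α (4 * R)) := by
  refine (norm_setIntegral_le_diskMass h0 h1 (by positivity) (h.ae_norm_potP_le h1 x)).trans
    (le_of_eq ?_)
  ring

theorem norm_potA_zero_le (h : IsCutHolder α R M F) (h0 : 0 < α) (h1 : α < 1) (hR : 0 < R) (x : ℂ) :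
    ‖potA R 0 F x‖ ≤ M * diskMass α (4 * R) := by
  refine (norm_setIntegral_le_diskMass h0 h1 (by positivity) (h.ae_norm_potA_le x)).trans
    (le_of_eq ?_)
  ring

theorem norm_potA_zero_sub_le (h : IsCutHolder α R M F) (h0 : 0 < α) (h1 : α < 1)
    (hx : x ∈ ball (0 : ℂ) (2 * R)) (hy : y ∈ ball (0 : ℂ) (2 * R)) :
    ‖potA R 0 F x - potA R 0 F y‖ ≤ M * (20 * weightMass α) * ‖x - y‖ ^ α := by
  rcases eq_or_ne x y with rfl | hxy
  · simp [Real.zero_rpow h0.ne']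
  have ht : 0 < ‖x - y‖ := norm_pos_iff.2 (sub_ne_zero.2 hxy)
  have e1 := h.norm_potA_sub_le h0 h1 ht x
  have e2 := h.norm_potA_sub_le h0 h1 ht y
  have e3 : ‖potA R ‖x - y‖ F x - potA R ‖x - y‖ F y‖ ≤
      M * (12 * ‖x - y‖⁻¹) * (‖x - y‖ ^ α * weightMass α) * ‖x - y‖ :=
    (convex_ball (0 : ℂ) (2 * R)).norm_image_sub_le_of_norm_hasFDerivWithin_le
      (fun z hz => (h.hasFDerivAt_potA h0 ht hz).hasFDerivWithinAt)
      (fun z _ => h.norm_deriv_potA_le h0 h1 ht z) hy hx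
  have e4 : M * (12 * ‖x - y‖⁻¹) * (‖x - y‖ ^ α * weightMass α) * ‖x - y‖ =
      M * 12 * (‖x - y‖ ^ α * weightMass α) := by
    field_simp
  rw [e4] at e3
  rw [norm_sub_rev] at e1
  calc _ = ‖(potA R 0 F x - potA R ‖x - y‖ F x) + (potA R ‖x - y‖ F x - potA R ‖x - y‖ F y) +
        (potA R ‖x - y‖ F y - potA R 0 F y)‖ := by congr 1; ring
    _ ≤ _ := norm_add₃_le
    _ ≤ _ := by linarith

end IsCutHolder

/-- Quantitative `C^{2,α}` regularity on a set in Wirtinger form: `p = 2 ∂φ`, `a = ∂p`,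
`b = ∂̄ p`. -/
structure IsC2Holder (α : ℝ) (s : Set ℂ) (K : ℝ) (φ : ℂ → ℝ) (p a b : ℂ → ℂ) : Prop where
  hasDeriv : ∀ z ∈ s,
    HasFDerivWithinAt φ (reMulCLM (p z)) s z
  hasDeriv₂ : ∀ z ∈ s,
    HasFDerivWithinAt p (wirtCLM (a z) (b z)) s z
  bound : ∀ z ∈ s, |φ z| ≤ K
  bound_p : ∀ z ∈ s, ‖p z‖ ≤ K
  bound_a : ∀ z ∈ s, ‖a z‖ ≤ K
  bound_b : ∀ z ∈ s, ‖b z‖ ≤ K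
  holder_a : ∀ z ∈ s, ∀ w ∈ s,
    ‖a z - a w‖ ≤ K * ‖z - w‖ ^ α
  holder_b : ∀ z ∈ s, ∀ w ∈ s,
    ‖b z - b w‖ ≤ K * ‖z - w‖ ^ α

theorem IsC2Holder.add {α K K' : ℝ} {s : Set ℂ} {φ ψ : ℂ → ℝ} {p a b p' a' b' : ℂ → ℂ}
    (h : IsC2Holder α s K φ p a b) (h' : IsC2Holder α s K' ψ p' a' b') :
    IsC2Holder α s (K + K') (φ + ψ) (p + p') (a + a') (b + b') where
  hasDeriv z hz := ((h.hasDeriv z hz).add (h'.hasDeriv z hz)).congr_fderiv (by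
    ext v; simp [add_mul])
  hasDeriv₂ z hz := ((h.hasDeriv₂ z hz).add (h'.hasDeriv₂ z hz)).congr_fderiv (by
    ext v; simp; ring)
  bound z hz := (abs_add_le _ _).trans (add_le_add (h.bound z hz) (h'.bound z hz))
  bound_p z hz := (norm_add_le _ _).trans (add_le_add (h.bound_p z hz) (h'.bound_p z hz))
  bound_a z hz := (norm_add_le _ _).trans (add_le_add (h.bound_a z hz) (h'.bound_a z hz))
  bound_b z hz := (norm_add_le _ _).trans (add_le_add (h.bound_b z hz) (h'.bound_b z hz))
  holder_a z hz w hw := by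
    have := norm_add_le (a z - a w) (a' z - a' w)
    have h1 := h.holder_a z hz w hw
    have h2 := h'.holder_a z hz w hw
    calc _ = ‖a z - a w + (a' z - a' w)‖ := by simp only [Pi.add_apply]; congr 1; ring
      _ ≤ _ := by linarith
  holder_b z hz w hw := by
    have := norm_add_le (b z - b w) (b' z - b' w)
    have h1 := h.holder_b z hz w hw
    have h2 := h'.holder_b z hz w hw
    calc _ = ‖b z - b w + (b' z - b' w)‖ := by simp only [Pi.add_apply]; congr 1; ring
      _ ≤ _ := by linarith

theorem IsC2Holder.mono {α K K' : ℝ} {s : Set ℂ} {φ : ℂ → ℝ} {p a b : ℂ → ℂ}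
    (h : IsC2Holder α s K φ p a b) (hK : K ≤ K') : IsC2Holder α s K' φ p a b where
  hasDeriv := h.hasDeriv
  hasDeriv₂ := h.hasDeriv₂
  bound z hz := (h.bound z hz).trans hK
  bound_p z hz := (h.bound_p z hz).trans hK
  bound_a z hz := (h.bound_a z hz).trans hK
  bound_b z hz := (h.bound_b z hz).trans hK
  holder_a z hz w hw := (h.holder_a z hz w hw).trans (by gcongr)
  holder_b z hz w hw := (h.holder_b z hz w hw).trans (by gcongr)

theorem IsC2Holder.const {α : ℝ} {s : Set ℂ} (c : ℝ) :
    IsC2Holder α s |c| (fun _ => c) 0 0 0 where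
  hasDeriv z _ := (hasFDerivWithinAt_const c z _).congr_fderiv (by ext v; simp)
  hasDeriv₂ z _ := (hasFDerivWithinAt_const 0 z _).congr_fderiv (by ext v; simp)
  bound z _ := le_rfl
  bound_p z _ := by simp
  bound_a z _ := by simp
  bound_b z _ := by simp
  holder_a z _ w _ := by simp; positivity
  holder_b z _ w _ := by simp; positivity

theorem IsC2Holder.subset {α K : ℝ} {s t : Set ℂ} {φ : ℂ → ℝ} {p a b : ℂ → ℂ}
    (h : IsC2Holder α s K φ p a b) (hts : t ⊆ s) : IsC2Holder α t K φ p a b where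
  hasDeriv z hz := (h.hasDeriv z (hts hz)).mono hts
  hasDeriv₂ z hz := (h.hasDeriv₂ z (hts hz)).mono hts
  bound z hz := h.bound z (hts hz)
  bound_p z hz := h.bound_p z (hts hz)
  bound_a z hz := h.bound_a z (hts hz)
  bound_b z hz := h.bound_b z (hts hz)
  holder_a z hz w hw := h.holder_a z (hts hz) w (hts hw)
  holder_b z hz w hw := h.holder_b z (hts hz) w (hts hw)

/-- Radial retraction onto the closed disk. -/
noncomputable def retract (R : ℝ) (z : ℂ) : ℂ := (R / max R ‖z‖) • z

/-- Piecewise linear radial cutoff. -/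
noncomputable def cutoff (R : ℝ) (z : ℂ) : ℝ := max 0 (min 1 (2 - ‖z‖ / R))

/-- Compactly supported Hölder extension, normalised for the logarithmic potential. -/
noncomputable def cutExt (R : ℝ) (f : ℂ → ℝ) (z : ℂ) : ℝ :=
  (2 * Real.pi)⁻¹ * (f (retract R z) * cutoff R z)

section

variable {R : ℝ}

theorem retract_of_mem (hR : 0 < R) {z : ℂ} (hz : z ∈ closedBall (0 : ℂ) R) : retract R z = z := by
  rw [retract, max_eq_left (mem_closedBall_zero_iff.1 hz), div_self hR.ne', one_smul]

theorem retract_mem (hR : 0 < R) (z : ℂ) : retract R z ∈ closedBall (0 : ℂ) R := by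
  rw [mem_closedBall_zero_iff, retract, norm_smul, Real.norm_of_nonneg (by positivity),
    div_mul_eq_mul_div, div_le_iff₀ (by positivity)]
  exact mul_le_mul_of_nonneg_left (le_max_right _ _) hR.le

theorem norm_retract_sub_le (hR : 0 < R) (z w : ℂ) :
    ‖retract R z - retract R w‖ ≤ 2 * ‖z - w‖ := by
  set m := max R ‖z‖ with hm
  set n := max R ‖w‖ with hn
  have hmp : 0 < m := lt_max_of_lt_left hR
  have hnp : 0 < n := lt_max_of_lt_left hR
  have hRm : R / m ≤ 1 := (div_le_one hmp).2 (le_max_left _ _)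
  have hwn : ‖w‖ / n ≤ 1 := (div_le_one hnp).2 (le_max_right _ _)
  have hmn : |n - m| ≤ ‖z - w‖ := by
    refine (abs_max_sub_max_le_max R ‖w‖ R ‖z‖).trans ?_
    rw [sub_self, abs_zero, max_eq_right (abs_nonneg _), norm_sub_rev]
    exact abs_norm_sub_norm_le _ _
  have e : retract R z - retract R w =
      (R / m) • (z - w) + (R / m * ((n - m) / n)) • w := by
    have : R / m * ((n - m) / n) = R / m - R / n := by field_simp
    rw [this, retract, retract, smul_sub, sub_smul]
    abel
  rw [e]
  refine (norm_add_le _ _).trans ?_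
  rw [norm_smul, norm_smul, norm_mul, norm_div, norm_div,
    Real.norm_of_nonneg hR.le, Real.norm_of_nonneg hmp.le, Real.norm_of_nonneg hnp.le,
    Real.norm_eq_abs]
  have h1 : R / m * ‖z - w‖ ≤ 1 * ‖z - w‖ := by gcongr
  have h2 : R / m * (|n - m| / n) * ‖w‖ ≤ 1 * ‖z - w‖ := by
    calc R / m * (|n - m| / n) * ‖w‖ = R / m * |n - m| * (‖w‖ / n) := by ring
      _ ≤ 1 * ‖z - w‖ * 1 := by gcongr
      _ = _ := by ring
  linarith

theorem cutoff_nonneg (z : ℂ) : 0 ≤ cutoff R z := le_max_left _ _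

theorem cutoff_le_one (z : ℂ) : cutoff R z ≤ 1 := max_le zero_le_one (min_le_left _ _)

theorem cutoff_of_mem (hR : 0 < R) {z : ℂ} (hz : z ∈ closedBall (0 : ℂ) R) : cutoff R z = 1 := by
  have : ‖z‖ / R ≤ 1 := (div_le_one hR).2 (mem_closedBall_zero_iff.1 hz)
  rw [cutoff, min_eq_left (by linarith), max_eq_right zero_le_one]

theorem cutoff_eq_zero (hR : 0 < R) {z : ℂ} (hz : 2 * R ≤ ‖z‖) : cutoff R z = 0 := by
  have : 2 ≤ ‖z‖ / R := (le_div_iff₀ hR).2 hz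
  exact max_eq_left ((min_le_right _ _).trans (by linarith))

theorem abs_cutoff_sub_le (hR : 0 < R) {α : ℝ} (h0 : 0 < α) (h1 : α < 1) (z w : ℂ) :
    |cutoff R z - cutoff R w| ≤ R ^ (-α) * ‖z - w‖ ^ α := by
  have e : R ^ (-α) * ‖z - w‖ ^ α = (‖z - w‖ / R) ^ α := by
    rw [Real.div_rpow (norm_nonneg _) hR.le, Real.rpow_neg hR.le]; ring
  rw [e]
  have hb : |cutoff R z - cutoff R w| ≤ 1 :=
    abs_sub_le_iff.2 ⟨by linarith [cutoff_nonneg (R := R) w, cutoff_le_one (R := R) z],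
      by linarith [cutoff_nonneg (R := R) z, cutoff_le_one (R := R) w]⟩
  have hl : |cutoff R z - cutoff R w| ≤ ‖z - w‖ / R := by
    refine (abs_max_sub_max_le_max _ _ _ _).trans (max_le (by simp; positivity) ?_)
    refine (abs_min_sub_min_le_max _ _ _ _).trans (max_le (by simp; positivity) ?_)
    rw [show 2 - ‖z‖ / R - (2 - ‖w‖ / R) = (‖w‖ - ‖z‖) / R by ring, abs_div, abs_of_pos hR,
      norm_sub_rev]
    exact div_le_div_of_nonneg_right (abs_norm_sub_norm_le _ _) hR.le
  rcases le_total (‖z - w‖ / R) 1 with h | h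
  · exact hl.trans (Real.self_le_rpow_of_le_one (by positivity) h h1.le)
  · exact hb.trans (Real.one_le_rpow h h0.le)

theorem isCutHolder_cutExt (hR : 0 < R) {α M : ℝ} (h0 : 0 < α) (h1 : α < 1) {f : ℂ → ℝ}
    (hf : ∀ z ∈ closedBall (0 : ℂ) R, |f z| ≤ M)
    (hf' : ∀ z ∈ closedBall (0 : ℂ) R, ∀ w ∈ closedBall (0 : ℂ) R,
      |f z - f w| ≤ M * ‖z - w‖ ^ α) :
    IsCutHolder α R (M * (2 + R ^ (-α))) (cutExt R f) := by
  have hM : 0 ≤ M := (abs_nonneg _).trans (hf 0 (mem_closedBall_self hR.le))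
  have hpi : (2 * Real.pi)⁻¹ ≤ 1 := inv_le_one_of_one_le₀ (by linarith [Real.pi_gt_three])
  have hpi0 : 0 ≤ (2 * Real.pi)⁻¹ := by positivity
  have hRα : 0 ≤ R ^ (-α) := by positivity
  have hb : ∀ z, |f (retract R z)| ≤ M := fun z => hf _ (retract_mem hR z)
  refine ⟨fun z => ?_, fun z w => ?_, fun z hz => ?_⟩
  · rw [cutExt, abs_mul, abs_mul, abs_of_nonneg hpi0, abs_of_nonneg (cutoff_nonneg z)]
    have hc := cutoff_nonneg (R := R) z
    calc _ ≤ 1 * (M * 1) := by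
          gcongr
          · exact hb z
          · exact cutoff_le_one z
      _ ≤ _ := by nlinarith
  · have h2 : |f (retract R z) - f (retract R w)| ≤ M * (2 * ‖z - w‖ ^ α) := by
      refine (hf' _ (retract_mem hR z) _ (retract_mem hR w)).trans ?_
      gcongr
      refine (Real.rpow_le_rpow (norm_nonneg _) (norm_retract_sub_le hR z w) h0.le).trans ?_
      rw [Real.mul_rpow zero_le_two (norm_nonneg _)]
      gcongr
      exact Real.rpow_le_self_of_one_le one_le_two h1.le
    have h3 := abs_cutoff_sub_le hR h0 h1 z w
    rw [cutExt, cutExt, ← mul_sub, abs_mul, abs_of_nonneg hpi0]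
    calc _ ≤ 1 * |f (retract R z) * cutoff R z - f (retract R w) * cutoff R w| := by gcongr
      _ = |(f (retract R z) - f (retract R w)) * cutoff R z +
            f (retract R w) * (cutoff R z - cutoff R w)| := by rw [one_mul]; congr 1; ring
      _ ≤ |f (retract R z) - f (retract R w)| * cutoff R z +
            |f (retract R w)| * |cutoff R z - cutoff R w| := by
          refine (abs_add_le _ _).trans ?_
          rw [abs_mul, abs_mul, abs_of_nonneg (cutoff_nonneg z)]
      _ ≤ M * (2 * ‖z - w‖ ^ α) * 1 + M * (R ^ (-α) * ‖z - w‖ ^ α) := by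
          gcongr
          · exact cutoff_nonneg z
          · exact cutoff_le_one z
          · exact hb w
      _ = _ := by ring
  · rw [cutExt, cutoff_eq_zero hR hz]; ring

/-- Constant in the Schauder estimate for the logarithmic potential. -/
noncomputable def newtonConst (α R : ℝ) : ℝ :=
  (2 + R ^ (-α)) * ((4 * R) ^ (1 - α) * diskMass α (4 * R) + 4 * R * (Real.pi * (4 * R) ^ 2) +
    diskMass α (4 * R) + 20 * weightMass α + 4)

theorem newtonConst_nonneg (hR : 0 < R) (α : ℝ) : 0 ≤ newtonConst α R := by
  have := diskMass_nonneg α (4 * R)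
  have := weightMass_nonneg α
  unfold newtonConst; positivity

theorem isC2Holder_potL (hR : 0 < R) {α M : ℝ} (h0 : 0 < α) (h1 : α < 1) {f : ℂ → ℝ}
    (hf : ∀ z ∈ closedBall (0 : ℂ) R, |f z| ≤ M)
    (hf' : ∀ z ∈ closedBall (0 : ℂ) R, ∀ w ∈ closedBall (0 : ℂ) R,
      |f z - f w| ≤ M * ‖z - w‖ ^ α) :
    IsC2Holder α (closedBall (0 : ℂ) R) (M * newtonConst α R) (potL R 0 (cutExt R f)) (potP R 0 (cutExt R f))
      (potA R 0 (cutExt R f)) (fun z => (Real.pi * cutExt R f z : ℝ)) := by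
  have h := isCutHolder_cutExt hR h0 h1 hf hf'
  set F := cutExt R f
  set N := M * (2 + R ^ (-α)) with hN
  have hN0 : 0 ≤ N := h.nonneg
  have hd := diskMass_nonneg α (4 * R)
  have hw := weightMass_nonneg α
  have hp : 0 ≤ (4 * R) ^ (1 - α) * diskMass α (4 * R) := by positivity
  have hp2 : 0 ≤ 4 * R * (Real.pi * (4 * R) ^ 2) := by positivity
  have hK : M * newtonConst α R = N * ((4 * R) ^ (1 - α) * diskMass α (4 * R) +
      4 * R * (Real.pi * (4 * R) ^ 2) + diskMass α (4 * R) + 20 * weightMass α + 4) := by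
    rw [newtonConst, hN]; ring
  have hsub : closedBall (0 : ℂ) R ⊆ ball 0 (2 * R) := closedBall_subset_ball (by linarith)
  rw [hK]
  refine ⟨fun z hz => (h.hasFDerivAt_potL_zero h0 h1 hR (hsub hz)).hasFDerivWithinAt,
    fun z hz => (h.hasFDerivAt_potP_zero h0 h1 hR (hsub hz)).hasFDerivWithinAt,
    fun z hz => ?_, fun z hz => ?_, fun z hz => ?_, fun z hz => ?_, fun z hz w hw' => ?_,
    fun z hz w hw' => ?_⟩
  · exact (h.abs_potL_zero_le h0 h1 hR z).trans (mul_le_mul_of_nonneg_left (by linarith) hN0)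
  · exact (h.norm_potP_zero_le h0 h1 hR z).trans (mul_le_mul_of_nonneg_left (by linarith) hN0)
  · exact (h.norm_potA_zero_le h0 h1 hR z).trans (mul_le_mul_of_nonneg_left (by linarith) hN0)
  · rw [norm_real, norm_mul, Real.norm_of_nonneg Real.pi_nonneg, mul_comm]
    refine mul_le_mul (h.bound z) ?_ Real.pi_nonneg hN0
    linarith [Real.pi_le_four]
  · refine (h.norm_potA_zero_sub_le h0 h1 (hsub hz) (hsub hw')).trans ?_
    gcongr; linarith
  · rw [← ofReal_sub, norm_real, ← mul_sub, norm_mul, Real.norm_of_nonneg Real.pi_nonneg, mul_comm]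
    calc _ ≤ N * ‖z - w‖ ^ α * 4 := mul_le_mul (h.holder z w) Real.pi_le_four Real.pi_nonneg
          (by positivity)
      _ = N * 4 * ‖z - w‖ ^ α := by ring
      _ ≤ _ := by gcongr; linarith

theorem pi_mul_cutExt (hR : 0 < R) {f : ℂ → ℝ} {z : ℂ} (hz : z ∈ closedBall (0 : ℂ) R) :
    Real.pi * cutExt R f z = f z / 2 := by
  rw [cutExt, retract_of_mem hR hz, cutoff_of_mem hR hz]
  field_simp

end

section CauchyTransform

/-- The point `e^{it}` of the unit circle. -/
noncomputable def cexpI (t : ℝ) : ℂ := exp (t * I)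

theorem norm_cexpI (t : ℝ) : ‖cexpI t‖ = 1 := norm_exp_ofReal_mul_I t

theorem cexpI_add (s t : ℝ) : cexpI (s + t) = cexpI s * cexpI t := by
  rw [cexpI, cexpI, cexpI, ← exp_add]; push_cast; ring_nf

theorem cexpI_periodic : Function.Periodic cexpI (2 * Real.pi) := fun t => by
  rw [cexpI_add]; simp [cexpI, exp_two_pi_mul_I]

theorem hasDerivAt_cexpI (t : ℝ) : HasDerivAt cexpI (cexpI t * I) t := by
  have h : HasDerivAt (fun z : ℂ => exp (z * I)) (exp (t * I) * I) t := by
    simpa using ((hasDerivAt_id (t : ℂ)).mul_const I).cexp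
  exact h.comp_ofReal

theorem continuous_cexpI : Continuous cexpI :=
  continuous_iff_continuousAt.2 fun t => (hasDerivAt_cexpI t).continuousAt

theorem norm_cexpI_sub_ge {z : ℂ} (t : ℝ) : 1 - ‖z‖ ≤ ‖cexpI t - z‖ := by
  simpa [norm_cexpI] using norm_sub_norm_le (cexpI t) z

theorem cexpI_sub_ne_zero {z : ℂ} (hz : z ∈ ball (0 : ℂ) 1) (t : ℝ) : cexpI t - z ≠ 0 := by
  have h := norm_cexpI_sub_ge (z := z) t
  rw [mem_ball_zero_iff] at hz
  exact norm_pos_iff.1 (by linarith)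

/-- Cauchy transform of a function on the unit circle. -/
noncomputable def cauchyT (g : ℝ → ℂ) (z : ℂ) : ℂ :=
  ∫ t in (0 : ℝ)..(2 * Real.pi), g t * (cexpI t / (cexpI t - z))

/-- Derivative of the Cauchy transform. -/
noncomputable def cauchyT' (g : ℝ → ℂ) (z : ℂ) : ℂ :=
  ∫ t in (0 : ℝ)..(2 * Real.pi), g t * (cexpI t / (cexpI t - z) ^ 2)

variable {g : ℝ → ℂ} {z : ℂ}

theorem continuous_cauchyT_integrand (hg : Continuous g) (hz : z ∈ ball (0 : ℂ) 1) :
    Continuous fun t => g t * (cexpI t / (cexpI t - z)) := by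
  have := continuous_cexpI
  have h := cexpI_sub_ne_zero hz
  fun_prop (disch := exact h)

theorem continuous_cauchyT'_integrand (hg : Continuous g) (hz : z ∈ ball (0 : ℂ) 1) :
    Continuous fun t => g t * (cexpI t / (cexpI t - z) ^ 2) := by
  have := continuous_cexpI
  have h : ∀ t, (cexpI t - z) ^ 2 ≠ 0 := fun t => pow_ne_zero 2 (cexpI_sub_ne_zero hz t)
  fun_prop (disch := exact h _)

theorem hasDerivAt_cauchyT (hg : Continuous g) (hz : z ∈ ball (0 : ℂ) 1) :
    HasDerivAt (cauchyT g) (cauchyT' g z) z := by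
  obtain ⟨r, hzr, hr1⟩ := exists_between (mem_ball_zero_iff.1 hz)
  have hsub : ball (0 : ℂ) r ⊆ ball 0 1 := ball_subset_ball hr1.le
  have hmem : ball (0 : ℂ) r ∈ nhds z := isOpen_ball.mem_nhds (mem_ball_zero_iff.2 hzr)
  refine (intervalIntegral.hasDerivAt_integral_of_dominated_loc_of_deriv_le
    (F := fun z t => g t * (cexpI t / (cexpI t - z)))
    (F' := fun z t => g t * (cexpI t / (cexpI t - z) ^ 2))
    (bound := fun t => ‖g t‖ * (1 / (1 - r) ^ 2)) hmem ?_ ?_ ?_ ?_ ?_ ?_).2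
  · filter_upwards [hmem] with w hw
    exact (continuous_cauchyT_integrand hg (hsub hw)).aestronglyMeasurable
  · exact (continuous_cauchyT_integrand hg hz).intervalIntegrable _ _
  · exact (continuous_cauchyT'_integrand hg hz).aestronglyMeasurable
  · refine Filter.Eventually.of_forall fun t _ w hw => ?_
    have h1 := norm_cexpI_sub_ge (z := w) t
    rw [mem_ball_zero_iff] at hw
    rw [norm_mul, norm_div, norm_cexpI, norm_pow]
    have : 0 < 1 - r := by linarith
    gcongr
    linarith
  · exact (hg.norm.mul continuous_const).intervalIntegrable _ _
  · refine Filter.Eventually.of_forall fun t _ w hw => ?_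
    have h := cexpI_sub_ne_zero (hsub hw) t
    have h1 : HasDerivAt (fun w => cexpI t - w) (-1) w := by
      simpa using (hasDerivAt_id w).const_sub (cexpI t)
    have h2 := ((hasDerivAt_const w (cexpI t)).div h1 h).const_mul (g t)
    refine h2.congr_deriv ?_
    ring

theorem cauchyT'_eq_of_hasDerivAt {q Q : ℝ → ℂ} (hq : ∀ t, HasDerivAt q (Q t) t)
    (hQ : Continuous Q) (hper : Function.Periodic q (2 * Real.pi)) (hz : z ∈ ball (0 : ℂ) 1) :
    cauchyT' q z = -I * ∫ t in (0 : ℝ)..(2 * Real.pi), Q t * (1 / (cexpI t - z)) := by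
  have hd : ∀ t, HasDerivAt (fun t => 1 / (cexpI t - z)) (-(cexpI t * I) / (cexpI t - z) ^ 2) t :=
    fun t => by
      have h := (hasDerivAt_const t (1 : ℂ)).div ((hasDerivAt_cexpI t).sub_const z)
        (cexpI_sub_ne_zero hz t)
      exact h.congr_deriv (by ring)
  have hc : Continuous fun t => -(cexpI t * I) / (cexpI t - z) ^ 2 := by
    have := continuous_cexpI
    have h : ∀ t, (cexpI t - z) ^ 2 ≠ 0 := fun t => pow_ne_zero 2 (cexpI_sub_ne_zero hz t)
    fun_prop (disch := exact h _)
  have key := intervalIntegral.integral_mul_deriv_eq_deriv_mul (a := 0) (b := 2 * Real.pi)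
    (fun t _ => hq t) (fun t _ => hd t) (hQ.intervalIntegrable _ _) (hc.intervalIntegrable _ _)
  have e0 : q (2 * Real.pi) = q 0 := by simpa using hper 0
  have e1 : cexpI (2 * Real.pi) = cexpI 0 := by simpa using cexpI_periodic 0
  rw [e0, e1, sub_self, zero_sub] at key
  have : cauchyT' q z = I * ∫ t in (0 : ℝ)..(2 * Real.pi),
      q t * (-(cexpI t * I) / (cexpI t - z) ^ 2) := by
    rw [cauchyT', ← intervalIntegral.integral_const_mul]
    congr 1
    ext t
    linear_combination (q t * (cexpI t / (cexpI t - z) ^ 2)) * I_sq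
  rw [this, key]
  ring

theorem cauchyT'_const (c : ℂ) (hz : z ∈ ball (0 : ℂ) 1) : cauchyT' (fun _ => c) z = 0 := by
  rw [cauchyT'_eq_of_hasDerivAt (fun t => hasDerivAt_const t c) continuous_const
    (fun _ => rfl) hz]
  simp

theorem cauchyT_const (c : ℂ) (hz : z ∈ ball (0 : ℂ) 1) :
    cauchyT (fun _ => c) z = 2 * Real.pi * c := by
  have h := circleIntegral.integral_sub_inv_of_mem_ball hz
  have e : ∮ ζ in C(0, 1), (ζ - z)⁻¹ =
      I * ∫ t in (0 : ℝ)..(2 * Real.pi), cexpI t / (cexpI t - z) := by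
    rw [circleIntegral, ← intervalIntegral.integral_const_mul]
    congr 1
    ext t
    simp only [deriv_circleMap, circleMap, cexpI, smul_eq_mul, ofReal_one, one_mul, zero_add]
    ring
  rw [e, mul_comm] at h
  rw [cauchyT, intervalIntegral.integral_const_mul, mul_right_cancel₀ I_ne_zero h]
  ring

theorem norm_cexpI_sub_one_ge {s : ℝ} (hs : |s| ≤ Real.pi) :
    2 / Real.pi * |s| ≤ ‖cexpI s - 1‖ := by
  have h1 : ‖cexpI s - 1‖ = 2 * |Real.sin (s / 2)| := by
    rw [cexpI, mul_comm, norm_exp_I_mul_ofReal_sub_one, norm_mul, Real.norm_eq_abs,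
      Real.norm_eq_abs, abs_two]
  rw [h1]
  have h2 := Real.mul_abs_le_abs_sin (x := s / 2) (by rw [abs_div, abs_two]; linarith)
  rw [abs_div, abs_two] at h2
  linarith

theorem sq_add_sq_le_normSq_cexpI_sub {r s : ℝ} (hr : r < 1) (hr0 : 0 ≤ r) (hs : |s| ≤ Real.pi) :
    ((1 - r) ^ 2 + s ^ 2) / (2 * Real.pi ^ 2) ≤ ‖cexpI s - r‖ ^ 2 := by
  have h1 : 1 - r ≤ ‖cexpI s - r‖ := by
    simpa [abs_of_nonneg hr0] using norm_cexpI_sub_ge (z := (r : ℂ)) s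
  have h2 : ‖cexpI s - 1‖ ≤ ‖cexpI s - r‖ + (1 - r) := by
    have : ‖(r : ℂ) - 1‖ = 1 - r := by
      rw [← ofReal_one, ← ofReal_sub, norm_real, norm_sub_rev, Real.norm_of_nonneg (by linarith)]
    rw [← this]
    exact norm_sub_le_norm_sub_add_norm_sub _ _ _
  have h3 := norm_cexpI_sub_one_ge hs
  have h4 : |s| / Real.pi ≤ ‖cexpI s - r‖ := by
    have : 2 / Real.pi * |s| = 2 * (|s| / Real.pi) := by ring
    linarith
  have h5 : s ^ 2 / Real.pi ^ 2 ≤ ‖cexpI s - r‖ ^ 2 := by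
    rw [← sq_abs s, ← div_pow]
    exact pow_le_pow_left₀ (by positivity) h4 2
  have h6 : (1 - r) ^ 2 / Real.pi ^ 2 ≤ ‖cexpI s - r‖ ^ 2 := by
    refine le_trans ?_ (pow_le_pow_left₀ (by linarith) h1 2)
    exact div_le_self (by positivity) (one_le_pow₀ (by linarith [Real.pi_gt_three]))
  have : ((1 - r) ^ 2 + s ^ 2) / (2 * Real.pi ^ 2) =
    ((1 - r) ^ 2 / Real.pi ^ 2 + s ^ 2 / Real.pi ^ 2) / 2 := by ring
  linarith

/-- The one-dimensional analogue of `weightMass`. -/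
noncomputable def lineMass (α : ℝ) : ℝ := ∫ u : ℝ, |u| ^ α / (1 + u ^ 2)

theorem lineMass_nonneg (α : ℝ) : 0 ≤ lineMass α := integral_nonneg fun u => by positivity

theorem integrable_rpow_div_one_add_sq {α : ℝ} (h0 : 0 < α) (h1 : α < 1) :
    Integrable fun u : ℝ => |u| ^ α / (1 + u ^ 2) := by
  have hi : Integrable fun u : ℝ => (1 + ‖u‖ ^ 2) ^ (-(2 - α) / 2) :=
    integrable_rpow_neg_one_add_norm_sq (by simp; linarith)
  refine hi.mono' ?_ (ae_of_all _ fun u => ?_)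
  · have : Continuous fun u : ℝ => |u| ^ α := by
      exact continuous_abs.rpow_const fun _ => Or.inr h0.le
    exact (this.div (by fun_prop) fun u => by positivity).aestronglyMeasurable
  · have hp : 0 < 1 + u ^ 2 := by positivity
    rw [Real.norm_of_nonneg (by positivity), Real.norm_eq_abs, sq_abs,
      show -(2 - α) / 2 = α / 2 - 1 by ring, Real.rpow_sub_one hp.ne']
    gcongr
    rw [← sq_abs u]
    calc |u| ^ α = (|u| ^ (2 : ℝ)) ^ (α / 2) := by
          rw [← Real.rpow_mul (abs_nonneg _)]; congr 1; ring
      _ ≤ _ := by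
          rw [Real.rpow_two]
          gcongr
          linarith [sq_abs u, hp]

theorem integrable_rpow_div_sq_add_sq {α d : ℝ} (h0 : 0 < α) (h1 : α < 1) (hd : 0 < d) :
    Integrable (fun s : ℝ => |s| ^ α / (d ^ 2 + s ^ 2)) ∧
      ∫ s : ℝ, |s| ^ α / (d ^ 2 + s ^ 2) = d ^ (α - 1) * lineMass α := by
  have e : ∀ s : ℝ, |s| ^ α / (d ^ 2 + s ^ 2) =
      d ^ (α - 2) * (|d⁻¹ * s| ^ α / (1 + (d⁻¹ * s) ^ 2)) := fun s => by
    rw [abs_mul, abs_inv, abs_of_pos hd, Real.mul_rpow (by positivity) (abs_nonneg _),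
      Real.inv_rpow hd.le, Real.rpow_sub hd, Real.rpow_two]
    have := Real.rpow_pos_of_pos hd α
    field_simp
  constructor
  · simp_rw [e]
    exact ((integrable_rpow_div_one_add_sq h0 h1).comp_mul_left' (inv_ne_zero hd.ne')).const_mul _
  · simp_rw [e]
    rw [integral_const_mul, Measure.integral_comp_mul_left (fun u => |u| ^ α / (1 + u ^ 2)) d⁻¹,
      inv_inv, abs_of_pos hd, smul_eq_mul, ← mul_assoc, lineMass, Real.rpow_sub_one hd.ne',
      Real.rpow_sub hd, Real.rpow_two]
    congr 1
    field_simp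

end CauchyTransform

section DiscEstimates

variable {α : ℝ}

theorem integral_holder_div_sq_le (h0 : 0 < α) (h1 : α < 1) {g : ℝ → ℂ} {N : ℝ}
    (hg : Continuous g) (hper : Function.Periodic g (2 * Real.pi))
    (hN : ∀ s t, ‖g s - g t‖ ≤ N * |s - t| ^ α) {r : ℝ} (hr0 : 0 ≤ r) (hr : r < 1) (θ : ℝ) :
    ∫ t in (0 : ℝ)..(2 * Real.pi), ‖g t - g θ‖ / ‖cexpI t - r * cexpI θ‖ ^ 2 ≤
      2 * Real.pi ^ 2 * N * ((1 - r) ^ (α - 1) * lineMass α) := by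
  have hpi := Real.pi_pos
  have hN0 : 0 ≤ N := by simpa using (norm_nonneg _).trans (hN 1 0)
  have hd : 0 < 1 - r := by linarith
  have hp : Function.Periodic (fun t => ‖g t - g θ‖ / ‖cexpI t - r * cexpI θ‖ ^ 2)
      (2 * Real.pi) := fun t => by
    simp only [hper t, cexpI_periodic t]
  have e1 := hp.intervalIntegral_add_eq 0 (-Real.pi + θ)
  rw [zero_add] at e1
  have e2 : -Real.pi + θ + 2 * Real.pi = Real.pi + θ := by ring
  rw [e1, e2, ← intervalIntegral.integral_comp_add_right]
  have e3 : ∀ s, ‖cexpI (s + θ) - r * cexpI θ‖ = ‖cexpI s - r‖ := fun s => by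
    rw [cexpI_add, ← sub_mul, norm_mul, norm_cexpI, mul_one]
  simp_rw [e3]
  have hi := integrable_rpow_div_sq_add_sq h0 h1 hd
  have hle : -Real.pi ≤ Real.pi := by linarith
  have hpos : ∀ s : ℝ, 0 ≤ |s| ^ α / ((1 - r) ^ 2 + s ^ 2) := fun s => by positivity
  have hz : ((r : ℝ) : ℂ) ∈ ball (0 : ℂ) 1 := by
    rw [mem_ball_zero_iff, norm_real, Real.norm_of_nonneg hr0]; exact hr
  have hc : Continuous fun s => ‖g (s + θ) - g θ‖ / ‖cexpI s - r‖ ^ 2 := by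
    have := continuous_cexpI
    have h : ∀ s, ‖cexpI s - r‖ ^ 2 ≠ 0 := fun s =>
      pow_ne_zero 2 (norm_ne_zero_iff.2 (cexpI_sub_ne_zero hz s))
    fun_prop (disch := exact h _)
  calc ∫ s in (-Real.pi)..Real.pi, ‖g (s + θ) - g θ‖ / ‖cexpI s - r‖ ^ 2
      ≤ ∫ s in (-Real.pi)..Real.pi,
          2 * Real.pi ^ 2 * N * (|s| ^ α / ((1 - r) ^ 2 + s ^ 2)) := by
        refine intervalIntegral.integral_mono_on hle (hc.intervalIntegrable _ _)
          (hi.1.const_mul _).intervalIntegrable fun s hs => ?_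
        have h2 : ‖g (s + θ) - g θ‖ ≤ N * |s| ^ α := by simpa using hN (s + θ) θ
        have h3 := sq_add_sq_le_normSq_cexpI_sub hr hr0 (abs_le.2 hs)
        have h4 : 0 < (1 - r) ^ 2 + s ^ 2 := by positivity
        calc _ ≤ (N * |s| ^ α) / (((1 - r) ^ 2 + s ^ 2) / (2 * Real.pi ^ 2)) := by gcongr
          _ = _ := by field_simp
    _ = 2 * Real.pi ^ 2 * N * ∫ s in (-Real.pi)..Real.pi, |s| ^ α / ((1 - r) ^ 2 + s ^ 2) :=
        intervalIntegral.integral_const_mul _ _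
    _ ≤ 2 * Real.pi ^ 2 * N * ∫ s, |s| ^ α / ((1 - r) ^ 2 + s ^ 2) := by
        gcongr
        rw [intervalIntegral.integral_of_le hle]
        exact setIntegral_le_integral hi.1 (ae_of_all _ hpos)
    _ = _ := by rw [hi.2]

theorem exists_eq_mul_cexpI (z : ℂ) : (‖z‖ : ℂ) * cexpI z.arg = z := norm_mul_exp_arg_mul_I z

theorem norm_cauchyT'_le (h0 : 0 < α) (h1 : α < 1) {g : ℝ → ℂ} {N : ℝ}
    (hg : Continuous g) (hper : Function.Periodic g (2 * Real.pi))
    (hN : ∀ s t, ‖g s - g t‖ ≤ N * |s - t| ^ α) {z : ℂ} (hz : z ∈ ball (0 : ℂ) 1) :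
    ‖cauchyT' g z‖ ≤ 2 * Real.pi ^ 2 * N * lineMass α * (1 - ‖z‖) ^ (α - 1) := by
  have e : cauchyT' g z = ∫ t in (0 : ℝ)..(2 * Real.pi),
      (g t - g z.arg) * (cexpI t / (cexpI t - z) ^ 2) := by
    rw [← sub_zero (cauchyT' g z), ← cauchyT'_const (g z.arg) hz, cauchyT', cauchyT',
      ← intervalIntegral.integral_sub
        ((continuous_cauchyT'_integrand hg hz).intervalIntegrable _ _)
        ((continuous_cauchyT'_integrand continuous_const hz).intervalIntegrable _ _)]
    congr 1
    ext t
    ring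
  rw [e]
  refine (intervalIntegral.norm_integral_le_integral_norm (by positivity)).trans ?_
  have key := integral_holder_div_sq_le h0 h1 hg hper hN (norm_nonneg z)
    (mem_ball_zero_iff.1 hz) z.arg
  rw [exists_eq_mul_cexpI] at key
  refine le_of_eq_of_le ?_ (key.trans (le_of_eq (by ring)))
  congr 1
  ext t
  rw [norm_mul, norm_div, norm_cexpI, norm_pow]
  ring

/-- The Hardy–Littlewood lemma: a growth bound on the derivative gives Hölder continuity. -/
theorem norm_sub_le_of_norm_deriv_le (h0 : 0 < α) (h1 : α < 1) {h h' : ℂ → ℂ} {A : ℝ}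
    (hd : ∀ z ∈ ball (0 : ℂ) 1, HasDerivAt h (h' z) z)
    (hA : ∀ z ∈ ball (0 : ℂ) 1, ‖h' z‖ ≤ A * (1 - ‖z‖) ^ (α - 1))
    {z w : ℂ} (hz : z ∈ ball (0 : ℂ) 1) (hw : w ∈ ball (0 : ℂ) 1) :
    ‖h z - h w‖ ≤ A * (2 / α + 1) * ‖z - w‖ ^ α := by
  have hA0 : 0 ≤ A := by simpa using (norm_nonneg _).trans (hA 0 (by simp))
  have rad : ∀ z ∈ ball (0 : ℂ) 1, ∀ d ∈ Icc (0 : ℝ) 1,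
      ‖h (((1 - d : ℝ) : ℂ) * z) - h z‖ ≤ A / α * d ^ α := by
    intro z hz d hd1
    have hz1 := mem_ball_zero_iff.1 hz
    have hmem : ∀ s ∈ Icc (0 : ℝ) 1, ((1 - s : ℝ) : ℂ) * z ∈ ball (0 : ℂ) 1 ∧
        ‖((1 - s : ℝ) : ℂ) * z‖ = (1 - s) * ‖z‖ := fun s hs => by
      have e : ‖((1 - s : ℝ) : ℂ) * z‖ = (1 - s) * ‖z‖ := by
        rw [norm_mul, norm_real, Real.norm_of_nonneg (by linarith [hs.2])]
      refine ⟨?_, e⟩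
      rw [mem_ball_zero_iff, e]
      nlinarith [hs.1, hs.2, norm_nonneg z]
    have hder : ∀ s ∈ Icc (0 : ℝ) 1, HasDerivAt (fun s : ℝ => h (((1 - s : ℝ) : ℂ) * z) - h z)
        (h' (((1 - s : ℝ) : ℂ) * z) * -z) s := fun s hs => by
      have h2 : HasDerivAt (fun s : ℝ => ((1 - s : ℝ) : ℂ) * z) (-z) s := by
        simpa using (((hasDerivAt_id s).const_sub 1).ofReal_comp).mul_const z
      exact ((hd _ (hmem s hs).1).comp s h2).sub_const _
    have hB : ∀ s ∈ Ico (0 : ℝ) d, HasDerivWithinAt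
        (fun s => A / α * ((1 - ‖z‖ + s * ‖z‖) ^ α - (1 - ‖z‖) ^ α))
        (A * ‖z‖ * (1 - ‖z‖ + s * ‖z‖) ^ (α - 1)) (Ici s) s := fun s hs => by
      have hp : 0 < 1 - ‖z‖ + s * ‖z‖ := by
        have := mul_nonneg hs.1 (norm_nonneg z); linarith
      have h3 : HasDerivAt (fun s => 1 - ‖z‖ + s * ‖z‖) ‖z‖ s := by
        simpa using ((hasDerivAt_id s).mul_const ‖z‖).const_add (1 - ‖z‖)
      have h4 := ((h3.rpow_const (p := α) (Or.inl hp.ne')).sub_const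
        ((1 - ‖z‖) ^ α)).const_mul (A / α)
      exact (h4.congr_deriv (by field_simp)).hasDerivWithinAt
    have key := image_norm_le_of_norm_deriv_right_le_deriv_boundary' (a := 0) (b := d)
      (f := fun s : ℝ => h (((1 - s : ℝ) : ℂ) * z) - h z)
      (f' := fun s => h' (((1 - s : ℝ) : ℂ) * z) * -z)
      (fun s hs => (hder s ⟨hs.1, hs.2.trans hd1.2⟩).continuousAt.continuousWithinAt)
      (fun s hs => (hder s ⟨hs.1, hs.2.le.trans hd1.2⟩).hasDerivWithinAt)
      (B := fun s => A / α * ((1 - ‖z‖ + s * ‖z‖) ^ α - (1 - ‖z‖) ^ α))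
      (B' := fun s => A * ‖z‖ * (1 - ‖z‖ + s * ‖z‖) ^ (α - 1)) (by simp)
      (by
        refine ContinuousOn.mul continuousOn_const (ContinuousOn.sub ?_ continuousOn_const)
        exact ContinuousOn.rpow_const (by fun_prop) fun s _ => Or.inr h0.le)
      hB (fun s hs => by
        have hs' : s ∈ Icc (0 : ℝ) 1 := ⟨hs.1, hs.2.le.trans hd1.2⟩
        have := hA _ (hmem s hs').1
        rw [(hmem s hs').2] at this
        rw [norm_mul, norm_neg]
        calc _ ≤ A * (1 - (1 - s) * ‖z‖) ^ (α - 1) * ‖z‖ := by gcongr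
          _ = _ := by rw [show 1 - (1 - s) * ‖z‖ = 1 - ‖z‖ + s * ‖z‖ by ring]; ring)
      (right_mem_Icc.2 hd1.1)
    refine key.trans ?_
    have hsub : (1 - ‖z‖ + d * ‖z‖) ^ α ≤ (1 - ‖z‖) ^ α + (d * ‖z‖) ^ α :=
      Real.rpow_add_le_add_rpow (by linarith) (mul_nonneg hd1.1 (norm_nonneg z)) h0.le h1.le
    have hdz : (d * ‖z‖) ^ α ≤ d ^ α :=
      Real.rpow_le_rpow (mul_nonneg hd1.1 (norm_nonneg z))
        (mul_le_of_le_one_right hd1.1 hz1.le) h0.le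
    have : 0 ≤ A / α := by positivity
    gcongr
    linarith
  rcases eq_or_ne z w with rfl | hne
  · simp [Real.zero_rpow h0.ne']
  have hd0 : 0 < ‖z - w‖ := norm_pos_iff.2 (sub_ne_zero.2 hne)
  rcases le_total ‖z - w‖ 1 with hle | hle
  · set d := ‖z - w‖ with hdd
    have r1 := rad z hz d ⟨hd0.le, hle⟩
    have r2 := rad w hw d ⟨hd0.le, hle⟩
    have hin : ∀ v ∈ ball (0 : ℂ) 1, ((1 - d : ℝ) : ℂ) * v ∈ closedBall (0 : ℂ) (1 - d) := by
      intro v hv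
      rw [mem_closedBall_zero_iff, norm_mul, norm_real, Real.norm_of_nonneg (by linarith)]
      exact mul_le_of_le_one_right (by linarith) (mem_ball_zero_iff.1 hv).le
    have hsub : closedBall (0 : ℂ) (1 - d) ⊆ ball 0 1 := closedBall_subset_ball (by linarith)
    have r3 := (convex_closedBall (0 : ℂ) (1 - d)).norm_image_sub_le_of_norm_hasDerivWithin_le
      (fun v hv => (hd v (hsub hv)).hasDerivWithinAt) (C := A * d ^ (α - 1))
      (fun v hv => by
        refine (hA v (hsub hv)).trans ?_
        have : d ≤ 1 - ‖v‖ := by linarith [mem_closedBall_zero_iff.1 hv]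
        exact mul_le_mul_of_nonneg_left
          (Real.rpow_le_rpow_of_nonpos hd0 this (by linarith)) hA0) (hin w hw) (hin z hz)
    rw [← mul_sub, norm_mul, norm_real, Real.norm_of_nonneg (by linarith), ← hdd] at r3
    have r4 : A * d ^ (α - 1) * ((1 - d) * d) ≤ A * d ^ α := by
      rw [Real.rpow_sub_one hd0.ne']
      have : A * (d ^ α / d) * ((1 - d) * d) = A * d ^ α * (1 - d) := by field_simp
      rw [this]
      exact mul_le_of_le_one_right (by positivity) (by linarith)
    rw [norm_sub_rev] at r1
    calc ‖h z - h w‖ = ‖(h z - h (((1 - d : ℝ) : ℂ) * z)) +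
          (h (((1 - d : ℝ) : ℂ) * z) - h (((1 - d : ℝ) : ℂ) * w)) +
          (h (((1 - d : ℝ) : ℂ) * w) - h w)‖ := by congr 1; ring
      _ ≤ A / α * d ^ α + A * d ^ α + A / α * d ^ α :=
        norm_add₃_le.trans (add_le_add (add_le_add r1 (r3.trans r4)) r2)
      _ = _ := by ring
  · have r1 := rad z hz 1 (by simp)
    have r2 := rad w hw 1 (by simp)
    simp only [sub_self, ofReal_zero, zero_mul, Real.one_rpow, mul_one] at r1 r2
    rw [norm_sub_rev] at r1
    have : (1 : ℝ) ≤ ‖z - w‖ ^ α := Real.one_le_rpow hle h0.le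
    calc ‖h z - h w‖ ≤ ‖h z - h 0‖ + ‖h 0 - h w‖ := norm_sub_le_norm_sub_add_norm_sub _ _ _
      _ ≤ A * (2 / α) * 1 := by
        have : A * (2 / α) * 1 = A / α + A / α := by ring
        linarith
      _ ≤ _ := by gcongr; linarith

end DiscEstimates

section DiscPart

/-- Periodic `C^{1,α}` data on the unit circle with derivative `Q`. -/
structure IsCircleData (α M : ℝ) (q Q : ℝ → ℝ) : Prop where
  hasDeriv : ∀ t, HasDerivAt q (Q t) t
  periodic : Function.Periodic q (2 * Real.pi)
  bound : ∀ t, |q t| ≤ M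
  bound_deriv : ∀ t, |Q t| ≤ M
  holder_deriv : ∀ s t, |Q s - Q t| ≤ M * |s - t| ^ α

theorem min_le_rpow {α x : ℝ} (h0 : 0 < α) (h1 : α < 1) (hx : 0 ≤ x) : min 1 x ≤ x ^ α := by
  rcases le_total x 1 with h | h
  · rw [min_eq_right h]
    rcases hx.eq_or_lt with rfl | hx
    · rw [Real.zero_rpow h0.ne']
    · simpa using Real.rpow_le_rpow_of_exponent_ge hx h h1.le
  · rw [min_eq_left h]
    exact Real.one_le_rpow h h0.le

theorem norm_cexpI_sub_le (s t : ℝ) : ‖cexpI s - cexpI t‖ ≤ |s - t| := by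
  have := Convex.norm_image_sub_le_of_norm_hasDerivWithin_le (f := cexpI) (C := 1) (s := univ)
    (fun x _ => (hasDerivAt_cexpI x).hasDerivWithinAt) (fun x _ => by simp [norm_cexpI])
    convex_univ (mem_univ t) (mem_univ s)
  simpa using this

theorem norm_cexpI_sub_le_rpow {α : ℝ} (h0 : 0 < α) (h1 : α < 1) (s t : ℝ) :
    ‖cexpI s - cexpI t‖ ≤ 2 * |s - t| ^ α := by
  have h := min_le_rpow h0 h1 (abs_nonneg (s - t))
  have h3 := norm_cexpI_sub_le s t
  have h4 : ‖cexpI s - cexpI t‖ ≤ 2 := (norm_sub_le _ _).trans (by simp [norm_cexpI]; norm_num)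
  have := abs_nonneg (s - t)
  rcases min_cases 1 |s - t| with ⟨e, _⟩ | ⟨e, _⟩ <;> rw [e] at h <;> linarith

namespace IsCircleData

variable {α M : ℝ} {q Q : ℝ → ℝ}

theorem continuous (h : IsCircleData α M q Q) : Continuous q :=
  continuous_iff_continuousAt.2 fun t => (h.hasDeriv t).continuousAt

theorem nonneg (h : IsCircleData α M q Q) : 0 ≤ M := (abs_nonneg _).trans (h.bound 0)

theorem continuous_deriv (h : IsCircleData α M q Q) (h0 : 0 < α) : Continuous Q := by
  refine continuous_iff_continuousAt.2 fun t => ?_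
  rw [ContinuousAt, tendsto_iff_norm_sub_tendsto_zero]
  refine squeeze_zero (fun _ => norm_nonneg _) (fun s => h.holder_deriv s t) ?_
  have : Continuous fun s : ℝ => M * |s - t| ^ α :=
    continuous_const.mul ((by fun_prop : Continuous fun s : ℝ => |s - t|).rpow_const
      fun _ => Or.inr h0.le)
  simpa [Real.zero_rpow h0.ne'] using this.tendsto t

theorem periodic_deriv (h : IsCircleData α M q Q) : Function.Periodic Q (2 * Real.pi) := fun t => by
  have h1 := (h.hasDeriv (t + 2 * Real.pi)).comp_add_const t (2 * Real.pi)
  have e : (fun x => q (x + 2 * Real.pi)) = q := funext h.periodic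
  rw [e] at h1
  exact h1.unique (h.hasDeriv t)

theorem holder (h : IsCircleData α M q Q) (h0 : 0 < α) (h1 : α < 1) (s t : ℝ) :
    |q s - q t| ≤ 2 * M * |s - t| ^ α := by
  have hm := min_le_rpow h0 h1 (abs_nonneg (s - t))
  have hM := h.nonneg
  have h3 : |q s - q t| ≤ M * |s - t| := by
    have := Convex.norm_image_sub_le_of_norm_hasDerivWithin_le (f := q) (C := M) (s := univ)
      (fun x _ => (h.hasDeriv x).hasDerivWithinAt) (fun x _ => h.bound_deriv x)
      convex_univ (mem_univ t) (mem_univ s)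
    simpa using this
  have h4 : |q s - q t| ≤ 2 * M := by
    have h5 := abs_sub (q s) (q t)
    linarith [h.bound s, h.bound t]
  rcases min_cases 1 |s - t| with ⟨e, _⟩ | ⟨e, _⟩ <;> rw [e] at hm
  · nlinarith
  · have : 0 ≤ M * |s - t| ^ α := by positivity
    nlinarith

end IsCircleData

/-- Analytic completion of boundary data `q` on the unit circle. -/
noncomputable def discH (q : ℝ → ℝ) (z : ℂ) : ℂ :=
  (Real.pi : ℂ)⁻¹ * cauchyT (fun t => (q t : ℂ)) z -
    ((2 * Real.pi)⁻¹ * ∫ t in (0 : ℝ)..(2 * Real.pi), q t : ℝ)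

/-- Boundary density of the second derivative. -/
noncomputable def discDensity (Q : ℝ → ℝ) (t : ℝ) : ℂ := -I * Q t * cexpI (-2 * t)

/-- The second derivative of the solution. -/
noncomputable def discK (Q : ℝ → ℝ) (z : ℂ) : ℂ :=
  (Real.pi : ℂ)⁻¹ * cauchyT (discDensity Q) z

/-- Derivative of `discH` at the origin. -/
noncomputable def discC (q : ℝ → ℝ) : ℂ := (Real.pi : ℂ)⁻¹ * cauchyT' (fun t => (q t : ℂ)) 0

/-- The first derivative of the solution. -/
noncomputable def discP (Q : ℝ → ℝ) (z : ℂ) : ℂ := wedgeIntegral 0 z (discK Q)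

/-- Analytic solution of `Re (z G' - G) = Re (H - c z)`. -/
noncomputable def discG (q Q : ℝ → ℝ) (z : ℂ) : ℂ := z * discP Q z - discH q z + discC q * z

variable {α M : ℝ} {q Q : ℝ → ℝ}

theorem continuous_discDensity (hQ : Continuous Q) : Continuous (discDensity Q) := by
  have := continuous_cexpI
  unfold discDensity
  fun_prop

theorem hasDerivAt_discH (hq : Continuous q) {z : ℂ} (hz : z ∈ ball (0 : ℂ) 1) :
    HasDerivAt (discH q) ((Real.pi : ℂ)⁻¹ * cauchyT' (fun t => (q t : ℂ)) z) z :=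
  ((hasDerivAt_cauchyT (by fun_prop) hz).const_mul _).sub_const _

theorem hasDerivAt_discK (hQ : Continuous Q) {z : ℂ} (hz : z ∈ ball (0 : ℂ) 1) :
    HasDerivAt (discK Q) ((Real.pi : ℂ)⁻¹ * cauchyT' (discDensity Q) z) z :=
  (hasDerivAt_cauchyT (continuous_discDensity hQ) hz).const_mul _

theorem hasDerivAt_discP (hQ : Continuous Q) {z : ℂ} (hz : z ∈ ball (0 : ℂ) 1) :
    HasDerivAt (discP Q) (discK Q z) z := by
  have hd : DifferentiableOn ℂ (discK Q) (ball 0 1) := fun w hw =>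
    (hasDerivAt_discK hQ hw).differentiableAt.differentiableWithinAt
  exact hd.isConservativeOn.hasDerivAt_wedgeIntegral hd.continuousOn hz

theorem discP_zero (Q : ℝ → ℝ) : discP Q 0 = 0 := by simp [discP, wedgeIntegral]

theorem IsCircleData.deriv_discH_eq (h : IsCircleData α M q Q) (h0 : 0 < α) {z : ℂ}
    (hz : z ∈ ball (0 : ℂ) 1) :
    (Real.pi : ℂ)⁻¹ * cauchyT' (fun t => (q t : ℂ)) z = z * discK Q z + discC q := by
  have hQ := h.continuous_deriv h0
  have hd : ∀ t : ℝ, HasDerivAt (fun t => (q t : ℂ)) (Q t) t := fun t => (h.hasDeriv t).ofReal_comp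
  have hQc : Continuous fun t => (Q t : ℂ) := by fun_prop
  have hper : Function.Periodic (fun t => (q t : ℂ)) (2 * Real.pi) := fun t => by
    simp only [h.periodic t]
  have hz0 : (0 : ℂ) ∈ ball (0 : ℂ) 1 := by simp
  have hce := continuous_cexpI
  have i1 : ∀ w ∈ ball (0 : ℂ) 1, IntervalIntegrable
      (fun t => (Q t : ℂ) * (1 / (cexpI t - w))) volume 0 (2 * Real.pi) := fun w hw => by
    have h := cexpI_sub_ne_zero hw
    refine Continuous.intervalIntegrable ?_ _ _
    fun_prop (disch := exact h)
  rw [discC, discK, cauchyT, cauchyT'_eq_of_hasDerivAt hd hQc hper hz,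
    cauchyT'_eq_of_hasDerivAt hd hQc hper hz0]
  rw [← sub_eq_iff_eq_add, ← mul_sub, ← mul_sub, ← intervalIntegral.integral_sub (i1 z hz) (i1 0 hz0),
    mul_left_comm z]
  congr 1
  rw [← intervalIntegral.integral_const_mul, ← intervalIntegral.integral_const_mul]
  refine intervalIntegral.integral_congr fun t _ => ?_
  have e1 := cexpI_sub_ne_zero hz t
  have e2 : cexpI t ≠ 0 := by simpa using cexpI_sub_ne_zero hz0 t
  have e3 : cexpI (-2 * t) * (cexpI t * cexpI t) = 1 := by
    rw [← cexpI_add, ← cexpI_add, show -2 * t + (t + t) = 0 by ring]; simp [cexpI]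
  have e4 : cexpI (-2 * t) = (cexpI t * cexpI t)⁻¹ := eq_inv_of_mul_eq_one_left e3
  simp only [discDensity, e4]
  field_simp
  ring

theorem IsCircleData.hasDerivAt_discG (h : IsCircleData α M q Q) (h0 : 0 < α) {z : ℂ}
    (hz : z ∈ ball (0 : ℂ) 1) : HasDerivAt (discG q Q) (discP Q z) z := by
  have h1 := hasDerivAt_discH h.continuous hz
  rw [h.deriv_discH_eq h0 hz] at h1
  have h2 := ((((hasDerivAt_id z).mul (hasDerivAt_discP (h.continuous_deriv h0) hz)).sub h1).add
    ((hasDerivAt_id z).const_mul (discC q)))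
  refine h2.congr_deriv ?_
  simp only [id_eq]
  ring

/-- Constant in the Schauder estimate on the disc. -/
noncomputable def discConst (α : ℝ) : ℝ :=
  9 + 2 * (10 * Real.pi * lineMass α * (2 / α + 1))

theorem IsCircleData.norm_discDensity_sub_le (h : IsCircleData α M q Q) (h0 : 0 < α) (h1 : α < 1)
    (s t : ℝ) : ‖discDensity Q s - discDensity Q t‖ ≤ (5 * M) * |s - t| ^ α := by
  have hM := h.nonneg
  have e : discDensity Q s - discDensity Q t = -I * (((Q s - Q t : ℝ) : ℂ) * cexpI (-2 * s)) +
      -I * (Q t * (cexpI (-2 * s) - cexpI (-2 * t))) := by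
    simp only [discDensity]; push_cast; ring
  have h3 := norm_cexpI_sub_le_rpow h0 h1 (-2 * s) (-2 * t)
  have h4 : |-2 * s - -2 * t| ^ α ≤ 2 * |s - t| ^ α := by
    rw [← mul_sub, abs_mul, Real.mul_rpow (abs_nonneg _) (abs_nonneg _)]
    gcongr
    norm_num
    calc (2 : ℝ) ^ α ≤ 2 ^ (1 : ℝ) := Real.rpow_le_rpow_of_exponent_le (by norm_num) h1.le
      _ = 2 := by norm_num
  rw [e]
  refine (norm_add_le _ _).trans ?_
  simp only [norm_mul, norm_neg, norm_I, norm_cexpI, norm_real, one_mul, mul_one, Real.norm_eq_abs]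
  have h5 := h.holder_deriv s t
  have h6 : |Q t| * ‖cexpI (-2 * s) - cexpI (-2 * t)‖ ≤ M * (4 * |s - t| ^ α) :=
    mul_le_mul (h.bound_deriv t) (by linarith) (norm_nonneg _) hM
  linarith

end DiscPart

section DiscBounds

variable {α M : ℝ} {q Q : ℝ → ℝ}

theorem norm_inv_pi_mul_integral_le {f : ℝ → ℂ} {M : ℝ} (hf : ∀ t, ‖f t‖ ≤ M) :
    ‖(Real.pi : ℂ)⁻¹ * ∫ t in (0 : ℝ)..(2 * Real.pi), f t‖ ≤ 2 * M := by
  have hpi := Real.pi_pos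
  have := intervalIntegral.norm_integral_le_of_norm_le_const (a := 0) (b := 2 * Real.pi)
    (fun t _ => hf t)
  rw [sub_zero, abs_of_pos (by positivity)] at this
  rw [norm_mul, norm_inv, norm_real, Real.norm_of_nonneg hpi.le, inv_mul_le_iff₀ hpi]
  linarith

/-- The Hölder constant of the second derivative in the disc estimate. -/
noncomputable def discHolder (α : ℝ) : ℝ := 10 * Real.pi * lineMass α * (2 / α + 1)

theorem discHolder_nonneg (h0 : 0 < α) : 0 ≤ discHolder α := by
  have := lineMass_nonneg α
  unfold discHolder
  positivity

theorem discConst_eq (α : ℝ) : discConst α = 9 + 2 * discHolder α := rfl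

namespace IsCircleData

theorem norm_discC_le (h : IsCircleData α M q Q) : ‖discC q‖ ≤ 2 * M := by
  refine norm_inv_pi_mul_integral_le fun t => ?_
  simpa [norm_cexpI] using h.bound t

theorem norm_discK_sub_le (h : IsCircleData α M q Q) (h0 : 0 < α) (h1 : α < 1) {z w : ℂ}
    (hz : z ∈ ball (0 : ℂ) 1) (hw : w ∈ ball (0 : ℂ) 1) :
    ‖discK Q z - discK Q w‖ ≤ discHolder α * M * ‖z - w‖ ^ α := by
  have hQ := h.continuous_deriv h0
  have hper : Function.Periodic (discDensity Q) (2 * Real.pi) := fun t => by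
    rw [discDensity, discDensity, h.periodic_deriv t]
    congr 1
    rw [show -2 * (t + 2 * Real.pi) = -2 * t - 2 * Real.pi - 2 * Real.pi by ring,
      cexpI_periodic.sub_eq, cexpI_periodic.sub_eq]
  have hpi := Real.pi_pos
  have key := norm_sub_le_of_norm_deriv_le h0 h1 (A := 10 * Real.pi * lineMass α * M)
    (fun z hz => hasDerivAt_discK hQ hz) (fun z hz => by
      rw [norm_mul, norm_inv, norm_real, Real.norm_of_nonneg hpi.le, inv_mul_le_iff₀ hpi]
      refine (norm_cauchyT'_le h0 h1 (continuous_discDensity hQ) hper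
        (h.norm_discDensity_sub_le h0 h1) hz).trans (le_of_eq ?_)
      ring) hz hw
  refine key.trans (le_of_eq ?_)
  rw [discHolder]; ring

theorem norm_discK_le (h : IsCircleData α M q Q) (h0 : 0 < α) (h1 : α < 1) {z : ℂ}
    (hz : z ∈ ball (0 : ℂ) 1) : ‖discK Q z‖ ≤ (2 + discHolder α) * M := by
  have hz0 : (0 : ℂ) ∈ ball (0 : ℂ) 1 := by simp
  have hK0 : ‖discK Q 0‖ ≤ 2 * M := by
    refine norm_inv_pi_mul_integral_le fun t => ?_
    simpa [norm_cexpI, discDensity, norm_mul, norm_div] using h.bound_deriv t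
  have h3 := h.norm_discK_sub_le h0 h1 hz hz0
  have h4 : ‖z - 0‖ ^ α ≤ 1 :=
    Real.rpow_le_one (norm_nonneg _) (by simpa using (mem_ball_zero_iff.1 hz).le) h0.le
  have h5 : discHolder α * M * ‖z - 0‖ ^ α ≤ discHolder α * M :=
    mul_le_of_le_one_right (mul_nonneg (discHolder_nonneg h0) h.nonneg) h4
  have h6 := norm_le_norm_add_norm_sub' (discK Q z) (discK Q 0)
  linarith

theorem norm_sub_zero_le {f f' : ℂ → ℂ} {C : ℝ}
    (hf : ∀ z ∈ ball (0 : ℂ) 1, HasDerivAt f (f' z) z)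
    (hC : ∀ z ∈ ball (0 : ℂ) 1, ‖f' z‖ ≤ C) {z : ℂ} (hz : z ∈ ball (0 : ℂ) 1) :
    ‖f z - f 0‖ ≤ C := by
  have hz0 : (0 : ℂ) ∈ ball (0 : ℂ) 1 := by simp
  have h := (convex_ball (0 : ℂ) 1).norm_image_sub_le_of_norm_hasDerivWithin_le
    (fun x hx => (hf x hx).hasDerivWithinAt) hC hz0 hz
  refine h.trans (mul_le_of_le_one_right ((norm_nonneg _).trans (hC 0 hz0)) ?_)
  simpa using (mem_ball_zero_iff.1 hz).le

theorem norm_discP_le (h : IsCircleData α M q Q) (h0 : 0 < α) (h1 : α < 1) {z : ℂ}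
    (hz : z ∈ ball (0 : ℂ) 1) : ‖discP Q z‖ ≤ (2 + discHolder α) * M := by
  have := norm_sub_zero_le (fun z hz => hasDerivAt_discP (h.continuous_deriv h0) hz)
    (fun z hz => h.norm_discK_le h0 h1 hz) hz
  rwa [discP_zero, sub_zero] at this

theorem norm_discH_le (h : IsCircleData α M q Q) (h0 : 0 < α) (h1 : α < 1) {z : ℂ}
    (hz : z ∈ ball (0 : ℂ) 1) : ‖discH q z‖ ≤ (5 + discHolder α) * M := by
  have hpi := Real.pi_pos
  have hH0 : ‖discH q 0‖ ≤ M := by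
    have e : discH q 0 = (2 : ℂ)⁻¹ * ((Real.pi : ℂ)⁻¹ *
        ∫ t in (0 : ℝ)..(2 * Real.pi), (q t : ℂ)) := by
      have e2 : ∀ t, cexpI t ≠ 0 := fun t => norm_ne_zero_iff.1 (by simp [norm_cexpI])
      simp only [discH, cauchyT, sub_zero, div_self (e2 _), mul_one]
      push_cast
      rw [intervalIntegral.integral_ofReal]
      ring
    have := norm_inv_pi_mul_integral_le (f := fun t => (q t : ℂ)) (M := M)
      (fun t => by simpa using h.bound t)
    rw [e, norm_mul, norm_inv, norm_ofNat]
    linarith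
  have h3 := norm_sub_zero_le (C := (4 + discHolder α) * M)
    (fun z hz => hasDerivAt_discH h.continuous hz)
    (fun z hz => by
      rw [h.deriv_discH_eq h0 hz]
      refine (norm_add_le _ _).trans ?_
      rw [norm_mul]
      have h5 := h.norm_discK_le h0 h1 hz
      have h6 : ‖z‖ * ‖discK Q z‖ ≤ ‖discK Q z‖ :=
        mul_le_of_le_one_left (norm_nonneg _) (mem_ball_zero_iff.1 hz).le
      linarith [h.norm_discC_le]) hz
  have h6 := norm_le_norm_add_norm_sub' (discH q z) (discH q 0)
  linarith

theorem norm_discG_le (h : IsCircleData α M q Q) (h0 : 0 < α) (h1 : α < 1) {z : ℂ}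
    (hz : z ∈ ball (0 : ℂ) 1) : ‖discG q Q z‖ ≤ discConst α * M := by
  have hz1 := (mem_ball_zero_iff.1 hz).le
  have h3 : ‖z * discP Q z‖ ≤ ‖discP Q z‖ := by
    rw [norm_mul]; exact mul_le_of_le_one_left (norm_nonneg _) hz1
  have h4 : ‖discC q * z‖ ≤ ‖discC q‖ := by
    rw [norm_mul]; exact mul_le_of_le_one_right (norm_nonneg _) hz1
  have h5 := norm_add_le (z * discP Q z - discH q z) (discC q * z)
  have h6 := norm_sub_le (z * discP Q z) (discH q z)
  rw [discG, discConst_eq]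
  linarith [h.norm_discP_le h0 h1 hz, h.norm_discH_le h0 h1 hz, h.norm_discC_le]

/-- Radial convergence of the Poisson integral, with a rate. -/
theorem abs_re_discH_sub_le (h : IsCircleData α M q Q) (h0 : 0 < α) (h1 : α < 1) {r : ℝ}
    (hr0 : 0 ≤ r) (hr : r < 1) (θ : ℝ) :
    |(discH q (r * cexpI θ)).re - q θ| ≤ 4 * Real.pi * M * lineMass α * (1 - r) ^ α := by
  have hpi := Real.pi_pos
  set z := (r : ℂ) * cexpI θ with hz
  have hnz : ‖z‖ = r := by rw [hz, norm_mul, norm_cexpI, norm_real, mul_one, Real.norm_of_nonneg hr0]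
  have hzb : z ∈ ball (0 : ℂ) 1 := by rwa [mem_ball_zero_iff, hnz]
  have hqc := h.continuous
  have hec := continuous_cexpI
  have hne := cexpI_sub_ne_zero hzb
  have i1 := (continuous_cauchyT_integrand (g := fun t => (q t : ℂ)) (by fun_prop)
    hzb).intervalIntegrable (μ := volume) 0 (2 * Real.pi)
  have i2 := (continuous_cauchyT_integrand (g := fun _ => (q θ : ℂ)) continuous_const
    hzb).intervalIntegrable (μ := volume) 0 (2 * Real.pi)
  have hc := cauchyT_const (q θ : ℂ) hzb
  have e1 : discH q z - q θ = (2 * Real.pi : ℂ)⁻¹ * ∫ t in (0 : ℝ)..(2 * Real.pi),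
      ((q t - q θ : ℝ) : ℂ) * (2 * (cexpI t / (cexpI t - z)) - 1) := by
    have e2 : ∀ t, ((q t - q θ : ℝ) : ℂ) * (2 * (cexpI t / (cexpI t - z)) - 1) =
        2 * ((q t : ℂ) * (cexpI t / (cexpI t - z)) - q θ * (cexpI t / (cexpI t - z))) -
          ((q t : ℂ) - q θ) := fun t => by push_cast; ring
    simp only [e2]
    rw [intervalIntegral.integral_sub ((i1.sub i2).const_mul 2)
      (Continuous.intervalIntegrable (by fun_prop) _ _),
      intervalIntegral.integral_const_mul, intervalIntegral.integral_sub i1 i2,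
      intervalIntegral.integral_sub (Continuous.intervalIntegrable (by fun_prop) _ _)
      (Continuous.intervalIntegrable (by fun_prop) _ _), ← cauchyT, ← cauchyT, hc,
      intervalIntegral.integral_const, intervalIntegral.integral_ofReal, discH]
    have : (Real.pi : ℂ) ≠ 0 := by exact_mod_cast hpi.ne'
    simp only [sub_zero, real_smul]
    push_cast
    field_simp
    ring
  have e3 : (discH q z).re - q θ = (2 * Real.pi)⁻¹ * ∫ t in (0 : ℝ)..(2 * Real.pi),
      (q t - q θ) * ((1 - r ^ 2) / ‖cexpI t - z‖ ^ 2) := by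
    have := congrArg re e1
    rw [sub_re, ofReal_re] at this
    rw [this, ← ofReal_ofNat, ← ofReal_mul, ← ofReal_inv, re_ofReal_mul]
    congr 1
    have hi := (reCLM.intervalIntegral_comp_comm (μ := volume) (a := 0) (b := 2 * Real.pi)
      (f := fun t => ((q t - q θ : ℝ) : ℂ) * (2 * (cexpI t / (cexpI t - z)) - 1))
      (Continuous.intervalIntegrable (by fun_prop (disch := exact hne)) _ _))
    simp only [reCLM_apply] at hi
    rw [ofReal_ofNat, ← hi]
    refine intervalIntegral.integral_congr fun t _ => ?_
    simp only [re_ofReal_mul]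
    congr 1
    have hn : 0 < normSq (cexpI t - z) := normSq_pos.2 (hne t)
    have h6 : normSq (cexpI t) = 1 := by rw [normSq_eq_norm_sq, norm_cexpI, one_pow]
    have h7 : normSq z = r ^ 2 := by rw [normSq_eq_norm_sq, hnz]
    rw [← normSq_eq_norm_sq, sub_re, one_re, ← ofReal_ofNat, re_ofReal_mul, div_re, ← h7, ← h6]
    rw [eq_div_iff hn.ne']
    field_simp
    simp only [normSq_apply, sub_re, sub_im] at h6 ⊢
    linear_combination (2 * (z.re * (cexpI t).re + z.im * (cexpI t).im) - 
      ((cexpI t).re ^ 2 + (cexpI t).im ^ 2) - (z.re ^ 2 + z.im ^ 2)) * h6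
  have hJ := integral_holder_div_sq_le h0 h1 (g := fun t => (q t : ℂ)) (N := 2 * M)
    (by fun_prop) (fun t => by simp only [h.periodic t])
    (fun s t => by
      rw [← ofReal_sub, norm_real]; exact h.holder h0 h1 s t) hr0 hr θ
  have hr2 : 0 ≤ 1 - r ^ 2 := by nlinarith
  have hb : |∫ t in (0 : ℝ)..(2 * Real.pi), (q t - q θ) * ((1 - r ^ 2) / ‖cexpI t - z‖ ^ 2)| ≤
      (1 - r ^ 2) * (2 * Real.pi ^ 2 * (2 * M) * ((1 - r) ^ (α - 1) * lineMass α)) := by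
    rw [← Real.norm_eq_abs]
    refine (intervalIntegral.norm_integral_le_integral_norm (by positivity)).trans ?_
    refine le_trans (le_of_eq ?_) (mul_le_mul_of_nonneg_left hJ hr2)
    rw [← intervalIntegral.integral_const_mul]
    refine intervalIntegral.integral_congr fun t _ => ?_
    simp only [norm_mul, norm_div, norm_pow, norm_norm, Real.norm_of_nonneg hr2, ← ofReal_sub,
      norm_real]
    ring
  have hd : 0 < 1 - r := by linarith
  have hrp : (1 - r) ^ α = (1 - r) * (1 - r) ^ (α - 1) := by
    rw [Real.rpow_sub_one hd.ne']; field_simp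
  rw [e3, abs_mul, abs_of_pos (by positivity), inv_mul_le_iff₀ (by positivity), hrp]
  refine hb.trans ?_
  have hX : 0 ≤ 2 * Real.pi ^ 2 * (2 * M) * ((1 - r) ^ (α - 1) * lineMass α) := by
    have := h.nonneg
    have := lineMass_nonneg α
    positivity
  calc _ ≤ (2 * (1 - r)) * (2 * Real.pi ^ 2 * (2 * M) * ((1 - r) ^ (α - 1) * lineMass α)) :=
        mul_le_mul_of_nonneg_right (by nlinarith) hX
    _ = _ := by ring

end IsCircleData

theorem HasDerivAt.hasFDerivAt_re_reMulCLM {f : ℂ → ℂ} {f' z : ℂ} (h : HasDerivAt f f' z) :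
    HasFDerivAt (fun z => (f z).re) (reMulCLM f') z :=
  (reCLM.hasFDerivAt.comp z (h.hasFDerivAt.restrictScalars ℝ)).congr_fderiv (by
    ext v; simp [mul_comm])

theorem HasDerivAt.hasFDerivAt_wirtCLM {f : ℂ → ℂ} {f' z : ℂ} (h : HasDerivAt f f' z) :
    HasFDerivAt f (wirtCLM f' 0) z :=
  (h.hasFDerivAt.restrictScalars ℝ).congr_fderiv (by
    ext v; simp [mul_comm])

/-- Constant in the Schauder estimate on the disc of radius `R`. -/
noncomputable def discScale (α R : ℝ) : ℝ :=
  discConst α * (1 + R⁻¹ + R⁻¹ ^ 2 + R⁻¹ ^ 2 * R⁻¹ ^ α)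

theorem discScale_nonneg {R : ℝ} (h0 : 0 < α) (hR : 0 < R) : 0 ≤ discScale α R := by
  have := discHolder_nonneg h0
  rw [discScale, discConst_eq]
  positivity

theorem IsCircleData.isC2Holder (h : IsCircleData α M q Q) (h0 : 0 < α) (h1 : α < 1) {R : ℝ}
    (hR : 0 < R) :
    IsC2Holder α (ball (0 : ℂ) R) (M * discScale α R)
      (fun z => (discG q Q ((R⁻¹ : ℝ) * z)).re) (fun z => (R⁻¹ : ℝ) * discP Q ((R⁻¹ : ℝ) * z))
      (fun z => ((R⁻¹ : ℝ) : ℂ) ^ 2 * discK Q ((R⁻¹ : ℝ) * z)) (fun _ => 0) := by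
  have hQ := h.continuous_deriv h0
  have hM := h.nonneg
  have hH := discHolder_nonneg h0
  have hRi : 0 < R⁻¹ := inv_pos.2 hR
  set ρ : ℝ := R⁻¹ with hρ
  have hmem : ∀ z ∈ ball (0 : ℂ) R, (ρ : ℂ) * z ∈ ball (0 : ℂ) 1 := fun z hz => by
    rw [mem_ball_zero_iff] at hz ⊢
    rw [norm_mul, norm_real, Real.norm_of_nonneg hRi.le, hρ, inv_mul_lt_iff₀ hR]
    simpa using hz
  have hρα : 0 < ρ ^ α := Real.rpow_pos_of_pos hRi α
  have hK : M * discScale α R =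
      M * (discConst α * (1 + ρ + ρ ^ 2 + ρ ^ 2 * ρ ^ α)) := rfl
  have hDC : (2 + discHolder α) * M ≤ M * discConst α := by
    rw [discConst_eq]; nlinarith
  have hDH : discHolder α * M ≤ M * discConst α := by
    rw [discConst_eq]; nlinarith
  have hDC0 : 0 ≤ M * discConst α := by
    rw [discConst_eq]; positivity
  set D := M * discConst α with hD
  have hK' : M * discScale α R = D + D * ρ + D * ρ ^ 2 + D * (ρ ^ 2 * ρ ^ α) := by
    rw [hK, hD]; ring
  have p1 : 0 ≤ D * ρ := by positivity
  have p2 : 0 ≤ D * ρ ^ 2 := by positivity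
  have p3 : 0 ≤ D * (ρ ^ 2 * ρ ^ α) := by positivity
  have hlin : ∀ z : ℂ, HasDerivAt (fun z : ℂ => (ρ : ℂ) * z) ρ z := fun z => by
    simpa using (hasDerivAt_id z).const_mul (ρ : ℂ)
  have hn : ‖(ρ : ℂ)‖ = ρ := by rw [norm_real, Real.norm_of_nonneg hRi.le]
  rw [hK']
  refine ⟨fun z hz => ?_, fun z hz => ?_, fun z hz => ?_, fun z hz => ?_, fun z hz => ?_,
    fun z hz => ?_, fun z hz w hw => ?_, fun z hz w hw => ?_⟩
  · have := ((h.hasDerivAt_discG h0 (hmem z hz)).comp z (hlin z)).hasFDerivAt_re_reMulCLM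
    rw [mul_comm] at this
    exact this.hasFDerivWithinAt
  · have := (((hasDerivAt_discP hQ (hmem z hz)).comp z (hlin z)).const_mul
      (ρ : ℂ)).hasFDerivAt_wirtCLM
    rw [show (ρ : ℂ) * (discK Q (ρ * z) * ρ) = (ρ : ℂ) ^ 2 * discK Q (ρ * z) by ring] at this
    exact this.hasFDerivWithinAt
  · have := (abs_re_le_norm _).trans (h.norm_discG_le h0 h1 (hmem z hz))
    rw [mul_comm (discConst α), ← hD] at this
    linarith
  · have := mul_le_mul_of_nonneg_left ((h.norm_discP_le h0 h1 (hmem z hz)).trans hDC) hRi.le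
    rw [norm_mul, hn]
    linarith
  · have := mul_le_mul_of_nonneg_left ((h.norm_discK_le h0 h1 (hmem z hz)).trans hDC)
      (sq_nonneg ρ)
    rw [norm_mul, norm_pow, hn]
    linarith
  · rw [norm_zero]; positivity
  · have := h.norm_discK_sub_le h0 h1 (hmem z hz) (hmem w hw)
    rw [← mul_sub, norm_mul, hn, Real.mul_rpow hRi.le (norm_nonneg _)] at this
    rw [← mul_sub, norm_mul, norm_pow, hn]
    have hx : 0 ≤ ‖z - w‖ ^ α := by positivity
    calc _ ≤ ρ ^ 2 * (D * (ρ ^ α * ‖z - w‖ ^ α)) := by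
          gcongr
          exact this.trans (mul_le_mul_of_nonneg_right hDH (by positivity))
      _ = D * (ρ ^ 2 * ρ ^ α) * ‖z - w‖ ^ α := by ring
      _ ≤ _ := by gcongr; linarith
  · rw [sub_self, norm_zero]; positivity

end DiscBounds

section Extension

open Filter Topology

theorem uniformContinuousOn_of_holder {E F : Type*} [NormedAddCommGroup E] [NormedAddCommGroup F]
    {f : E → F} {s : Set E} {C β : ℝ} (hβ : 0 < β)
    (h : ∀ z ∈ s, ∀ w ∈ s, ‖f z - f w‖ ≤ C * ‖z - w‖ ^ β) : UniformContinuousOn f s := by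
  rw [Metric.uniformContinuousOn_iff]
  intro ε hε
  have hc : Tendsto (fun x : ℝ => C * x ^ β) (𝓝 0) (𝓝 0) := by
    have : Continuous fun x : ℝ => C * x ^ β :=
      continuous_const.mul (continuous_id.rpow_const fun _ => Or.inr hβ.le)
    simpa [Real.zero_rpow hβ.ne'] using this.tendsto 0
  obtain ⟨δ, hδ, hδ'⟩ := Metric.eventually_nhds_iff.1 (hc.eventually (gt_mem_nhds hε))
  refine ⟨δ, hδ, fun x hx y hy hxy => ?_⟩
  rw [dist_eq_norm] at hxy ⊢
  exact (h x hx y hy).trans_lt (hδ' (by simpa using hxy))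

theorem UniformContinuousOn.tendsto_extendFrom {E F : Type*} [NormedAddCommGroup E]
    [NormedAddCommGroup F] [CompleteSpace F] {f : E → F} {s : Set E} (h : UniformContinuousOn f s)
    {z : E} (hz : z ∈ closure s) : Tendsto f (𝓝[s] z) (𝓝 (extendFrom s f z)) := by
  have := mem_closure_iff_nhdsWithin_neBot.1 hz
  refine _root_.tendsto_extendFrom ?_
  have hc : Cauchy (𝓝[s] z) := cauchy_nhds.mono inf_le_left
  have : Cauchy (map f (𝓝[s] z)) := by
    refine ⟨inferInstance, ?_⟩
    rw [prod_map_map_eq]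
    refine (map_mono (le_inf hc.2 ?_)).trans h
    rw [← prod_principal_principal]
    exact Filter.prod_mono inf_le_right inf_le_right
  exact CompleteSpace.complete this

namespace IsC2Holder

variable {α K : ℝ} {s : Set ℂ} {φ : ℂ → ℝ} {p a b : ℂ → ℂ}

theorem uniformContinuousOn (h : IsC2Holder α s K φ p a b) (hc : Convex ℝ s) :
    UniformContinuousOn φ s :=
  uniformContinuousOn_of_holder (C := K) zero_lt_one fun z hz w hw => by
    rw [Real.rpow_one]
    exact hc.norm_image_sub_le_of_norm_hasFDerivWithin_le h.hasDeriv
      (fun x hx => (norm_reMulCLM_le _).trans (h.bound_p x hx)) hw hz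

theorem uniformContinuousOn_p (h : IsC2Holder α s K φ p a b) (hc : Convex ℝ s) :
    UniformContinuousOn p s :=
  uniformContinuousOn_of_holder (C := K + K) zero_lt_one fun z hz w hw => by
    rw [Real.rpow_one]
    exact hc.norm_image_sub_le_of_norm_hasFDerivWithin_le h.hasDeriv₂
      (fun x hx => (norm_wirtCLM_le _ _).trans (add_le_add (h.bound_a x hx) (h.bound_b x hx)))
      hw hz

theorem uniformContinuousOn_a (h : IsC2Holder α s K φ p a b) (h0 : 0 < α) :
    UniformContinuousOn a s := uniformContinuousOn_of_holder h0 h.holder_a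

theorem uniformContinuousOn_b (h : IsC2Holder α s K φ p a b) (h0 : 0 < α) :
    UniformContinuousOn b s := uniformContinuousOn_of_holder h0 h.holder_b

end IsC2Holder

theorem extendFrom_eq_of_mem {E F : Type*} [TopologicalSpace E]
    [TopologicalSpace F] [T2Space F] {f : E → F} {s : Set E} (h : ContinuousOn f s)
    {z : E} (hz : z ∈ s) : extendFrom s f z = f z := extendFrom_eq (subset_closure hz) (h z hz)

theorem hasFDerivWithinAt_extendFrom {F : Type*} [NormedAddCommGroup F] [NormedSpace ℝ F]
    [CompleteSpace F] {f : ℂ → F} {f' : ℂ → ℂ →L[ℝ] F} {s : Set ℂ}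
    (hs : IsOpen s) (hc : Convex ℝ s) (hu : UniformContinuousOn f s)
    (hf : ∀ z ∈ s, HasFDerivWithinAt f (f' z) s z) {z : ℂ} {L : ℂ →L[ℝ] F}
    (hL : Tendsto f' (𝓝[s] z) (𝓝 L)) : HasFDerivWithinAt (extendFrom s f) L (closure s) z := by
  have hd : ∀ y ∈ s, HasFDerivAt (extendFrom s f) (f' y) y := fun y hy =>
    ((hf y hy).hasFDerivAt (hs.mem_nhds hy)).congr_of_eventuallyEq
      (Filter.eventuallyEq_of_mem (hs.mem_nhds hy) fun w hw =>
        extendFrom_eq_of_mem hu.continuousOn hw)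
  refine hasFDerivWithinAt_closure_of_tendsto_fderiv
    (fun y hy => (hd y hy).differentiableAt.differentiableWithinAt) hc hs (fun y hy => ?_) ?_
  · exact ((continuousOn_extendFrom subset_rfl fun x hx => ⟨_, hu.tendsto_extendFrom hx⟩) y hy).mono
      subset_closure
  · refine hL.congr' ?_
    filter_upwards [self_mem_nhdsWithin] with y hy using (hd y hy).fderiv.symm

theorem norm_extendFrom_le {F : Type*} [NormedAddCommGroup F]
    [CompleteSpace F] {f : ℂ → F} {s : Set ℂ} {K : ℝ} (hu : UniformContinuousOn f s)
    (hK : ∀ z ∈ s, ‖f z‖ ≤ K) {z : ℂ} (hz : z ∈ closure s) : ‖extendFrom s f z‖ ≤ K := by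
  have := mem_closure_iff_nhdsWithin_neBot.1 hz
  refine le_of_tendsto (hu.tendsto_extendFrom hz).norm ?_
  filter_upwards [self_mem_nhdsWithin] with y hy using hK y hy

theorem norm_extendFrom_sub_le {F : Type*} [NormedAddCommGroup F]
    [CompleteSpace F] {f : ℂ → F} {s : Set ℂ} {K β : ℝ} (hβ : 0 < β)
    (hK : ∀ z ∈ s, ∀ w ∈ s, ‖f z - f w‖ ≤ K * ‖z - w‖ ^ β) {z w : ℂ} (hz : z ∈ closure s)
    (hw : w ∈ closure s) : ‖extendFrom s f z - extendFrom s f w‖ ≤ K * ‖z - w‖ ^ β := by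
  have hu := uniformContinuousOn_of_holder hβ hK
  have := mem_closure_iff_nhdsWithin_neBot.1 hz
  have := mem_closure_iff_nhdsWithin_neBot.1 hw
  have h1 : Tendsto (fun x : ℂ × ℂ => ‖f x.1 - f x.2‖) (𝓝[s] z ×ˢ 𝓝[s] w)
      (𝓝 ‖extendFrom s f z - extendFrom s f w‖) :=
    (((hu.tendsto_extendFrom hz).comp tendsto_fst).sub
      ((hu.tendsto_extendFrom hw).comp tendsto_snd)).norm
  have h2 : Tendsto (fun x : ℂ × ℂ => K * ‖x.1 - x.2‖ ^ β) (𝓝[s] z ×ˢ 𝓝[s] w)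
      (𝓝 (K * ‖z - w‖ ^ β)) := by
    have hc : Continuous fun x : ℂ × ℂ => K * ‖x.1 - x.2‖ ^ β :=
      continuous_const.mul ((by fun_prop : Continuous fun x : ℂ × ℂ => ‖x.1 - x.2‖).rpow_const
        fun _ => Or.inr hβ.le)
    refine (hc.tendsto (z, w)).mono_left ?_
    rw [nhds_prod_eq]
    exact Filter.prod_mono inf_le_left inf_le_left
  refine le_of_tendsto_of_tendsto h1 h2 ?_
  filter_upwards [prod_mem_prod (self_mem_nhdsWithin (s := s) (a := z))
    (self_mem_nhdsWithin (s := s) (a := w))] with x hx using hK _ hx.1 _ hx.2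

theorem IsC2Holder.closure_extendFrom {α K : ℝ} {s : Set ℂ} {φ : ℂ → ℝ} {p a b : ℂ → ℂ}
    (h : IsC2Holder α s K φ p a b) (h0 : 0 < α) (hs : IsOpen s) (hc : Convex ℝ s) :
    IsC2Holder α (closure s) K (extendFrom s φ) (extendFrom s p) (extendFrom s a)
      (extendFrom s b) where
  hasDeriv z hz := by
    refine hasFDerivWithinAt_extendFrom hs hc (h.uniformContinuousOn hc) h.hasDeriv ?_
    exact (continuous_reMulCLM.tendsto _).comp ((h.uniformContinuousOn_p hc).tendsto_extendFrom hz)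
  hasDeriv₂ z hz := by
    refine hasFDerivWithinAt_extendFrom hs hc (h.uniformContinuousOn_p hc) h.hasDeriv₂ ?_
    have ha := (h.uniformContinuousOn_a h0).tendsto_extendFrom hz
    have hb := (h.uniformContinuousOn_b h0).tendsto_extendFrom hz
    exact (continuous_wirtCLM.tendsto _).comp (ha.prodMk_nhds hb)
  bound z hz := norm_extendFrom_le (h.uniformContinuousOn hc) h.bound hz
  bound_p z hz := norm_extendFrom_le (h.uniformContinuousOn_p hc) h.bound_p hz
  bound_a z hz := norm_extendFrom_le (h.uniformContinuousOn_a h0) h.bound_a hz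
  bound_b z hz := norm_extendFrom_le (h.uniformContinuousOn_b h0) h.bound_b hz
  holder_a z hz w hw := norm_extendFrom_sub_le h0 h.holder_a hz hw
  holder_b z hz w hw := norm_extendFrom_sub_le h0 h.holder_b hz hw

end Extension

section BoundaryData

theorem IsC2Holder.const_mul {α K : ℝ} {s : Set ℂ} {φ : ℂ → ℝ} {p a b : ℂ → ℂ}
    (h : IsC2Holder α s K φ p a b) (c : ℝ) :
    IsC2Holder α s (|c| * K) (fun z => c * φ z) (fun z => c * p z) (fun z => c * a z)
      (fun z => c * b z) where
  hasDeriv z hz := ((h.hasDeriv z hz).const_mul c).congr_fderiv (by ext v; simp; ring)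
  hasDeriv₂ z hz := ((h.hasDeriv₂ z hz).const_mul (c : ℂ)).congr_fderiv (by ext v; simp; ring)
  bound z hz := by rw [abs_mul]; exact mul_le_mul_of_nonneg_left (h.bound z hz) (abs_nonneg c)
  bound_p z hz := by
    rw [norm_mul, norm_real]; exact mul_le_mul_of_nonneg_left (h.bound_p z hz) (abs_nonneg c)
  bound_a z hz := by
    rw [norm_mul, norm_real]; exact mul_le_mul_of_nonneg_left (h.bound_a z hz) (abs_nonneg c)
  bound_b z hz := by
    rw [norm_mul, norm_real]; exact mul_le_mul_of_nonneg_left (h.bound_b z hz) (abs_nonneg c)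
  holder_a z hz w hw := by
    rw [← mul_sub, norm_mul, norm_real, mul_assoc]
    exact mul_le_mul_of_nonneg_left (h.holder_a z hz w hw) (abs_nonneg c)
  holder_b z hz w hw := by
    rw [← mul_sub, norm_mul, norm_real, mul_assoc]
    exact mul_le_mul_of_nonneg_left (h.holder_b z hz w hw) (abs_nonneg c)

theorem neg_conj_mem_closedBall {R : ℝ} {z : ℂ} (hz : z ∈ closedBall (0 : ℂ) R) :
    -conj z ∈ closedBall (0 : ℂ) R := by simpa using hz

theorem neg_conj_neg_conj (z : ℂ) : -conj (-conj z) = z := by simp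

/-- Reflection in the imaginary axis preserves `C^{2,α}` bounds. -/
theorem IsC2Holder.reflect {α K R : ℝ} {φ : ℂ → ℝ} {p a b : ℂ → ℂ}
    (h : IsC2Holder α (closedBall 0 R) K φ p a b) :
    IsC2Holder α (closedBall 0 R) K (fun z => φ (-conj z)) (fun z => -conj (p (-conj z)))
      (fun z => conj (a (-conj z))) (fun z => conj (b (-conj z))) := by
  have hσ : ∀ z : ℂ, HasFDerivWithinAt (fun z : ℂ => -conj z) (wirtCLM 0 (-1)) (closedBall 0 R) z :=
    fun z => ((hasFDerivAt_conj z).neg.congr_fderiv (by ext v; simp)).hasFDerivWithinAt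
  have hm : MapsTo (fun z : ℂ => -conj z) (closedBall 0 R) (closedBall 0 R) :=
    fun z hz => neg_conj_mem_closedBall hz
  have hsub : ∀ z w : ℂ, ‖-conj z - -conj w‖ = ‖z - w‖ := fun z w => by
    rw [← neg_sub', norm_neg, ← map_sub, RCLike.norm_conj]
  refine ⟨fun z hz => ?_, fun z hz => ?_, fun z hz => h.bound _ (hm hz), fun z hz => ?_,
    fun z hz => ?_, fun z hz => ?_, fun z hz w hw => ?_, fun z hz w hw => ?_⟩
  · refine ((h.hasDeriv _ (hm hz)).comp z (hσ z) hm).congr_fderiv ?_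
    ext v
    simp
  · have h1 := (h.hasDeriv₂ _ (hm hz)).comp z (hσ z) hm
    refine (((hasFDerivAt_conj _).comp_hasFDerivWithinAt z h1).neg).congr_fderiv ?_
    ext v
    simp
    ring
  · rw [norm_neg, RCLike.norm_conj]; exact h.bound_p _ (hm hz)
  · rw [RCLike.norm_conj]; exact h.bound_a _ (hm hz)
  · rw [RCLike.norm_conj]; exact h.bound_b _ (hm hz)
  · rw [← map_sub, RCLike.norm_conj, ← hsub z w]; exact h.holder_a _ (hm hz) _ (hm hw)
  · rw [← map_sub, RCLike.norm_conj, ← hsub z w]; exact h.holder_b _ (hm hz) _ (hm hw)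

/-- Boundary datum left for the harmonic part once the particular solution `u` is subtracted. -/
noncomputable def bdData (R : ℝ) (f : ℝ → ℝ) (u : ℂ → ℝ) (p : ℂ → ℂ) (θ : ℝ) : ℝ :=
  R * f θ - R * (p (R * cexpI θ) * cexpI θ).re + u (R * cexpI θ)

/-- Derivative of `bdData`. -/
noncomputable def bdDeriv (R : ℝ) (f : ℝ → ℝ) (a b : ℂ → ℂ) (θ : ℝ) : ℝ :=
  R * f θ - R ^ 2 * (I * (a (R * cexpI θ) * cexpI (2 * θ) - b (R * cexpI θ))).re

/-- Constant relating interior bounds to bounds on `bdData`. -/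
noncomputable def bdConst (α R : ℝ) : ℝ := 1 + R + R ^ 2 * (6 + 2 * R ^ α)

theorem IsC2Holder.isCircleData {α K M R : ℝ} {φ : ℂ → ℝ} {p a b : ℂ → ℂ} {f : ℝ → ℝ}
    (h : IsC2Holder α (closedBall 0 R) K φ p a b) (h0 : 0 < α) (h1 : α < 1) (hR : 0 < R)
    (hf : ContDiff ℝ 1 f) (hper : Function.Periodic f (2 * Real.pi)) (hb : ∀ θ, |f θ| ≤ M)
    (hb' : ∀ θ, |deriv f θ| ≤ M)
    (hh : ∀ s t, |deriv f s - deriv f t| ≤ M * |s - t| ^ α) :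
    IsCircleData α (M * R + K * bdConst α R) (bdData R f φ p) (bdDeriv R (deriv f) a b) := by
  have hnz : ∀ θ, ‖(R : ℂ) * cexpI θ‖ = R := fun θ => by
    rw [norm_mul, norm_cexpI, norm_real, mul_one, Real.norm_of_nonneg hR.le]
  have hmem : ∀ θ, (R : ℂ) * cexpI θ ∈ closedBall (0 : ℂ) R := fun θ => by
    rw [mem_closedBall_zero_iff, hnz]
  have hK : 0 ≤ K := (abs_nonneg _).trans (h.bound _ (hmem 0))
  have hRα : 0 < R ^ α := Real.rpow_pos_of_pos hR α
  have k1 : 0 ≤ K * R := by positivity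
  have k2 : 0 ≤ K * R ^ 2 := by positivity
  have k3 : 0 ≤ K * R ^ 2 * R ^ α := by positivity
  have hconst : K * bdConst α R = K + K * R + 6 * (K * R ^ 2) + 2 * (K * R ^ 2 * R ^ α) := by
    rw [bdConst]; ring
  have hcurve : ∀ θ, HasDerivWithinAt (fun θ => (R : ℂ) * cexpI θ) (R * (cexpI θ * I)) univ θ :=
    fun θ => ((hasDerivAt_cexpI θ).const_mul (R : ℂ)).hasDerivWithinAt
  have hmaps : MapsTo (fun θ => (R : ℂ) * cexpI θ) univ (closedBall 0 R) := fun θ _ => hmem θ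
  have hce : ∀ θ, conj (cexpI θ) * cexpI θ = 1 := fun θ => by
    rw [mul_comm, mul_conj, normSq_eq_norm_sq, norm_cexpI]; norm_num
  have h2 : ∀ θ, cexpI (2 * θ) = cexpI θ * cexpI θ := fun θ => by rw [two_mul, cexpI_add]
  refine ⟨fun θ => ?_, fun θ => ?_, fun θ => ?_, fun θ => ?_, fun s t => ?_⟩
  · have d1 := ((hf.differentiable one_ne_zero θ).hasDerivAt).const_mul R
    have d2 := hasDerivWithinAt_univ.1
      ((h.hasDeriv _ (hmem θ)).comp_hasDerivWithinAt θ (hcurve θ) hmaps)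
    have d3 := hasDerivWithinAt_univ.1
      ((h.hasDeriv₂ _ (hmem θ)).comp_hasDerivWithinAt θ (hcurve θ) hmaps)
    have d4 := reCLM.hasFDerivAt.comp_hasDerivAt θ (d3.mul (hasDerivAt_cexpI θ))
    refine ((d1.sub (d4.const_mul R)).add d2).congr_deriv ?_
    simp only [Function.comp_apply, reCLM_apply, wirtCLM_apply, reMulCLM_apply, map_mul, conj_I,
      conj_ofReal, bdDeriv, h2]
    have e : (a (R * cexpI θ) * (R * (cexpI θ * I)) + b (R * cexpI θ) *
        (R * (conj (cexpI θ) * -I))) * cexpI θ + p (R * cexpI θ) * (cexpI θ * I) =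
        (R : ℝ) * (I * (a (R * cexpI θ) * (cexpI θ * cexpI θ) - b (R * cexpI θ))) +
          p (R * cexpI θ) * (cexpI θ * I) := by
      linear_combination (-(b (R * cexpI θ)) * R * I) * hce θ
    rw [e, add_re, re_ofReal_mul,
      show p (R * cexpI θ) * (R * (cexpI θ * I)) = (R : ℝ) * (p (R * cexpI θ) * (cexpI θ * I)) by
        ring, re_ofReal_mul]
    ring
  · simp only [bdData, hper θ, cexpI_periodic θ]
  · have b1 : |R * f θ| ≤ M * R := by
      rw [abs_mul, abs_of_pos hR, mul_comm]; exact mul_le_mul_of_nonneg_right (hb θ) hR.le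
    have b2 : |R * (p (R * cexpI θ) * cexpI θ).re| ≤ K * R := by
      rw [abs_mul, abs_of_pos hR, mul_comm]
      refine mul_le_mul_of_nonneg_right ((abs_re_le_norm _).trans ?_) hR.le
      rw [norm_mul, norm_cexpI, mul_one]; exact h.bound_p _ (hmem θ)
    have b3 := h.bound _ (hmem θ)
    have b4 := abs_add_le (R * f θ - R * (p (R * cexpI θ) * cexpI θ).re) (φ (R * cexpI θ))
    have b5 := abs_sub (R * f θ) (R * (p (R * cexpI θ) * cexpI θ).re)
    rw [bdData]
    linarith
  · have b1 : |R * deriv f θ| ≤ M * R := by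
      rw [abs_mul, abs_of_pos hR, mul_comm]; exact mul_le_mul_of_nonneg_right (hb' θ) hR.le
    have b2 : |R ^ 2 * (I * (a (R * cexpI θ) * cexpI (2 * θ) - b (R * cexpI θ))).re| ≤
        2 * K * R ^ 2 := by
      rw [abs_mul, abs_of_pos (by positivity), mul_comm]
      refine mul_le_mul_of_nonneg_right ((abs_re_le_norm _).trans ?_) (by positivity)
      rw [norm_mul, norm_I, one_mul]
      refine (norm_sub_le _ _).trans ?_
      rw [norm_mul, norm_cexpI, mul_one]
      linarith [h.bound_a _ (hmem θ), h.bound_b _ (hmem θ)]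
    have b5 := abs_sub (R * deriv f θ)
      (R ^ 2 * (I * (a (R * cexpI θ) * cexpI (2 * θ) - b (R * cexpI θ))).re)
    rw [bdDeriv]
    linarith
  · have hx : 0 ≤ |s - t| ^ α := by positivity
    have b1 : |R * deriv f s - R * deriv f t| ≤ M * R * |s - t| ^ α := by
      rw [← mul_sub, abs_mul, abs_of_pos hR]
      calc _ ≤ R * (M * |s - t| ^ α) := mul_le_mul_of_nonneg_left (hh s t) hR.le
        _ = _ := by ring
    have hz : ‖(R : ℂ) * cexpI s - R * cexpI t‖ ^ α ≤ R ^ α * |s - t| ^ α := by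
      rw [← mul_sub, norm_mul, norm_real, Real.norm_of_nonneg hR.le,
        Real.mul_rpow hR.le (norm_nonneg _)]
      gcongr
      exact norm_cexpI_sub_le s t
    have hKz : K * ‖(R : ℂ) * cexpI s - R * cexpI t‖ ^ α ≤ K * R ^ α * |s - t| ^ α := by
      rw [mul_assoc]; exact mul_le_mul_of_nonneg_left hz hK
    have b2 := (h.holder_a _ (hmem s) _ (hmem t)).trans hKz
    have b3 := (h.holder_b _ (hmem s) _ (hmem t)).trans hKz
    have b4 : ‖cexpI (2 * s) - cexpI (2 * t)‖ ≤ 4 * |s - t| ^ α := by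
      have h3 := norm_cexpI_sub_le_rpow h0 h1 (2 * s) (2 * t)
      have h4 : |2 * s - 2 * t| ^ α ≤ 2 * |s - t| ^ α := by
        rw [← mul_sub, abs_mul, abs_two, Real.mul_rpow zero_le_two (abs_nonneg _)]
        gcongr
        calc (2 : ℝ) ^ α ≤ 2 ^ (1 : ℝ) := Real.rpow_le_rpow_of_exponent_le (by norm_num) h1.le
          _ = 2 := by norm_num
      linarith
    have b5 : ‖a (R * cexpI t) * (cexpI (2 * s) - cexpI (2 * t))‖ ≤ K * (4 * |s - t| ^ α) := by
      rw [norm_mul]; exact mul_le_mul (h.bound_a _ (hmem t)) b4 (norm_nonneg _) hK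
    set aₛ := a (R * cexpI s)
    set aₜ := a (R * cexpI t)
    set bₛ := b (R * cexpI s)
    set bₜ := b (R * cexpI t)
    have e : bdDeriv R (deriv f) a b s - bdDeriv R (deriv f) a b t =
        (R * deriv f s - R * deriv f t) - R ^ 2 * (I * ((aₛ - aₜ) * cexpI (2 * s) +
          aₜ * (cexpI (2 * s) - cexpI (2 * t)) - (bₛ - bₜ))).re := by
      have : I * ((aₛ - aₜ) * cexpI (2 * s) + aₜ * (cexpI (2 * s) - cexpI (2 * t)) - (bₛ - bₜ)) =
        I * (aₛ * cexpI (2 * s) - bₛ) - I * (aₜ * cexpI (2 * t) - bₜ) := by ring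
      rw [this, sub_re, bdDeriv, bdDeriv]
      ring
    have b6 : |R ^ 2 * (I * ((aₛ - aₜ) * cexpI (2 * s) +
          aₜ * (cexpI (2 * s) - cexpI (2 * t)) - (bₛ - bₜ))).re| ≤
        R ^ 2 * (K * R ^ α * |s - t| ^ α + K * (4 * |s - t| ^ α) + K * R ^ α * |s - t| ^ α) := by
      rw [abs_mul, abs_of_pos (by positivity)]
      refine mul_le_mul_of_nonneg_left ((abs_re_le_norm _).trans ?_) (by positivity)
      rw [norm_mul, norm_I, one_mul]
      refine (norm_sub_le _ _).trans (add_le_add ((norm_add_le _ _).trans (add_le_add ?_ b5)) b3)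
      rw [norm_mul, norm_cexpI, mul_one]; exact b2
    rw [e, hconst]
    refine (abs_sub _ _).trans ((add_le_add b1 b6).trans ?_)
    have y1 : 0 ≤ (K + K * R + 2 * (K * R ^ 2)) * |s - t| ^ α := by positivity
    linarith

end BoundaryData

section Solution

open Filter Topology

/-- Admissible data for the projected Robin problem. -/
structure IsRobinData (R α M₁ M₂ : ℝ) (f₁ : ℂ → ℝ) (f₂ : ℝ → ℝ) : Prop where
  even : ∀ z : ℂ, f₁ (-conj z) = f₁ z
  bound : ∀ z ∈ closedBall (0 : ℂ) R, |f₁ z| ≤ M₁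
  holder : ∀ z ∈ closedBall (0 : ℂ) R, ∀ w ∈ closedBall (0 : ℂ) R,
    |f₁ z - f₁ w| ≤ M₁ * ‖z - w‖ ^ α
  contDiff : ContDiff ℝ 1 f₂
  periodic : ∀ θ : ℝ, f₂ (θ + 2 * Real.pi) = f₂ θ
  even_bd : ∀ θ : ℝ, f₂ (Real.pi - θ) = f₂ θ
  bound_bd : ∀ θ : ℝ, |f₂ θ| ≤ M₂
  bound_deriv : ∀ θ : ℝ, |deriv f₂ θ| ≤ M₂
  holder_deriv : ∀ s t : ℝ, |deriv f₂ s - deriv f₂ t| ≤ M₂ * |s - t| ^ α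

/-- Newtonian potential of `f`. -/
noncomputable def newtU (R : ℝ) (f : ℂ → ℝ) : ℂ → ℝ := potL R 0 (cutExt R f)

/-- Gradient of `newtU`. -/
noncomputable def newtP (R : ℝ) (f : ℂ → ℝ) : ℂ → ℂ := potP R 0 (cutExt R f)

/-- The `∂_z`-derivative of `newtP`. -/
noncomputable def newtA (R : ℝ) (f : ℂ → ℝ) : ℂ → ℂ := potA R 0 (cutExt R f)

/-- The `∂_{z̄}`-derivative of `newtP`. -/
noncomputable def newtB (R : ℝ) (f : ℂ → ℝ) (z : ℂ) : ℂ := (Real.pi * cutExt R f z : ℝ)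

/-- Boundary datum of the harmonic part. -/
noncomputable def robinData (R : ℝ) (f₁ : ℂ → ℝ) (f₂ : ℝ → ℝ) : ℝ → ℝ :=
  bdData R f₂ (newtU R f₁) (newtP R f₁)

/-- Derivative of `robinData`. -/
noncomputable def robinDeriv (R : ℝ) (f₁ : ℂ → ℝ) (f₂ : ℝ → ℝ) : ℝ → ℝ :=
  bdDeriv R (deriv f₂) (newtA R f₁) (newtB R f₁)

/-- Solution in the open disc, before symmetrisation. -/
noncomputable def innerSol (R : ℝ) (f₁ : ℂ → ℝ) (f₂ : ℝ → ℝ) (z : ℂ) : ℝ :=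
  newtU R f₁ z + (discG (robinData R f₁ f₂) (robinDeriv R f₁ f₂) ((R⁻¹ : ℝ) * z)).re -
    (discC (robinData R f₁ f₂)).im

/-- Gradient of `innerSol`. -/
noncomputable def innerP (R : ℝ) (f₁ : ℂ → ℝ) (f₂ : ℝ → ℝ) (z : ℂ) : ℂ :=
  newtP R f₁ z + (R⁻¹ : ℝ) * discP (robinDeriv R f₁ f₂) ((R⁻¹ : ℝ) * z)

/-- The `∂_z`-derivative of `innerP`. -/
noncomputable def innerA (R : ℝ) (f₁ : ℂ → ℝ) (f₂ : ℝ → ℝ) (z : ℂ) : ℂ :=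
  newtA R f₁ z + ((R⁻¹ : ℝ) : ℂ) ^ 2 * discK (robinDeriv R f₁ f₂) ((R⁻¹ : ℝ) * z)

/-- The projection coefficient. -/
noncomputable def robinG (R : ℝ) (f₁ : ℂ → ℝ) (f₂ : ℝ → ℝ) : ℝ :=
  (discC (robinData R f₁ f₂)).im / R ^ 2

/-- The solution on the closed disc, extended by zero. -/
noncomputable def robinSol (R : ℝ) (f₁ : ℂ → ℝ) (f₂ : ℝ → ℝ) : ℂ → ℝ :=
  (closedBall (0 : ℂ) R).indicator fun z =>
    2⁻¹ * extendFrom (ball 0 R) (innerSol R f₁ f₂) z +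
      2⁻¹ * extendFrom (ball 0 R) (innerSol R f₁ f₂) (-conj z)

/-- Coefficient of the circle data bound. -/
noncomputable def circleConst (α R : ℝ) : ℝ := R + newtonConst α R * bdConst α R

/-- The constant in the `C^{2,α}` estimate. -/
noncomputable def solConst (α R : ℝ) : ℝ :=
  newtonConst α R + circleConst α R * (discScale α R + 2)

theorem circleConst_nonneg {α R : ℝ} (hR : 0 < R) : 0 ≤ circleConst α R := by
  have := newtonConst_nonneg hR α
  have : 0 ≤ bdConst α R := by unfold bdConst; positivity
  unfold circleConst
  positivity

theorem solConst_nonneg {α R : ℝ} (h0 : 0 < α) (hR : 0 < R) : 0 ≤ solConst α R := by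
  have := newtonConst_nonneg hR α
  have := circleConst_nonneg (α := α) hR
  have := discScale_nonneg h0 hR
  unfold solConst
  positivity

namespace IsRobinData

variable {R α M₁ M₂ : ℝ} {f₁ : ℂ → ℝ} {f₂ : ℝ → ℝ}

theorem nonneg_left (h : IsRobinData R α M₁ M₂ f₁ f₂) (hR : 0 < R) : 0 ≤ M₁ :=
  (abs_nonneg _).trans (h.bound 0 (by simpa using hR.le))

theorem nonneg_right (h : IsRobinData R α M₁ M₂ f₁ f₂) : 0 ≤ M₂ :=
  (abs_nonneg _).trans (h.bound_bd 0)

theorem isC2Holder_newt (h : IsRobinData R α M₁ M₂ f₁ f₂) (h0 : 0 < α) (h1 : α < 1) (hR : 0 < R) :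
    IsC2Holder α (closedBall 0 R) (M₁ * newtonConst α R) (newtU R f₁) (newtP R f₁) (newtA R f₁)
      (newtB R f₁) := isC2Holder_potL hR h0 h1 h.bound h.holder

theorem isCircleData (h : IsRobinData R α M₁ M₂ f₁ f₂) (h0 : 0 < α) (h1 : α < 1) (hR : 0 < R) :
    IsCircleData α (circleConst α R * (M₁ + M₂)) (robinData R f₁ f₂) (robinDeriv R f₁ f₂) := by
  have h3 := (h.isC2Holder_newt h0 h1 hR).isCircleData h0 h1 hR h.contDiff h.periodic h.bound_bd
    h.bound_deriv h.holder_deriv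
  have hN := newtonConst_nonneg hR α
  have hb : 0 ≤ bdConst α R := by unfold bdConst; positivity
  have hM₁ := h.nonneg_left hR
  have hM₂ := h.nonneg_right
  have e : M₂ * R + M₁ * newtonConst α R * bdConst α R ≤ circleConst α R * (M₁ + M₂) := by
    have y1 : 0 ≤ R * M₁ := by positivity
    have y2 : 0 ≤ newtonConst α R * bdConst α R * M₂ := by positivity
    rw [circleConst]
    linarith
  exact ⟨h3.hasDeriv, h3.periodic, fun t => (h3.bound t).trans e,
    fun t => (h3.bound_deriv t).trans e, fun s t => (h3.holder_deriv s t).trans (by gcongr)⟩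

theorem isC2Holder_inner (h : IsRobinData R α M₁ M₂ f₁ f₂) (h0 : 0 < α) (h1 : α < 1) (hR : 0 < R) :
    IsC2Holder α (ball 0 R) (solConst α R * (M₁ + M₂)) (innerSol R f₁ f₂) (innerP R f₁ f₂)
      (innerA R f₁ f₂) (newtB R f₁) := by
  have hq := h.isCircleData h0 h1 hR
  have h3 := (((h.isC2Holder_newt h0 h1 hR).subset ball_subset_closedBall).add
    (hq.isC2Holder h0 h1 hR)).add (IsC2Holder.const (-(discC (robinData R f₁ f₂)).im))
  have hN := newtonConst_nonneg hR α
  have hM₂ := h.nonneg_right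
  have hc : |-(discC (robinData R f₁ f₂)).im| ≤ 2 * (circleConst α R * (M₁ + M₂)) := by
    rw [abs_neg]; exact (abs_im_le_norm _).trans hq.norm_discC_le
  have h4 := h3.mono (K' := solConst α R * (M₁ + M₂)) (by
    have y1 : 0 ≤ newtonConst α R * M₂ := by positivity
    rw [solConst]
    linarith)
  have e1 : innerSol R f₁ f₂ = (newtU R f₁ + fun z =>
      (discG (robinData R f₁ f₂) (robinDeriv R f₁ f₂) ((R⁻¹ : ℝ) * z)).re) +
        fun _ => -(discC (robinData R f₁ f₂)).im := by
    ext z; simp [innerSol, sub_eq_add_neg]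
  have e2 : innerP R f₁ f₂ = (newtP R f₁ + fun z =>
      (R⁻¹ : ℝ) * discP (robinDeriv R f₁ f₂) ((R⁻¹ : ℝ) * z)) + 0 := by
    rw [add_zero]; rfl
  have e3 : innerA R f₁ f₂ = (newtA R f₁ + fun z =>
      ((R⁻¹ : ℝ) : ℂ) ^ 2 * discK (robinDeriv R f₁ f₂) ((R⁻¹ : ℝ) * z)) + 0 := by
    rw [add_zero]; rfl
  have e4 : newtB R f₁ = (newtB R f₁ + fun _ => 0) + 0 := by
    ext z; simp
  rw [e1, e2, e3, e4]
  exact h4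

theorem robin_extend (h : IsRobinData R α M₁ M₂ f₁ f₂) (h0 : 0 < α) (h1 : α < 1) (hR : 0 < R)
    (θ : ℝ) :
    R * (extendFrom (ball 0 R) (innerP R f₁ f₂) (R * cexpI θ) * cexpI θ).re -
      extendFrom (ball 0 R) (innerSol R f₁ f₂) (R * cexpI θ) =
      R * f₂ θ - (discC (robinData R f₁ f₂) * cexpI θ).re + (discC (robinData R f₁ f₂)).im := by
  have hq := h.isCircleData h0 h1 hR
  have hi := h.isC2Holder_inner h0 h1 hR
  have hn := h.isC2Holder_newt h0 h1 hR
  set q := robinData R f₁ f₂ with hqdef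
  set Q := robinDeriv R f₁ f₂
  set x : ℂ := R * cexpI θ with hx
  have hnx : ‖x‖ = R := by
    rw [hx, norm_mul, norm_cexpI, norm_real, mul_one, Real.norm_of_nonneg hR.le]
  have hxc : x ∈ closedBall (0 : ℂ) R := by rw [mem_closedBall_zero_iff, hnx]
  have hxcl : x ∈ closure (ball (0 : ℂ) R) := by rwa [closure_ball _ hR.ne']
  have hr : ∀ᶠ r : ℝ in 𝓝[<] 1, r ∈ Ico (0 : ℝ) 1 :=
    Ico_mem_nhdsLT zero_lt_one
  have hzt : Tendsto (fun r : ℝ => (r : ℂ) * x) (𝓝[<] 1) (𝓝[ball 0 R] x) := by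
    refine tendsto_nhdsWithin_iff.2 ⟨?_, ?_⟩
    · have : Continuous fun r : ℝ => (r : ℂ) * x := by fun_prop
      simpa using (this.tendsto 1).mono_left nhdsWithin_le_nhds
    · filter_upwards [hr] with r hr
      rw [mem_ball_zero_iff, norm_mul, hnx, norm_real, Real.norm_of_nonneg hr.1]
      exact mul_lt_of_lt_one_left hR hr.2
  have hzt' := hzt.mono_right (nhdsWithin_mono x (ball_subset_closedBall (x := (0 : ℂ)) (ε := R)))
  have hrt : Tendsto (fun r : ℝ => (r : ℂ) * cexpI θ) (𝓝[<] 1) (𝓝 (cexpI θ)) := by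
    have : Continuous fun r : ℝ => (r : ℂ) * cexpI θ := by fun_prop
    simpa using (this.tendsto 1).mono_left nhdsWithin_le_nhds
  have hre : ∀ {l : Filter ℝ} {f : ℝ → ℂ} {w : ℂ}, Tendsto f l (𝓝 w) →
      Tendsto (fun r => (f r).re) l (𝓝 w.re) := fun h => (continuous_re.tendsto _).comp h
  have t1 : Tendsto (fun r : ℝ => R * (innerP R f₁ f₂ (r * x) * (r * cexpI θ)).re -
      innerSol R f₁ f₂ (r * x)) (𝓝[<] 1)
      (𝓝 (R * (extendFrom (ball 0 R) (innerP R f₁ f₂) x * cexpI θ).re -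
        extendFrom (ball 0 R) (innerSol R f₁ f₂) x)) := by
    have hc := convex_ball (0 : ℂ) R
    have l1 := ((hi.uniformContinuousOn_p hc).tendsto_extendFrom hxcl).comp hzt
    have l2 := ((hi.uniformContinuousOn hc).tendsto_extendFrom hxcl).comp hzt
    exact ((hre (l1.mul hrt)).const_mul R).sub l2
  have t2 : Tendsto (fun r : ℝ => R * (newtP R f₁ (r * x) * (r * cexpI θ)).re -
      newtU R f₁ (r * x)) (𝓝[<] 1)
      (𝓝 (R * (newtP R f₁ x * cexpI θ).re - newtU R f₁ x)) := by
    have l1 := ((hn.hasDeriv₂ x hxc).continuousWithinAt).tendsto.comp hzt'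
    have l2 := ((hn.hasDeriv x hxc).continuousWithinAt).tendsto.comp hzt'
    exact ((hre (l1.mul hrt)).const_mul R).sub l2
  have t3 : Tendsto (fun r : ℝ => (discH q (r * cexpI θ)).re) (𝓝[<] 1) (𝓝 (q θ)) := by
    rw [tendsto_iff_norm_sub_tendsto_zero]
    have hd : Tendsto (fun r : ℝ => 4 * Real.pi * (circleConst α R * (M₁ + M₂)) * lineMass α *
        (1 - r) ^ α) (𝓝[<] 1) (𝓝 0) := by
      have : Continuous fun r : ℝ => 4 * Real.pi * (circleConst α R * (M₁ + M₂)) * lineMass α *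
        (1 - r) ^ α := continuous_const.mul ((continuous_const.sub continuous_id).rpow_const
          fun _ => Or.inr h0.le)
      simpa [Real.zero_rpow h0.ne'] using (this.tendsto 1).mono_left nhdsWithin_le_nhds
    refine squeeze_zero' (Eventually.of_forall fun _ => norm_nonneg _) ?_ hd
    filter_upwards [hr] with r hr using hq.abs_re_discH_sub_le h0 h1 hr.1 hr.2 θ
  have t4 : Tendsto (fun r : ℝ => (discC q * (r * cexpI θ)).re) (𝓝[<] 1)
      (𝓝 (discC q * cexpI θ).re) := hre (hrt.const_mul _)
  have t5 := ((t2.add t3).sub t4).add_const (discC q).im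
  refine tendsto_nhds_unique (t1.congr' ?_) (t5.trans_eq ?_)
  · filter_upwards [hr] with r hr
    have e1 : ((R⁻¹ : ℝ) : ℂ) * (r * x) = r * cexpI θ := by
      have : (R : ℂ) ≠ 0 := by exact_mod_cast hR.ne'
      rw [hx]; push_cast; field_simp
    have e2 : R * (((R⁻¹ : ℝ) : ℂ) * discP Q (r * cexpI θ) * (r * cexpI θ)).re =
        (r * cexpI θ * discP Q (r * cexpI θ)).re := by
      rw [mul_assoc, re_ofReal_mul, ← mul_assoc, mul_inv_cancel₀ hR.ne', one_mul,
        mul_comm (discP Q _)]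
    simp only [innerP, innerSol]
    rw [e1, ← hqdef, add_mul, add_re, mul_add, e2, discG, add_re, sub_re]
    ring
  · congr 1
    rw [hqdef, robinData, bdData]
    ring

end IsRobinData

end Solution

section Regularity

theorem uniqueDiffOn_closedBall {R : ℝ} (hR : 0 < R) : UniqueDiffOn ℝ (closedBall (0 : ℂ) R) :=
  uniqueDiffOn_convex (convex_closedBall _ _)
    ⟨0, ball_subset_interior_closedBall (mem_ball_self hR)⟩

namespace IsC2Holder

theorem congr {α K : ℝ} {s : Set ℂ} {φ ψ : ℂ → ℝ} {p a b : ℂ → ℂ}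
    (h : IsC2Holder α s K φ p a b) (e : ∀ z ∈ s, ψ z = φ z) : IsC2Holder α s K ψ p a b where
  hasDeriv z hz := (h.hasDeriv z hz).congr e (e z hz)
  hasDeriv₂ := h.hasDeriv₂
  bound z hz := by rw [e z hz]; exact h.bound z hz
  bound_p := h.bound_p
  bound_a := h.bound_a
  bound_b := h.bound_b
  holder_a := h.holder_a
  holder_b := h.holder_b

variable {α K : ℝ} {s : Set ℂ} {φ : ℂ → ℝ} {p a b : ℂ → ℂ}

theorem fderivWithin_eq (h : IsC2Holder α s K φ p a b) (hs : UniqueDiffOn ℝ s) {z : ℂ}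
    (hz : z ∈ s) : fderivWithin ℝ φ s z = reMulCLM (p z) :=
  (h.hasDeriv z hz).fderivWithin (hs z hz)

theorem fderivWithin_fderivWithin_apply (h : IsC2Holder α s K φ p a b) (hs : UniqueDiffOn ℝ s)
    {z : ℂ} (hz : z ∈ s) (v w : ℂ) :
    fderivWithin ℝ (fderivWithin ℝ φ s) s z v w = ((a z * v + b z * conj v) * w).re := by
  let L : ℂ →L[ℝ] ℂ →L[ℝ] ℝ := (ContinuousLinearMap.compL ℝ ℂ ℂ ℝ reCLM).comp
    (ContinuousLinearMap.mul ℝ ℂ)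
  have hL : ∀ x y, L x y = (x * y).re := fun x y => rfl
  have h1 : HasFDerivWithinAt (fun x => L (p x)) (L.comp (wirtCLM (a z) (b z))) s z :=
    L.hasFDerivAt.comp_hasFDerivWithinAt z (h.hasDeriv₂ z hz)
  have h2 : HasFDerivWithinAt (fderivWithin ℝ φ s) (L.comp (wirtCLM (a z) (b z))) s z :=
    have e : ∀ x ∈ s, fderivWithin ℝ φ s x = L (p x) := fun x hx => by
      rw [h.fderivWithin_eq hs hx]; ext v; simp [hL]
    h1.congr e (e z hz)
  rw [h2.fderivWithin (hs z hz)]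
  simp [hL]
  ring

theorem contDiffOn (h : IsC2Holder α s K φ p a b) (hs : UniqueDiffOn ℝ s) (h0 : 0 < α) :
    ContDiffOn ℝ 2 φ s := by
  have hp : ContDiffOn ℝ 1 p s := by
    rw [show (1 : WithTop ℕ∞) = 0 + 1 by norm_num, contDiffOn_succ_iff_fderivWithin hs,
      contDiffOn_zero]
    refine ⟨fun z hz => (h.hasDeriv₂ z hz).differentiableWithinAt, by simp, ?_⟩
    refine (continuous_wirtCLM.comp_continuousOn ((h.uniformContinuousOn_a h0).continuousOn.prodMk
      (h.uniformContinuousOn_b h0).continuousOn)).congr fun z hz => ?_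
    exact (h.hasDeriv₂ z hz).fderivWithin (hs z hz)
  have hd : ContDiffOn ℝ 1 (fderivWithin ℝ φ s) s := by
    let L : ℂ →L[ℝ] ℂ →L[ℝ] ℝ := (ContinuousLinearMap.compL ℝ ℂ ℂ ℝ reCLM).comp
      (ContinuousLinearMap.mul ℝ ℂ)
    have hL : ∀ x y, L x y = (x * y).re := fun x y => rfl
    refine (L.contDiff.comp_contDiffOn hp).congr fun z hz => ?_
    rw [h.fderivWithin_eq hs hz]; ext v; simp [hL]
  rw [show (2 : WithTop ℕ∞) = 1 + 1 by norm_num, contDiffOn_succ_iff_fderivWithin hs]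
  exact ⟨fun z hz => (h.hasDeriv z hz).differentiableWithinAt, by simp, hd⟩

theorem iteratedFDerivWithin_two_apply_eq (h : IsC2Holder α s K φ p a b) (hs : UniqueDiffOn ℝ s)
    {z : ℂ} (hz : z ∈ s) (m : Fin 2 → ℂ) :
    iteratedFDerivWithin ℝ 2 φ s z m = ((a z * m 0 + b z * conj (m 0)) * m 1).re := by
  rw [iteratedFDerivWithin_two_apply φ hs hz, h.fderivWithin_fderivWithin_apply hs hz]

theorem abs_re_wirt_mul_le {a b : ℂ} {A : ℝ} (ha : ‖a‖ ≤ A) (hb : ‖b‖ ≤ A) (m : Fin 2 → ℂ) :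
    |((a * m 0 + b * conj (m 0)) * m 1).re| ≤ 2 * A * ∏ i, ‖m i‖ := by
  refine (abs_re_le_norm _).trans ?_
  rw [norm_mul, Fin.prod_univ_two, ← mul_assoc]
  refine mul_le_mul_of_nonneg_right ((norm_add_le _ _).trans ?_) (norm_nonneg _)
  rw [norm_mul, norm_mul, RCLike.norm_conj]
  nlinarith [norm_nonneg (m 0)]

theorem norm_iteratedFDerivWithin_two_le (h : IsC2Holder α s K φ p a b) (hs : UniqueDiffOn ℝ s)
    {z : ℂ} (hz : z ∈ s) : ‖iteratedFDerivWithin ℝ 2 φ s z‖ ≤ 2 * K := by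
  have hK : 0 ≤ K := (abs_nonneg _).trans (h.bound z hz)
  refine ContinuousMultilinearMap.opNorm_le_bound (by positivity) fun m => ?_
  rw [h.iteratedFDerivWithin_two_apply_eq hs hz]
  exact abs_re_wirt_mul_le (h.bound_a z hz) (h.bound_b z hz) m

theorem norm_iteratedFDerivWithin_two_sub_le (h : IsC2Holder α s K φ p a b)
    (hs : UniqueDiffOn ℝ s) {z w : ℂ} (hz : z ∈ s) (hw : w ∈ s) :
    ‖iteratedFDerivWithin ℝ 2 φ s z - iteratedFDerivWithin ℝ 2 φ s w‖ ≤
      2 * K * ‖z - w‖ ^ α := by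
  have hK : 0 ≤ K := (abs_nonneg _).trans (h.bound z hz)
  refine ContinuousMultilinearMap.opNorm_le_bound (by positivity) fun m => ?_
  rw [sub_apply, h.iteratedFDerivWithin_two_apply_eq hs hz,
    h.iteratedFDerivWithin_two_apply_eq hs hw, ← sub_re, mul_assoc 2 K,
    show (a z * m 0 + b z * conj (m 0)) * m 1 - (a w * m 0 + b w * conj (m 0)) * m 1 =
      ((a z - a w) * m 0 + (b z - b w) * conj (m 0)) * m 1 by ring]
  exact abs_re_wirt_mul_le (h.holder_a z hz w hw) (h.holder_b z hz w hw) m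

theorem lap_eq (h : IsC2Holder α s K φ p a b) {z : ℂ} (hs : s ∈ nhds z) :
    lap φ z = 2 * (b z).re := by
  have h1 : ∀ᶠ w in nhds z, fderiv ℝ φ w = reMulCLM (p w) := by
    filter_upwards [eventually_mem_nhds_iff.2 hs] with w hw
    exact ((h.hasDeriv w (mem_of_mem_nhds hw)).hasFDerivAt hw).fderiv
  have hp := (h.hasDeriv₂ z (mem_of_mem_nhds hs)).hasFDerivAt hs
  have h2 : ∀ v : ℂ, fderiv ℝ (fun w => fderiv ℝ φ w v) z v =
      ((a z * v + b z * conj v) * v).re := fun v => by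
    have e : (fun w => fderiv ℝ φ w v) =ᶠ[nhds z] fun w => (p w * v).re := by
      filter_upwards [h1] with w hw
      rw [hw]; simp
    rw [e.fderiv_eq]
    have h3 : HasFDerivAt (fun w => (p w * v).re) _ z :=
      reCLM.hasFDerivAt.comp z (hp.mul_const v)
    rw [h3.fderiv]
    simp
    ring
  rw [lap, h2, h2]
  simp
  ring

end IsC2Holder

end Regularity

section Symmetrised

open Filter Topology

theorem robinSol_neg_conj (R : ℝ) (f₁ : ℂ → ℝ) (f₂ : ℝ → ℝ) (z : ℂ) :
    robinSol R f₁ f₂ (-conj z) = robinSol R f₁ f₂ z := by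
  have e : -conj z ∈ closedBall (0 : ℂ) R ↔ z ∈ closedBall (0 : ℂ) R := by simp
  by_cases hz : z ∈ closedBall (0 : ℂ) R
  · rw [robinSol, indicator_of_mem hz, indicator_of_mem (e.2 hz), neg_conj_neg_conj, add_comm]
  · rw [robinSol, indicator_of_notMem hz, indicator_of_notMem fun h => hz (e.1 h)]

theorem cexpI_pi_sub (θ : ℝ) : cexpI (Real.pi - θ) = -conj (cexpI θ) := by
  have e : conj (cexpI θ) = Complex.exp (-(θ * I)) := by
    rw [cexpI, ← Complex.exp_conj]; simp
  rw [e, cexpI, ofReal_sub, sub_mul, sub_eq_add_neg, Complex.exp_add, exp_pi_mul_I, neg_one_mul]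

theorem im_cexpI (θ : ℝ) : (cexpI θ).im = Real.sin θ := by
  rw [cexpI, exp_ofReal_mul_I_im]

namespace IsRobinData

variable {R α M₁ M₂ : ℝ} {f₁ : ℂ → ℝ} {f₂ : ℝ → ℝ}

theorem abs_robinG_le (h : IsRobinData R α M₁ M₂ f₁ f₂) (h0 : 0 < α) (h1 : α < 1) (hR : 0 < R) :
    |robinG R f₁ f₂| ≤ 2 * circleConst α R / R ^ 2 * (M₁ + M₂) := by
  have := (abs_im_le_norm _).trans (h.isCircleData h0 h1 hR).norm_discC_le
  rw [robinG, abs_div, abs_of_pos (pow_pos hR 2), div_mul_eq_mul_div, mul_assoc]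
  gcongr

theorem exists_isC2Holder (h : IsRobinData R α M₁ M₂ f₁ f₂) (h0 : 0 < α) (h1 : α < 1)
    (hR : 0 < R) : ∃ p a b, IsC2Holder α (closedBall 0 R) (solConst α R * (M₁ + M₂))
      (robinSol R f₁ f₂) p a b ∧ (∀ z ∈ ball (0 : ℂ) R, 2 * (b z).re = f₁ z) ∧
      ∀ θ, (p (R * cexpI θ) * cexpI θ).re - robinSol R f₁ f₂ (R * cexpI θ) / R =
        f₂ θ + robinG R f₁ f₂ * (R * Real.sin θ + R) := by
  have hi := h.isC2Holder_inner h0 h1 hR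
  have hE := hi.closure_extendFrom h0 isOpen_ball (convex_ball _ _)
  rw [closure_ball _ hR.ne'] at hE
  set E := extendFrom (ball 0 R) (innerSol R f₁ f₂) with hEdef
  set p := extendFrom (ball 0 R) (innerP R f₁ f₂)
  set a := extendFrom (ball 0 R) (innerA R f₁ f₂)
  set b := extendFrom (ball 0 R) (newtB R f₁)
  have hS := (((hE.const_mul 2⁻¹).add (hE.reflect.const_mul 2⁻¹)).mono
    (K' := solConst α R * (M₁ + M₂)) (by rw [abs_of_pos (by norm_num)]; linarith)).congr
    (ψ := robinSol R f₁ f₂) fun z hz => by rw [robinSol, indicator_of_mem hz]; rfl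
  refine ⟨_, _, _, hS, fun z hz => ?_, fun θ => ?_⟩
  · have hb : ∀ w ∈ ball (0 : ℂ) R, b w = ((f₁ w / 2 : ℝ) : ℂ) := fun w hw => by
      rw [show b w = newtB R f₁ w from
        extendFrom_eq_of_mem (hi.uniformContinuousOn_b h0).continuousOn hw, newtB,
        pi_mul_cutExt hR (ball_subset_closedBall hw)]
    have hz' : -conj z ∈ ball (0 : ℂ) R := by simpa using hz
    simp only [Pi.add_apply]
    rw [hb z hz, hb _ hz', h.even, conj_ofReal, ← ofReal_mul, ← ofReal_add, ofReal_re]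
    ring
  · have hmem : ∀ t : ℝ, (R : ℂ) * cexpI t ∈ closedBall (0 : ℂ) R := fun t => by
      rw [mem_closedBall_zero_iff, norm_mul, norm_cexpI, norm_real, mul_one,
        Real.norm_of_nonneg hR.le]
    have e1 : -conj ((R : ℂ) * cexpI θ) = R * cexpI (Real.pi - θ) := by
      rw [cexpI_pi_sub, map_mul, conj_ofReal, mul_neg]
    have e2 := h.robin_extend h0 h1 hR θ
    have e3 := h.robin_extend h0 h1 hR (Real.pi - θ)
    rw [h.even_bd] at e3
    have e4 : (-conj (p (R * cexpI (Real.pi - θ))) * cexpI θ).re =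
        (p (R * cexpI (Real.pi - θ)) * cexpI (Real.pi - θ)).re := by
      rw [cexpI_pi_sub θ]; simp
    have e5 : ∀ c : ℂ, (c * cexpI θ).re + (c * cexpI (Real.pi - θ)).re =
        -2 * c.im * Real.sin θ := fun c => by
      rw [cexpI_pi_sub, ← im_cexpI]; simp; ring
    have e6 := e5 (discC (robinData R f₁ f₂))
    simp only [Pi.add_apply]
    rw [robinSol, indicator_of_mem (hmem θ), e1, robinG, add_mul, add_re, mul_assoc, mul_assoc,
      re_ofReal_mul, re_ofReal_mul, e4]
    set c := discC (robinData R f₁ f₂)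
    change R * (p _ * _).re - E _ = _ at e2
    change R * (p _ * _).re - E _ = _ at e3
    simp only [← hEdef]
    generalize (p (R * cexpI θ) * cexpI θ).re = x₁ at e2 ⊢
    generalize (p (R * cexpI (Real.pi - θ)) * cexpI (Real.pi - θ)).re = x₂ at e3 ⊢
    field_simp
    linear_combination e2 + e3 - e6

end IsRobinData

end Symmetrised

section Linearity

open Filter Topology

theorem cutExt_combo (R c : ℝ) (f g : ℂ → ℝ) :
    cutExt R (c • f + g) = c • cutExt R f + cutExt R g := by
  ext z
  simp only [cutExt, Pi.add_apply, Pi.smul_apply, smul_eq_mul]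
  ring

section Potential

theorem setIntegral_combo {E : Type*} [NormedAddCommGroup E] [NormedSpace ℝ E] {s : Set ℂ}
    {u v w : ℂ → E} (hu : IntegrableOn u s) (hv : IntegrableOn v s) (c : ℝ)
    (e : ∀ z, w z = c • u z + v z) :
    ∫ z in s, w z = c • (∫ z in s, u z) + ∫ z in s, v z := by
  rw [← integral_smul]
  exact (integral_congr_ae (Eventually.of_forall e)).trans (integral_add (hu.smul c) hv)

variable {α R M N : ℝ} {F G : ℂ → ℝ}

theorem IsCutHolder.potL_combo (hF : IsCutHolder α R M F) (hG : IsCutHolder α R N G) (h0 : 0 < α)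
    (h1 : α < 1) (c : ℝ) : potL R 0 (c • F + G) = c • potL R 0 F + potL R 0 G :=
  funext fun x => setIntegral_combo (hF.integrableOn_potL h0 h1 x) (hG.integrableOn_potL h0 h1 x) c
    fun z => by simp only [Pi.add_apply, Pi.smul_apply, add_smul, smul_assoc]

theorem IsCutHolder.potP_combo (hF : IsCutHolder α R M F) (hG : IsCutHolder α R N G) (h0 : 0 < α)
    (h1 : α < 1) (c : ℝ) : potP R 0 (c • F + G) = c • potP R 0 F + potP R 0 G :=
  funext fun x => setIntegral_combo (hF.integrableOn_potP h0 h1 x) (hG.integrableOn_potP h0 h1 x) c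
    fun z => by simp only [Pi.add_apply, Pi.smul_apply, add_smul, smul_assoc]

theorem IsCutHolder.potA_combo (hF : IsCutHolder α R M F) (hG : IsCutHolder α R N G) (h0 : 0 < α)
    (h1 : α < 1) (c : ℝ) : potA R 0 (c • F + G) = c • potA R 0 F + potA R 0 G :=
  funext fun x => setIntegral_combo (hF.integrableOn_potA h0 h1 x) (hG.integrableOn_potA h0 h1 x) c
    fun z => by
      rw [← smul_assoc, ← add_smul, smul_sub, Pi.add_apply, Pi.add_apply, Pi.smul_apply,
        Pi.smul_apply, add_sub_add_comm]

end Potential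

section Disc

variable {g k : ℝ → ℂ} {z : ℂ}

theorem cauchyT_combo (hg : Continuous g) (hk : Continuous k) (hz : z ∈ ball (0 : ℂ) 1) (c : ℂ) :
    cauchyT (fun t => c * g t + k t) z = c * cauchyT g z + cauchyT k z := by
  rw [cauchyT, cauchyT, cauchyT, ← intervalIntegral.integral_const_mul,
    ← intervalIntegral.integral_add
      (((continuous_cauchyT_integrand hg hz).const_mul c).intervalIntegrable _ _)
      ((continuous_cauchyT_integrand hk hz).intervalIntegrable _ _)]
  simp only [add_mul, mul_assoc]

theorem cauchyT'_combo (hg : Continuous g) (hk : Continuous k) (hz : z ∈ ball (0 : ℂ) 1) (c : ℂ) :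
    cauchyT' (fun t => c * g t + k t) z = c * cauchyT' g z + cauchyT' k z := by
  rw [cauchyT', cauchyT', cauchyT', ← intervalIntegral.integral_const_mul,
    ← intervalIntegral.integral_add
      (((continuous_cauchyT'_integrand hg hz).const_mul c).intervalIntegrable _ _)
      ((continuous_cauchyT'_integrand hk hz).intervalIntegrable _ _)]
  simp only [add_mul, mul_assoc]

variable {q r Q S : ℝ → ℝ}

theorem discC_combo (hq : Continuous q) (hr : Continuous r) (c : ℝ) :
    discC (c • q + r) = c * discC q + discC r := by
  have := cauchyT'_combo (continuous_ofReal.comp hq) (continuous_ofReal.comp hr)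
    (mem_ball_self one_pos : (0 : ℂ) ∈ ball 0 1) c
  simp only [discC, Pi.add_apply, Pi.smul_apply, smul_eq_mul, ofReal_add, ofReal_mul]
  simp only [Function.comp_def] at this
  rw [this]
  ring

theorem discH_combo (hq : Continuous q) (hr : Continuous r) (hz : z ∈ ball (0 : ℂ) 1) (c : ℝ) :
    discH (c • q + r) z = c * discH q z + discH r z := by
  have := cauchyT_combo (continuous_ofReal.comp hq) (continuous_ofReal.comp hr) hz c
  simp only [Function.comp_def] at this
  have e : ∫ t in (0 : ℝ)..(2 * Real.pi), (c • q + r) t =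
      c * (∫ t in (0 : ℝ)..(2 * Real.pi), q t) + ∫ t in (0 : ℝ)..(2 * Real.pi), r t := by
    rw [← intervalIntegral.integral_const_mul, ← intervalIntegral.integral_add
      ((hq.const_mul c).intervalIntegrable _ _) (hr.intervalIntegrable _ _)]
    rfl
  rw [discH, discH, discH, e]
  simp only [Pi.add_apply, Pi.smul_apply, smul_eq_mul, ofReal_add, ofReal_mul]
  rw [this]
  ring

theorem discK_combo (hQ : Continuous Q) (hS : Continuous S) (hz : z ∈ ball (0 : ℂ) 1) (c : ℝ) :
    discK (c • Q + S) z = c * discK Q z + discK S z := by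
  have := cauchyT_combo (continuous_discDensity hQ) (continuous_discDensity hS) hz c
  have e : discDensity (c • Q + S) = fun t => c * discDensity Q t + discDensity S t := by
    ext t
    simp only [discDensity, Pi.add_apply, Pi.smul_apply, smul_eq_mul, ofReal_add, ofReal_mul]
    ring
  rw [discK, e, this, discK, discK]
  ring

theorem discP_combo (hQ : Continuous Q) (hS : Continuous S) (hz : z ∈ ball (0 : ℂ) 1) (c : ℝ) :
    discP (c • Q + S) z = c * discP Q z + discP S z := by
  have hd : ∀ w ∈ ball (0 : ℂ) 1, HasDerivAt (fun w => c * discP Q w + discP S w)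
      (discK (c • Q + S) w) w := fun w hw => by
    rw [discK_combo hQ hS hw]
    exact ((hasDerivAt_discP hQ hw).const_mul (c : ℂ)).add (hasDerivAt_discP hS hw)
  have hd' : ∀ w ∈ ball (0 : ℂ) 1, HasDerivAt (discP (c • Q + S)) (discK (c • Q + S) w) w :=
    fun w hw => hasDerivAt_discP ((hQ.const_smul c).add hS) hw
  exact isOpen_ball.eqOn_of_deriv_eq (convex_ball (0 : ℂ) 1).isPreconnected
    (fun w hw => (hd' w hw).differentiableAt.differentiableWithinAt)
    (fun w hw => (hd w hw).differentiableAt.differentiableWithinAt)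
    (fun w hw => by rw [(hd w hw).deriv, (hd' w hw).deriv]) (mem_ball_self one_pos)
    (by simp [discP_zero]) hz

theorem discG_combo (hq : Continuous q) (hr : Continuous r) (hQ : Continuous Q)
    (hS : Continuous S) (hz : z ∈ ball (0 : ℂ) 1) (c : ℝ) :
    discG (c • q + r) (c • Q + S) z = c * discG q Q z + discG r S z := by
  rw [discG, discP_combo hQ hS hz, discH_combo hq hr hz, discC_combo hq hr, discG, discG]
  ring

end Disc

namespace IsRobinData

variable {R α M₁ M₂ N₁ N₂ : ℝ} {f₁ k₁ : ℂ → ℝ} {f₂ k₂ : ℝ → ℝ}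

theorem combo (h : IsRobinData R α M₁ M₂ f₁ f₂) (k : IsRobinData R α N₁ N₂ k₁ k₂) (c : ℝ) :
    IsRobinData R α (|c| * M₁ + N₁) (|c| * M₂ + N₂) (c • f₁ + k₁) (c • f₂ + k₂) := by
  have hd : ∀ t, deriv (c • f₂ + k₂) t = c * deriv f₂ t + deriv k₂ t := fun t => by
    have h1 := (h.contDiff.differentiable one_ne_zero t).hasDerivAt
    have h2 := (k.contDiff.differentiable one_ne_zero t).hasDerivAt
    exact ((h1.const_smul c).add h2).deriv
  have key : ∀ x y A B : ℝ, |x| ≤ A → |y| ≤ B → |c * x + y| ≤ |c| * A + B := fun x y A B hx hy => by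
    refine (abs_add_le _ _).trans ?_
    rw [abs_mul]
    gcongr
  refine ⟨fun z => ?_, fun z hz => key _ _ _ _ (h.bound z hz) (k.bound z hz),
    fun z hz w hw => ?_, (h.contDiff.const_smul c).add k.contDiff, fun θ => ?_, fun θ => ?_,
    fun θ => key _ _ _ _ (h.bound_bd θ) (k.bound_bd θ), fun θ => ?_, fun s t => ?_⟩
  · simp only [Pi.add_apply, Pi.smul_apply, h.even, k.even]
  · have := key _ _ _ _ (h.holder z hz w hw) (k.holder z hz w hw)
    simp only [Pi.add_apply, Pi.smul_apply, smul_eq_mul]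
    convert this using 1
    · congr 1; ring
    · ring
  · simp only [Pi.add_apply, Pi.smul_apply, h.periodic, k.periodic]
  · simp only [Pi.add_apply, Pi.smul_apply, h.even_bd, k.even_bd]
  · rw [hd]; exact key _ _ _ _ (h.bound_deriv θ) (k.bound_deriv θ)
  · have := key _ _ _ _ (h.holder_deriv s t) (k.holder_deriv s t)
    rw [hd, hd]
    convert this using 1
    · congr 1; ring
    · ring

theorem isCutHolder (h : IsRobinData R α M₁ M₂ f₁ f₂) (h0 : 0 < α) (h1 : α < 1) (hR : 0 < R) :
    IsCutHolder α R (M₁ * (2 + R ^ (-α))) (cutExt R f₁) :=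
  isCutHolder_cutExt hR h0 h1 h.bound h.holder

theorem robinData_combo (h : IsRobinData R α M₁ M₂ f₁ f₂) (k : IsRobinData R α N₁ N₂ k₁ k₂)
    (h0 : 0 < α) (h1 : α < 1) (hR : 0 < R) (c : ℝ) :
    robinData R (c • f₁ + k₁) (c • f₂ + k₂) = c • robinData R f₁ f₂ + robinData R k₁ k₂ := by
  have hF := h.isCutHolder h0 h1 hR
  have hG := k.isCutHolder h0 h1 hR
  ext θ
  simp only [robinData, bdData, newtU, newtP, cutExt_combo, hF.potL_combo hG h0 h1,
    hF.potP_combo hG h0 h1, Pi.add_apply, Pi.smul_apply, smul_eq_mul, real_smul, add_mul, add_re,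
    mul_assoc, re_ofReal_mul]
  ring

theorem robinDeriv_combo (h : IsRobinData R α M₁ M₂ f₁ f₂) (k : IsRobinData R α N₁ N₂ k₁ k₂)
    (h0 : 0 < α) (h1 : α < 1) (hR : 0 < R) (c : ℝ) :
    robinDeriv R (c • f₁ + k₁) (c • f₂ + k₂) = c • robinDeriv R f₁ f₂ + robinDeriv R k₁ k₂ := by
  have hF := h.isCutHolder h0 h1 hR
  have hG := k.isCutHolder h0 h1 hR
  ext θ
  have hd : deriv (c • f₂ + k₂) θ = c * deriv f₂ θ + deriv k₂ θ := by
    have h1 := (h.contDiff.differentiable one_ne_zero θ).hasDerivAt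
    have h2 := (k.contDiff.differentiable one_ne_zero θ).hasDerivAt
    exact ((h1.const_smul c).add h2).deriv
  have e : ∀ A B x X Y : ℂ, (I * ((c * A + B) * x - (c * X + Y))).re =
      c * (I * (A * x - X)).re + (I * (B * x - Y)).re := fun A B x X Y => by
    rw [← re_ofReal_mul, ← add_re]
    congr 1
    ring
  have e' : ∀ X Y : ℝ, ((Real.pi * (c * X + Y) : ℝ) : ℂ) =
      c * ((Real.pi * X : ℝ) : ℂ) + ((Real.pi * Y : ℝ) : ℂ) := fun X Y => by
    push_cast
    ring
  simp only [robinDeriv, bdDeriv, newtA, newtB, cutExt_combo, hF.potA_combo hG h0 h1, hd,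
    Pi.add_apply, Pi.smul_apply, smul_eq_mul, real_smul, e', e]
  ring

theorem innerSol_combo (h : IsRobinData R α M₁ M₂ f₁ f₂) (k : IsRobinData R α N₁ N₂ k₁ k₂)
    (h0 : 0 < α) (h1 : α < 1) (hR : 0 < R) (c : ℝ) {z : ℂ} (hz : z ∈ ball (0 : ℂ) R) :
    innerSol R (c • f₁ + k₁) (c • f₂ + k₂) z = c * innerSol R f₁ f₂ z + innerSol R k₁ k₂ z := by
  have hq := h.isCircleData h0 h1 hR
  have hr := k.isCircleData h0 h1 hR
  have hz' : ((R⁻¹ : ℝ) : ℂ) * z ∈ ball (0 : ℂ) 1 := by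
    rw [mem_ball_zero_iff] at hz ⊢
    rwa [norm_mul, norm_real, Real.norm_of_nonneg (inv_nonneg.2 hR.le), inv_mul_lt_one₀ hR]
  rw [innerSol, h.robinData_combo k h0 h1 hR, h.robinDeriv_combo k h0 h1 hR,
    discG_combo hq.continuous hr.continuous (hq.continuous_deriv h0) (hr.continuous_deriv h0) hz',
    discC_combo hq.continuous hr.continuous, newtU, cutExt_combo,
    (h.isCutHolder h0 h1 hR).potL_combo (k.isCutHolder h0 h1 hR) h0 h1]
  simp only [innerSol, newtU, Pi.add_apply, Pi.smul_apply, smul_eq_mul, add_re, add_im,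
    re_ofReal_mul, im_ofReal_mul]
  ring

theorem robinG_combo (h : IsRobinData R α M₁ M₂ f₁ f₂) (k : IsRobinData R α N₁ N₂ k₁ k₂)
    (h0 : 0 < α) (h1 : α < 1) (hR : 0 < R) (c : ℝ) :
    robinG R (c • f₁ + k₁) (c • f₂ + k₂) = c * robinG R f₁ f₂ + robinG R k₁ k₂ := by
  rw [robinG, h.robinData_combo k h0 h1 hR, discC_combo (h.isCircleData h0 h1 hR).continuous
    (k.isCircleData h0 h1 hR).continuous, add_im, im_ofReal_mul, robinG, robinG]
  ring

theorem robinSol_combo (h : IsRobinData R α M₁ M₂ f₁ f₂) (k : IsRobinData R α N₁ N₂ k₁ k₂)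
    (h0 : 0 < α) (h1 : α < 1) (hR : 0 < R) (c : ℝ) :
    robinSol R (c • f₁ + k₁) (c • f₂ + k₂) = c • robinSol R f₁ f₂ + robinSol R k₁ k₂ := by
  have hc := convex_ball (0 : ℂ) R
  have key : ∀ z ∈ closedBall (0 : ℂ) R,
      extendFrom (ball 0 R) (innerSol R (c • f₁ + k₁) (c • f₂ + k₂)) z =
        c * extendFrom (ball 0 R) (innerSol R f₁ f₂) z +
          extendFrom (ball 0 R) (innerSol R k₁ k₂) z := fun z hz => by
    rw [← closure_ball _ hR.ne'] at hz
    refine extendFrom_eq hz ((((((h.isC2Holder_inner h0 h1 hR).uniformContinuousOn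
      hc).tendsto_extendFrom hz).const_mul c).add (((k.isC2Holder_inner h0 h1
      hR).uniformContinuousOn hc).tendsto_extendFrom hz)).congr' ?_)
    filter_upwards [self_mem_nhdsWithin] with w hw
    rw [h.innerSol_combo k h0 h1 hR c hw]
  ext z
  by_cases hz : z ∈ closedBall (0 : ℂ) R
  · simp only [Pi.add_apply, Pi.smul_apply, smul_eq_mul, robinSol, indicator_of_mem hz, key z hz,
      key _ (neg_conj_mem_closedBall hz)]
    ring
  · simp only [Pi.add_apply, Pi.smul_apply, smul_eq_mul, robinSol, indicator_of_notMem hz]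
    ring

end IsRobinData

end Linearity

section Operator

/-- The space of admissible data. -/
noncomputable def robinSpace (R α : ℝ) : Submodule ℝ ((ℂ → ℝ) × (ℝ → ℝ)) where
  carrier := {x | ∃ M₁ M₂, IsRobinData R α M₁ M₂ x.1 x.2}
  zero_mem' := ⟨0, 0, by
    refine ⟨fun z => rfl, fun z _ => by simp, fun z _ w _ => by simp, contDiff_const,
      fun θ => rfl, fun θ => rfl, fun θ => by simp, fun θ => ?_, fun s t => ?_⟩ <;>
    simp⟩
  add_mem' := by
    rintro x y ⟨_, _, h⟩ ⟨_, _, k⟩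
    have := h.combo k 1
    rw [one_smul, one_smul] at this
    exact ⟨_, _, this⟩
  smul_mem' := by
    rintro c x ⟨_, _, h⟩
    have := h.combo h (c - 1)
    rw [sub_smul, sub_smul, one_smul, one_smul, sub_add_cancel, sub_add_cancel] at this
    exact ⟨_, _, this⟩

theorem exists_robin_linearMap {R α : ℝ} (h0 : 0 < α) (h1 : α < 1) (hR : 0 < R) :
    ∃ T : ((ℂ → ℝ) × (ℝ → ℝ)) →ₗ[ℝ] ((ℂ → ℝ) × ℝ), ∀ (f₁ : ℂ → ℝ) (f₂ : ℝ → ℝ) (M₁ M₂ : ℝ),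
      IsRobinData R α M₁ M₂ f₁ f₂ → T (f₁, f₂) = (robinSol R f₁ f₂, robinG R f₁ f₂) := by
  let F : (ℂ → ℝ) × (ℝ → ℝ) → (ℂ → ℝ) × ℝ := fun x => (robinSol R x.1 x.2, robinG R x.1 x.2)
  have hF : ∀ x ∈ robinSpace R α, ∀ y ∈ robinSpace R α, ∀ c : ℝ, F (c • x + y) = c • F x + F y := by
    rintro x ⟨_, _, h⟩ y ⟨_, _, k⟩ c
    exact Prod.ext (h.robinSol_combo k h0 h1 hR c) (h.robinG_combo k h0 h1 hR c)
  have hF0 : F 0 = 0 := by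
    have := hF 0 (zero_mem _) 0 (zero_mem _) 1
    simpa using this
  let T₀ : robinSpace R α →ₗ[ℝ] (ℂ → ℝ) × ℝ :=
    { toFun := fun x => F x
      map_add' := fun x y => by simpa using hF x x.2 y y.2 1
      map_smul' := fun c x => by simpa [hF0] using hF x x.2 0 (zero_mem _) c }
  obtain ⟨T, hT⟩ := T₀.exists_extend
  exact ⟨T, fun f₁ f₂ M₁ M₂ h => LinearMap.congr_fun hT ⟨(f₁, f₂), M₁, M₂, h⟩⟩

end Operator

end RobinProblem

/-- solvability, with estimates and a linear solution operator, of the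
projected Robin problem on the disk `B_R`.  Data: `f₁` is `α`-Hölder on the closed ball,
`f₂` is `C^{1,α}` on the circle (parametrized by `θ ↦ R e^{iθ}`, `2π`-periodic); both are
even in `x₁` (for `f₂` this reads `f₂(π − θ) = f₂(θ)`); the Hölder data is encoded by any
bounds `M₁, M₂`. The solution `(φ, g) = T (f₁, f₂)` depends linearly on `(f₁, f₂)`, `φ` is
even in `x₁` and `C^{2,α}` on the closed ball, `Δφ = f₁` in `B_R`,
`∂φ/∂ν − φ/R = f₂ + g(x₂ + R)` on `∂B_R`, and
`‖φ‖_{C^{2,α}} + |g| ≤ C(‖f₁‖_{C^α} + ‖f₂‖_{C^{1,α}})`. -/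
theorem statement19 (R α : ℝ) (hR : 0 < R) (hα0 : 0 < α) (hα1 : α < 1) :
    ∃ C : ℝ, 0 < C ∧
      ∃ T : ((ℂ → ℝ) × (ℝ → ℝ)) →ₗ[ℝ] ((ℂ → ℝ) × ℝ),
        ∀ (f₁ : ℂ → ℝ) (f₂ : ℝ → ℝ) (M₁ M₂ : ℝ),
          (∀ z : ℂ, f₁ (-(starRingEnd ℂ z)) = f₁ z) →
          (∀ z ∈ Metric.closedBall (0 : ℂ) R, |f₁ z| ≤ M₁) →
          (∀ z₁ ∈ Metric.closedBall (0 : ℂ) R, ∀ z₂ ∈ Metric.closedBall (0 : ℂ) R,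
            |f₁ z₁ - f₁ z₂| ≤ M₁ * ‖z₁ - z₂‖ ^ α) →
          ContDiff ℝ 1 f₂ →
          (∀ θ : ℝ, f₂ (θ + 2 * Real.pi) = f₂ θ) →
          (∀ θ : ℝ, f₂ (Real.pi - θ) = f₂ θ) →
          (∀ θ : ℝ, |f₂ θ| ≤ M₂) →
          (∀ θ : ℝ, |deriv f₂ θ| ≤ M₂) →
          (∀ θ₁ θ₂ : ℝ, |deriv f₂ θ₁ - deriv f₂ θ₂| ≤ M₂ * |θ₁ - θ₂| ^ α) →
          (∀ z : ℂ, (T (f₁, f₂)).1 (-(starRingEnd ℂ z)) = (T (f₁, f₂)).1 z) ∧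
          ContDiffOn ℝ 2 (T (f₁, f₂)).1 (Metric.closedBall (0 : ℂ) R) ∧
          (∀ z ∈ Metric.ball (0 : ℂ) R, lap (T (f₁, f₂)).1 z = f₁ z) ∧
          (∀ θ : ℝ,
            fderivWithin ℝ (T (f₁, f₂)).1 (Metric.closedBall (0 : ℂ) R)
                ((R : ℂ) * Complex.exp ((θ : ℂ) * Complex.I))
                (Complex.exp ((θ : ℂ) * Complex.I)) -
              (T (f₁, f₂)).1 ((R : ℂ) * Complex.exp ((θ : ℂ) * Complex.I)) / R =
              f₂ θ + (T (f₁, f₂)).2 * (R * Real.sin θ + R)) ∧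
          (∀ z ∈ Metric.closedBall (0 : ℂ) R,
            |(T (f₁, f₂)).1 z| ≤ C * (M₁ + M₂) ∧
            ‖fderivWithin ℝ (T (f₁, f₂)).1 (Metric.closedBall (0 : ℂ) R) z‖ ≤
              C * (M₁ + M₂) ∧
            ‖iteratedFDerivWithin ℝ 2 (T (f₁, f₂)).1 (Metric.closedBall (0 : ℂ) R) z‖ ≤
              C * (M₁ + M₂)) ∧
          (∀ z₁ ∈ Metric.closedBall (0 : ℂ) R, ∀ z₂ ∈ Metric.closedBall (0 : ℂ) R,
            ‖iteratedFDerivWithin ℝ 2 (T (f₁, f₂)).1 (Metric.closedBall (0 : ℂ) R) z₁ -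
                iteratedFDerivWithin ℝ 2 (T (f₁, f₂)).1 (Metric.closedBall (0 : ℂ) R) z₂‖ ≤
              C * (M₁ + M₂) * ‖z₁ - z₂‖ ^ α) ∧
          |(T (f₁, f₂)).2| ≤ C * (M₁ + M₂) := by
  have hs := solConst_nonneg hα0 hR
  have hg : 0 ≤ 2 * circleConst α R / R ^ 2 := by
    have := circleConst_nonneg (α := α) hR
    positivity
  set C := 2 * solConst α R + 2 * circleConst α R / R ^ 2 + 1 with hC
  obtain ⟨T, hT⟩ := exists_robin_linearMap hα0 hα1 hR
  refine ⟨C, by positivity, T, fun f₁ f₂ M₁ M₂ h₁ h₂ h₃ h₄ h₅ h₆ h₇ h₈ h₉ => ?_⟩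
  have h : IsRobinData R α M₁ M₂ f₁ f₂ := ⟨h₁, h₂, h₃, h₄, h₅, h₆, h₇, h₈, h₉⟩
  obtain ⟨p, a, b, hS, hb, hp⟩ := h.exists_isC2Holder hα0 hα1 hR
  have hu := uniqueDiffOn_closedBall hR
  have hM : 0 ≤ M₁ + M₂ := add_nonneg (h.nonneg_left hR) h.nonneg_right
  have hK : 2 * (solConst α R * (M₁ + M₂)) ≤ C * (M₁ + M₂) := by
    rw [← mul_assoc]
    exact mul_le_mul_of_nonneg_right (by linarith) hM
  have hK' : solConst α R * (M₁ + M₂) ≤ C * (M₁ + M₂) :=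
    mul_le_mul_of_nonneg_right (by linarith) hM
  rw [hT f₁ f₂ M₁ M₂ h]
  refine ⟨robinSol_neg_conj R f₁ f₂, hS.contDiffOn hu hα0, fun z hz => ?_, fun θ => ?_,
    fun z hz => ⟨(hS.bound z hz).trans hK', ?_,
      (hS.norm_iteratedFDerivWithin_two_le hu hz).trans hK⟩, fun z hz w hw => ?_, ?_⟩
  · rw [hS.lap_eq (Filter.mem_of_superset (isOpen_ball.mem_nhds hz) ball_subset_closedBall),
      hb z hz]
  · have hz : (R : ℂ) * cexpI θ ∈ closedBall (0 : ℂ) R := by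
      rw [mem_closedBall_zero_iff, norm_mul, norm_cexpI, norm_real, mul_one,
        Real.norm_of_nonneg hR.le]
    rw [← cexpI, hS.fderivWithin_eq hu hz, reMulCLM_apply, hp]
  · rw [hS.fderivWithin_eq hu hz]
    exact ((norm_reMulCLM_le _).trans (hS.bound_p z hz)).trans hK'
  · exact (hS.norm_iteratedFDerivWithin_two_sub_le hu hz hw).trans (by gcongr)
  · exact (h.abs_robinG_le hα0 hα1 hR).trans (mul_le_mul_of_nonneg_right (by linarith) hM)
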